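/- For any word w over the positive integers and any crystal operator e_i, the RSK recording tableau and the shifted mixed insertion recording tableau are invariant under e_i: Q(e_i(w)) = Q(w) and Q'(e_i(w)) = Q'(w). -/

import Mathlib

/-! ### Insertion machinery: tableaux as lists of rows of naturals -/

/-- Set position `j` of the list `l` to `v`, padding with `0`s if necessary. -/
def padSet (l : List ℕ) (j v : ℕ) : List ℕ :=
  if j < l.length then l.set j v else l ++ List.replicate (j - l.length) 0 ++ [v]

/-- Set the box in row `r`, (row-relative) position `j`, of the tableau `T` to `v`,
adding new rows if necessary. -/
def setBox (T : List (List ℕ)) (r j v : ℕ) : List (List ℕ) :=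
  let T' := if r < T.length then T else T ++ List.replicate (r + 1 - T.length) ([] : List ℕ)
  T'.set r (padSet (T'.getD r []) j v)

/-- The number of boxes of a tableau. -/
def tsize (T : List (List ℕ)) : ℕ := (T.map List.length).sum

/-- RSK row insertion of a letter `x` into a tableau: `x` bumps the leftmost entry of the
first row that is strictly greater than `x`; the bumped entry is inserted into the next row,
and so on; a letter bumping nothing is placed at the end of the row. -/
def rskInsert (x : ℕ) : List (List ℕ) → List (List ℕ)
  | [] => [[x]]
  | row :: rest =>
    match row.findIdx? (fun z => decide (x < z)) with
    | none => (row ++ [x]) :: rest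
    | some j => row.set j x :: rskInsert (row.getD j 0) rest

/-- The (unique) cell where the shapes of the tableaux `T` and `T'` differ,
when `T'` is obtained from `T` by one insertion. -/
def newCell (T T' : List (List ℕ)) : ℕ × ℕ :=
  let r := (List.range T'.length).findIdx
    (fun r => decide ((T.getD r []).length ≠ (T'.getD r []).length))
  (r, (T.getD r []).length)

/-- The RSK insertion tableau `P(w)` and recording tableau `Q(w)` of a word `w`. -/
def rskPQ (w : List ℕ) : List (List ℕ) × List (List ℕ) :=
  w.foldl
    (fun PQ x =>
      let P' := rskInsert x PQ.1
      let c := newCell PQ.1 P'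
      (P', setBox PQ.2 c.1 c.2 (tsize PQ.2 + 1)))
    ([], [])

/-- The RSK insertion tableau `P(w)` of the word `w`. -/
def rskP (w : List ℕ) : List (List ℕ) := (rskPQ w).1

/-- The RSK recording tableau `Q(w)` of the word `w`. -/
def rskQ (w : List ℕ) : List (List ℕ) := (rskPQ w).2

/-! Shifted mixed insertion (Haiman; semistandard version of Serrano).

A shifted tableau is stored as a list of rows, row `r` occupying the (absolute) columns
`r, r+1, …`.  Entries are encoded so that primed letters can be handled: the unprimed
letter `k` is stored as `2k` and the primed letter `k'` is stored as `2k - 1`; this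
encoding is order-preserving for the alphabet `1' < 1 < 2' < 2 < ⋯`. -/

/-- The entry of a shifted tableau `T` in row `r` and (absolute) column `c`, with `0`
meaning that there is no such box. -/
def sEntry (T : List (List ℕ)) (r c : ℕ) : ℕ := (T.getD r []).getD (c - r) 0

/-- One step of shifted mixed insertion, with `fuel` bounding the bumping chain.
If `isRow = true`, the (unprimed) value `v` is inserted into row `i`, bumping the leftmost
entry strictly greater than `v`; if `isRow = false`, the (primed) value `v` is inserted into
column `i`, bumping the topmost entry strictly greater than `v`; a value bumping nothing is
placed at the end of the row resp. the bottom of the column, ending the insertion.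
An entry bumped from the main diagonal becomes primed.  A bumped unprimed entry is inserted
into the next row; a bumped primed entry is inserted into the next column.
Returns the new tableau and the cell `(row, column)` where the insertion terminated. -/
def mixedIns : ℕ → List (List ℕ) → Bool → ℕ → ℕ → List (List ℕ) × (ℕ × ℕ)
  | 0, T, _, _, _ => (T, (0, 0))
  | fuel+1, T, true, r, v =>
    let row := T.getD r []
    match row.findIdx? (fun z => decide (v < z)) with
    | none => (setBox T r row.length v, (r, r + row.length))
    | some j =>
      let z := row.getD j 0
      let T' := T.set r (row.set j v)
      let z' := if j = 0 ∧ z % 2 = 0 then z - 1 else z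
      if z' % 2 = 0 then mixedIns fuel T' true (r+1) z'
      else mixedIns fuel T' false (r + j + 1) z'
  | fuel+1, T, false, c, v =>
    match (List.range (c+1)).find? (fun r =>
        decide (c - r < (T.getD r []).length) && decide (v < sEntry T r c)) with
    | some r =>
      let z := sEntry T r c
      let T' := setBox T r (c - r) v
      let z' := if r = c ∧ z % 2 = 0 then z - 1 else z
      if z' % 2 = 0 then mixedIns fuel T' true (r+1) z'
      else mixedIns fuel T' false (c+1) z'
    | none =>
      let r := (List.range (c+1)).findIdx (fun r => decide ((T.getD r []).length ≤ c - r))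
      (setBox T r (c - r) v, (r, c))

/-- Shifted mixed insertion of the letter `x` into the shifted tableau `T`:
the new insertion tableau together with the new cell. -/
def mixedInsLetter (T : List (List ℕ)) (x : ℕ) : List (List ℕ) × (ℕ × ℕ) :=
  mixedIns (tsize T + 2) T true 0 (2 * x)

/-- The shifted mixed insertion tableau `P'(w)` (with primed entries encoded as above) and
the standard shifted recording tableau `Q'(w)` of a word `w`. -/
def mixedPQ (w : List ℕ) : List (List ℕ) × List (List ℕ) :=
  w.foldl
    (fun PQ x =>
      let s := mixedInsLetter PQ.1 x
      (s.1, setBox PQ.2 s.2.1 (s.2.2 - s.2.1) (tsize PQ.2 + 1)))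
    ([], [])

/-- The shifted mixed insertion tableau `P'(w)` of the word `w`. -/
def mixedP (w : List ℕ) : List (List ℕ) := (mixedPQ w).1

/-- The shifted mixed insertion recording tableau `Q'(w)` of the word `w`. -/
def mixedQ (w : List ℕ) : List (List ℕ) := (mixedPQ w).2

/-- View a straight-shape tableau (list of rows) as a filling `ℕ × ℕ → ℕ`. -/
def toFunStraight (T : List (List ℕ)) : (ℕ × ℕ) → ℕ := fun c => (T.getD c.1 []).getD c.2 0

/-- View a shifted tableau (list of rows, row `r` starting in column `r`) as a filling
`ℕ × ℕ → ℕ`. -/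
def toFunShifted (T : List (List ℕ)) : (ℕ × ℕ) → ℕ :=
  fun c => if c.1 ≤ c.2 then (T.getD c.1 []).getD (c.2 - c.1) 0 else 0

/-! ### Words, crystal operators, and the major index -/

/-- The position (if any) of the rightmost letter `j` of `w` that is unpaired in the
bracket pairing of the letters `j+1` (opening brackets) and `j` (closing brackets) of `w`. -/
def unpairedPos (j : ℕ) (w : List ℕ) : Option ℕ :=
  (((List.range w.length).zip w).foldl
    (fun (s : ℕ × Option ℕ) p =>
      if p.2 = j + 1 then (s.1 + 1, s.2)
      else if p.2 = j then (if 0 < s.1 then (s.1 - 1, s.2) else (0, some p.1))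
      else s)
    (0, none)).2

/-- The crystal raising operator `e_j` on words: in the subword of `w` formed by the letters
`j` and `j+1`, pair each `j+1` (opening bracket) with a `j` (closing bracket); the unpaired
letters form a subword `j^r (j+1)^s`, and `e_j` changes this subword into
`j^(r-1) (j+1)^(s+1)`, i.e. it turns the last unpaired `j` into a `j+1`, leaving the rest
of `w` unchanged.  (If `r = 0`, we let `e_j` fix `w`.) -/
def cryE (j : ℕ) (w : List ℕ) : List ℕ :=
  match unpairedPos j w with
  | none => w
  | some i => w.set i (j + 1)

/-- The composite operator `ē = e_1 ∘ e_2 ∘ ⋯ ∘ e_(n-1)` (applying `e_(n-1)` first). -/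
def cryEbar (n : ℕ) (w : List ℕ) : List ℕ :=
  (List.range (n - 1)).reverse.foldl (fun v i => cryE (i + 1) v) w

/-- A square word of order `n`: a word with exactly `n` copies of each of the letters
`1, …, n` (and no other letters), such that every initial segment contains at least as
many letters `j+1` as letters `j`, for every `j`. -/
def IsSquareWord (n : ℕ) (w : List ℕ) : Prop :=
  w.length = n * n ∧
  (∀ j, 1 ≤ j → j ≤ n → w.count j = n) ∧
  (∀ k j, 1 ≤ j → j < n → (w.take k).count j ≤ (w.take k).count (j + 1))

/-- The major index of a word `v = v_1 v_2 ⋯ v_l`: the sum of the descent positions,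
i.e. of the positions `i` (`1 ≤ i ≤ l - 1`) such that `v_i > v_(i+1)`. -/
def majW (v : List ℕ) : ℕ :=
  ∑ i ∈ Finset.range v.length, if 0 < i ∧ v.getD i 0 < v.getD (i-1) 0 then i else 0

/-! ### Part A: Knuth equivalence of words of positions -/

/-- Knuth equivalence of words of natural numbers. -/
inductive Plac : List ℕ → List ℕ → Prop
  | refl (u : List ℕ) : Plac u u
  | symm {u v : List ℕ} : Plac u v → Plac v u
  | trans {u v w : List ℕ} : Plac u v → Plac v w → Plac u w
  | k1 (X Y : List ℕ) (a b c : ℕ) : a < b → b < c →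
      Plac (X ++ b :: a :: c :: Y) (X ++ b :: c :: a :: Y)
  | k2 (X Y : List ℕ) (a b c : ℕ) : a < b → b < c →
      Plac (X ++ a :: c :: b :: Y) (X ++ c :: a :: b :: Y)

theorem Plac.cong {u v : List ℕ} (h : Plac u v) (x y : List ℕ) :
    Plac (x ++ u ++ y) (x ++ v ++ y) := by
  induction h with
  | refl u => exact Plac.refl _
  | symm _ ih => exact ih.symm
  | trans _ _ ih1 ih2 => exact ih1.trans ih2
  | k1 X Y a b c h1 h2 =>
    have := Plac.k1 (x ++ X) (Y ++ y) a b c h1 h2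
    simpa using this
  | k2 X Y a b c h1 h2 =>
    have := Plac.k2 (x ++ X) (Y ++ y) a b c h1 h2
    simpa using this

theorem Plac.congL {u v : List ℕ} (h : Plac u v) (x : List ℕ) : Plac (x ++ u) (x ++ v) := by
  simpa using h.cong x []

theorem Plac.congR {u v : List ℕ} (h : Plac u v) (y : List ℕ) : Plac (u ++ y) (v ++ y) := by
  simpa using h.cong [] y

theorem Plac.of_eq {u v : List ℕ} (h : u = v) : Plac u v := h ▸ Plac.refl _

theorem Plac.perm {u v : List ℕ} (h : Plac u v) : u.Perm v := by
  induction h with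
  | refl u => exact List.Perm.refl _
  | symm _ ih => exact ih.symm
  | trans _ _ ih1 ih2 => exact ih1.trans ih2
  | k1 X Y a b c h1 h2 =>
    exact List.Perm.append_left _ (List.Perm.cons _ (List.Perm.swap _ _ _))
  | k2 X Y a b c h1 h2 =>
    exact List.Perm.append_left _ (List.Perm.swap _ _ _)

theorem Plac.map {u v : List ℕ} (h : Plac u v) (f : ℕ → ℕ) (hf : StrictMono f) :
    Plac (u.map f) (v.map f) := by
  induction h with
  | refl u => exact Plac.refl _
  | symm _ ih => exact ih.symm
  | trans _ _ ih1 ih2 => exact ih1.trans ih2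
  | k1 X Y a b c h1 h2 =>
    simpa using Plac.k1 (X.map f) (Y.map f) _ _ _ (hf h1) (hf h2)
  | k2 X Y a b c h1 h2 =>
    simpa using Plac.k2 (X.map f) (Y.map f) _ _ _ (hf h1) (hf h2)

theorem plac_mv1 (x : ℕ) : ∀ (B : List ℕ) (a : ℕ), x < a → (a :: B).Pairwise (· < ·) →
    Plac (a :: B ++ [x]) (a :: x :: B)
  | [], _, _, _ => Plac.refl _
  | b :: B, a, hx, hp => by
    have hab : a < b := by
      have := (List.pairwise_cons.1 hp).1 b (by simp); exact this
    have ih := plac_mv1 x B b (hx.trans hab) (List.pairwise_cons.1 hp).2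
    have h1 := ih.congL [a]
    have h2 := (Plac.k1 [] B x a b hx hab).symm
    exact Plac.trans (by simpa using h1) (by simpa using h2)

theorem plac_mv2 (a x : ℕ) (hx : x < a) : ∀ (A : List ℕ), (A ++ [x]).Pairwise (· < ·) →
    Plac (A ++ [a, x]) (a :: A ++ [x])
  | [], _ => Plac.refl _
  | a1 :: A, hp => by
    have hp' : (A ++ [x]).Pairwise (· < ·) := by
      have := List.pairwise_cons.1 (by simpa using hp : (a1 :: (A ++ [x])).Pairwise (· < ·))
      exact this.2
    have h0 := (List.pairwise_cons.1 (by simpa using hp : (a1 :: (A ++ [x])).Pairwise (· < ·))).1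
    have ih := plac_mv2 a x hx A hp'
    have h1 := ih.congL [a1]
    refine Plac.trans (by simpa using h1) ?_
    cases A with
    | nil =>
      have := Plac.k2 [] [] a1 x a (h0 x (by simp)) hx
      simpa using this
    | cons y A =>
      have hyx : y < x := by
        have := (List.pairwise_cons.1 (by simpa using hp' : (y :: (A ++ [x])).Pairwise (· < ·))).1
        exact this x (by simp)
      have := Plac.k2 [] (A ++ [x]) a1 y a (h0 y (by simp)) (hyx.trans hx)
      simpa using this

/-- Moving a larger increasing word past `v`. -/
def PS1 (n : ℕ) (u v : List ℕ) : Prop :=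
  ∀ Y : List ℕ, Y.Pairwise (· < ·) → (∀ y ∈ Y, n ≤ y) → Plac (u ++ Y ++ v) (u ++ v ++ Y)

theorem PS1.mono {n m : ℕ} {u v : List ℕ} (h : PS1 n u v) (hnm : n ≤ m) : PS1 m u v :=
  fun Y h1 h2 => h Y h1 (fun y hy => hnm.trans (h2 y hy))

theorem PS1.close0 {n : ℕ} {u v : List ℕ} (h : PS1 n u v) : PS1 (n + 1) (u ++ [n]) v := by
  intro Y h1 h2
  have a1 := h (n :: Y) (List.pairwise_cons.2 ⟨fun y hy => by have := h2 y hy; omega, h1⟩)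
    (by intro y hy; rcases List.mem_cons.1 hy with rfl | hy
        · exact le_rfl
        · have := h2 y hy; omega)
  have a2 := (h [n] (by simp) (by simp)).symm.congR Y
  exact Plac.trans (by simpa using a1) (by simpa using a2)

theorem PS1.close1 {n x : ℕ} {u v : List ℕ} (h : PS1 n u v) (hx : x < n) :
    PS1 (n + 1) (u ++ [n]) (v ++ [x]) := by
  intro Y h1 h2
  have hnY : (n :: Y).Pairwise (· < ·) :=
    List.pairwise_cons.2 ⟨fun y hy => by have := h2 y hy; omega, h1⟩
  have a1 := (h (n :: Y) hnY
    (by intro y hy; rcases List.mem_cons.1 hy with rfl | hy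
        · exact le_rfl
        · have := h2 y hy; omega)).congR [x]
  have a2 := (plac_mv1 x Y n hx hnY).congL (u ++ v)
  have a3 := (h [n] (by simp) (by simp)).symm.congR (x :: Y)
  refine Plac.trans (by simpa using a1) (Plac.trans (by simpa using a2) (by simpa using a3))

theorem PS2.close {n x : ℕ} {A u v : List ℕ} (h1 : PS1 n u v)
    (h2 : Plac (A ++ u ++ v) (u ++ A ++ v)) (hx : x < n)
    (hs : (A ++ v ++ [x]).Pairwise (· < ·)) :
    Plac (A ++ (u ++ [n]) ++ (v ++ [x])) ((u ++ [n]) ++ A ++ (v ++ [x])) := by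
  have a1 := (h1 [n] (by simp) (by simp)).cong A [x]
  have a2 := h2.congR [n, x]
  have a3 := (plac_mv2 n x hx (A ++ v) hs).congL u
  refine Plac.trans (by simpa using a1) (Plac.trans (by simpa using a2) (by simpa using a3))

/-- The positions of the letter `k` in `w`. -/
def posOf (k : ℕ) (w : List ℕ) : List ℕ :=
  (List.range w.length).filter (fun i => decide (w[i]? = some k))

theorem posOf_sorted (k : ℕ) (w : List ℕ) : (posOf k w).Pairwise (· < ·) :=
  List.Pairwise.filter _ List.pairwise_lt_range

theorem mem_posOf {k i : ℕ} {w : List ℕ} : i ∈ posOf k w ↔ w[i]? = some k := by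
  simp only [posOf, List.mem_filter, List.mem_range, decide_eq_true_eq, and_iff_right_iff_imp]
  intro h
  by_contra hc
  rw [List.getElem?_eq_none (by omega)] at h
  cases h

theorem posOf_lt {k i : ℕ} {w : List ℕ} (h : i ∈ posOf k w) : i < w.length := by
  simp only [posOf, List.mem_filter, List.mem_range] at h
  exact h.1

theorem posOf_snoc (k x : ℕ) (w : List ℕ) :
    posOf k (w ++ [x]) = posOf k w ++ if x = k then [w.length] else [] := by
  unfold posOf
  rw [List.length_append, List.length_singleton, List.range_succ, List.filter_append]
  congr 1
  · apply List.filter_congr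
    intro i hi
    rw [List.mem_range] at hi
    rw [List.getElem?_append_left hi]
  · by_cases h : x = k <;> simp [h]

theorem sorted_ext {u v : List ℕ} (hu : u.Pairwise (· < ·)) (hv : v.Pairwise (· < ·))
    (h : ∀ x, x ∈ u ↔ x ∈ v) : u = v := by
  apply List.Perm.eq_of_pairwise (le := (· < ·)) _ hu hv
  · exact (List.perm_ext_iff_of_nodup (hu.imp (fun h => ne_of_lt h)) (hv.imp (fun h => ne_of_lt h))).2 h
  · intro a b _ _ h1 h2; omega

/-- The state of the bracketing fold. -/
def brState (j : ℕ) (w : List ℕ) : ℕ × Option ℕ :=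
  ((List.range w.length).zip w).foldl
    (fun (s : ℕ × Option ℕ) p =>
      if p.2 = j + 1 then (s.1 + 1, s.2)
      else if p.2 = j then (if 0 < s.1 then (s.1 - 1, s.2) else (0, some p.1))
      else s)
    (0, none)

theorem brState_snoc (j x : ℕ) (w : List ℕ) : brState j (w ++ [x]) =
    if x = j + 1 then ((brState j w).1 + 1, (brState j w).2)
    else if x = j then
      (if 0 < (brState j w).1 then ((brState j w).1 - 1, (brState j w).2) else (0, some w.length))
    else brState j w := by
  unfold brState
  rw [List.length_append, List.length_singleton, List.range_succ,
    List.zip_append (by simp), List.foldl_append]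
  rfl

structure BrInv (j : ℕ) (w : List ℕ) : Prop where
  h1 : ∃ v' v'', posOf (j + 1) w = v' ++ v'' ∧ v''.length = (brState j w).1 ∧
    PS1 w.length (posOf j w) v'
  h2 : ∀ i, (brState j w).2 = some i → ∃ u1 u2 v1 v' v'',
    posOf j w = u1 ++ i :: u2 ∧ posOf (j + 1) w = v1 ++ v' ++ v'' ∧
    v''.length = (brState j w).1 ∧ (∀ x ∈ v1, x < i) ∧ (∀ x ∈ v' ++ v'', i < x) ∧
    PS1 i u1 v1 ∧ PS1 w.length u2 v' ∧
    Plac ((v1 ++ [i]) ++ u2 ++ v') (u2 ++ (v1 ++ [i]) ++ v')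

theorem brInv (j : ℕ) (w : List ℕ) : BrInv j w := by
  induction w using List.reverseRecOn with
  | nil =>
    refine ⟨⟨[], [], rfl, rfl, ?_⟩, ?_⟩
    · intro Y _ _; simpa [posOf] using Plac.refl _
    · intro i hi; simp [brState] at hi
  | append_singleton w x ih =>
    obtain ⟨⟨p, q, hpq, hq, hS⟩, h2⟩ := ih
    have hlt : ∀ k, ∀ y ∈ posOf k w, y < w.length := fun k y hy => posOf_lt hy
    by_cases hx1 : x = j + 1
    · -- opening bracket
      have hxj : x ≠ j := by omega
      have e1 : posOf j (w ++ [x]) = posOf j w := by rw [posOf_snoc, if_neg hxj]; simp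
      have e2 : posOf (j + 1) (w ++ [x]) = posOf (j + 1) w ++ [w.length] := by
        rw [posOf_snoc, if_pos hx1]
      have e3 : brState j (w ++ [x]) = ((brState j w).1 + 1, (brState j w).2) := by
        rw [brState_snoc, if_pos hx1]
      constructor
      · refine ⟨p, q ++ [w.length], ?_, ?_, ?_⟩
        · rw [e2, hpq]; simp
        · rw [e3]; simp [hq]
        · rw [e1]; exact hS.mono (by simp)
      · intro i hi
        rw [e3] at hi
        obtain ⟨u1, u2, v1, v', v'', a1, a2, a3, a4, a5, a6, a7, a8⟩ := h2 i hi
        have hi' : i < w.length := hlt j i (by rw [a1]; simp)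
        refine ⟨u1, u2, v1, v', v'' ++ [w.length], ?_, ?_, ?_, a4, ?_, a6, a7.mono (by simp), a8⟩
        · rw [e1, a1]
        · rw [e2, a2]; simp
        · rw [e3]; simp [a3]
        · intro y hy
          rw [← List.append_assoc, List.mem_append] at hy
          rcases hy with hy | hy
          · exact a5 y hy
          · rw [List.mem_singleton] at hy; omega
    · have e2 : posOf (j + 1) (w ++ [x]) = posOf (j + 1) w := by
        rw [posOf_snoc, if_neg hx1]; simp
      by_cases hxj : x = j
      · have e1 : posOf j (w ++ [x]) = posOf j w ++ [w.length] := by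
          rw [posOf_snoc, if_pos hxj]
        by_cases hc : 0 < (brState j w).1
        · have e3 : brState j (w ++ [x]) = ((brState j w).1 - 1, (brState j w).2) := by
            rw [brState_snoc, if_neg hx1, if_pos hxj, if_pos hc]
          constructor
          · cases q with
            | nil => simp at hq; omega
            | cons y q =>
              refine ⟨p ++ [y], q, ?_, ?_, ?_⟩
              · rw [e2, hpq]; simp
              · rw [e3, ← hq]; simp
              · rw [e1, List.length_append, List.length_singleton]
                exact hS.close1 (hlt (j + 1) y (by rw [hpq]; simp))
          · intro i hi
            rw [e3] at hi
            obtain ⟨u1, u2, v1, v', v'', a1, a2, a3, a4, a5, a6, a7, a8⟩ := h2 i hi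
            cases v'' with
            | nil => simp at a3; omega
            | cons y v'' =>
              have hy : y < w.length := hlt (j + 1) y (by rw [a2]; simp)
              refine ⟨u1, u2 ++ [w.length], v1, v' ++ [y], v'', ?_, ?_, ?_, a4, ?_, a6, ?_, ?_⟩
              · rw [e1, a1]; simp
              · rw [e2, a2]; simp
              · rw [e3, ← a3]; simp
              · intro z hz; exact a5 z (by simpa using hz)
              · rw [List.length_append, List.length_singleton]
                exact a7.close1 hy
              · refine PS2.close a7 a8 hy ?_
                have hs := posOf_sorted (j + 1) w
                rw [a2] at hs
                have hs1 : (v1 ++ (v' ++ [y])).Pairwise (· < ·) := by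
                  refine hs.sublist ?_
                  simp
                rw [List.pairwise_append] at hs1
                have : (v1 ++ (i :: (v' ++ [y]))).Pairwise (· < ·) := by
                  rw [List.pairwise_append]
                  refine ⟨hs1.1, ?_, ?_⟩
                  · rw [List.pairwise_cons]
                    exact ⟨fun z hz => a5 z (by simp at hz ⊢; tauto), hs1.2.1⟩
                  · intro a ha b hb
                    rcases List.mem_cons.1 hb with rfl | hb
                    · exact a4 a ha
                    · exact hs1.2.2 a ha b hb
                simpa using this
        · have hc0 : (brState j w).1 = 0 := by omega
          have e3 : brState j (w ++ [x]) = (0, some w.length) := by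
            rw [brState_snoc, if_neg hx1, if_pos hxj, if_neg hc]
          have hq0 : q = [] := by rw [hc0] at hq; exact List.length_eq_zero_iff.1 hq
          subst hq0
          rw [List.append_nil] at hpq
          constructor
          · refine ⟨p, [], ?_, ?_, ?_⟩
            · rw [e2, hpq]; simp
            · rw [e3]; rfl
            · rw [e1, List.length_append, List.length_singleton]
              exact hS.close0
          · intro i hi
            rw [e3] at hi
            have hi : w.length = i := by simpa using hi
            subst hi
            refine ⟨posOf j w, [], p, [], [], e1, ?_, ?_, ?_, by simp, hS, ?_, ?_⟩
            · rw [e2, hpq]; simp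
            · rw [e3]; rfl
            · intro y hy; exact hlt (j + 1) y (by rw [hpq]; exact hy)
            · intro Y _ _; simpa using Plac.refl _
            · simpa using Plac.refl _
      · have e1 : posOf j (w ++ [x]) = posOf j w := by rw [posOf_snoc, if_neg hxj]; simp
        have e3 : brState j (w ++ [x]) = brState j w := by
          rw [brState_snoc, if_neg hx1, if_neg hxj]
        constructor
        · refine ⟨p, q, ?_, ?_, ?_⟩
          · rw [e2, hpq]
          · rw [e3, hq]
          · rw [e1]; exact hS.mono (by simp)
        · intro i hi
          rw [e3] at hi
          obtain ⟨u1, u2, v1, v', v'', a1, a2, a3, a4, a5, a6, a7, a8⟩ := h2 i hi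
          refine ⟨u1, u2, v1, v', v'', ?_, ?_, ?_, a4, a5, a6, a7.mono (by simp), a8⟩
          · rw [e1, a1]
          · rw [e2, a2]
          · rw [e3, a3]

theorem cryE_cases (j : ℕ) (w : List ℕ) :
    cryE j w = w ∨ ∃ i, (brState j w).2 = some i ∧ cryE j w = w.set i (j + 1) := by
  have h : unpairedPos j w = (brState j w).2 := rfl
  unfold cryE
  rw [h]
  cases h2 : (brState j w).2 with
  | none => left; rfl
  | some i => right; exact ⟨i, rfl, rfl⟩

theorem posOf_set {k i a b : ℕ} {w : List ℕ} (hi : w[i]? = some a) (x : ℕ) :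
    x ∈ posOf k (w.set i b) ↔ (if x = i then b = k else x ∈ posOf k w) := by
  rw [mem_posOf, mem_posOf, List.getElem?_set]
  have hil : i < w.length := by
    by_contra hc
    rw [List.getElem?_eq_none (by omega)] at hi
    cases hi
  by_cases h : i = x
  · subst h; simp [hil]
  · rw [if_neg h, if_neg (Ne.symm h)]

theorem cry_pos_other (j k : ℕ) (w : List ℕ) (hk : k ≠ j) (hk1 : k ≠ j + 1) :
    posOf k (cryE j w) = posOf k w := by
  rcases cryE_cases j w with h | ⟨i, hi, h⟩
  · rw [h]
  · rw [h]
    obtain ⟨u1, u2, v1, v', v'', a1, -⟩ := (brInv j w).h2 i hi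
    have hw : w[i]? = some j := mem_posOf.1 (by rw [a1]; simp)
    apply sorted_ext (posOf_sorted _ _) (posOf_sorted _ _)
    intro x
    rw [posOf_set hw]
    by_cases hx : x = i
    · subst hx
      rw [if_pos rfl, mem_posOf, hw]
      simp only [Option.some.injEq]
      constructor <;> intro h <;> omega
    · rw [if_neg hx]

theorem cry_plac (j : ℕ) (w : List ℕ) :
    Plac (posOf j (cryE j w) ++ posOf (j + 1) (cryE j w)) (posOf j w ++ posOf (j + 1) w) := by
  rcases cryE_cases j w with h | ⟨i, hi, h⟩
  · rw [h]; exact Plac.refl _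
  · obtain ⟨u1, u2, v1, v', v'', a1, a2, a3, a4, a5, a6, a7, a8⟩ := (brInv j w).h2 i hi
    have hw : w[i]? = some j := mem_posOf.1 (by rw [a1]; simp)
    have hsu := posOf_sorted j w
    have hsv := posOf_sorted (j + 1) w
    rw [a1] at hsu
    rw [a2, List.append_assoc] at hsv
    have hsu' := hsu
    rw [List.pairwise_append, List.pairwise_cons] at hsu'
    rw [List.pairwise_append] at hsv
    have b1 : posOf j (cryE j w) = u1 ++ u2 := by
      apply sorted_ext (posOf_sorted _ _) (hsu.sublist (by simp))
      intro x
      rw [h, posOf_set hw, a1]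
      by_cases hx : x = i
      · subst hx
        rw [if_pos rfl]
        constructor
        · intro h; omega
        · intro hm
          exfalso
          rcases List.mem_append.1 hm with hm | hm
          · have := hsu'.2.2 x hm x (by simp); omega
          · have := hsu'.2.1.1 x hm; omega
      · rw [if_neg hx]; simp [hx]
    have b2 : posOf (j + 1) (cryE j w) = v1 ++ i :: (v' ++ v'') := by
      apply sorted_ext (posOf_sorted _ _)
      · rw [List.pairwise_append, List.pairwise_cons]
        refine ⟨hsv.1, ⟨a5, hsv.2.1⟩, ?_⟩
        intro a ha b hb
        rcases List.mem_cons.1 hb with rfl | hb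
        · exact a4 a ha
        · exact hsv.2.2 a ha b hb
      · intro x
        rw [h, posOf_set hw, a2]
        by_cases hx : x = i
        · subst hx; simp
        · rw [if_neg hx]; simp [hx]
    rw [b1, b2, a1, a2]
    have c1 := (a6 (i :: u2) (List.pairwise_cons.2 hsu'.2.1) (by
      intro y hy
      rcases List.mem_cons.1 hy with rfl | hy
      · exact le_rfl
      · exact (hsu'.2.1.1 y hy).le)).congR (v' ++ v'')
    have c2 := a8.cong u1 v''
    exact (Plac.trans (by simpa using c1) (by simpa using c2)).symm

/-- The standardization of a word: its positions sorted by letter, then by position. -/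
def stdTimes (K : ℕ) (w : List ℕ) : List ℕ :=
  (List.range K).flatMap (fun k => posOf k w)

theorem cry_stdTimes (j K : ℕ) (w : List ℕ) (hK : j + 2 ≤ K) :
    Plac (stdTimes K (cryE j w)) (stdTimes K w) := by
  obtain ⟨d, rfl⟩ := Nat.exists_eq_add_of_le hK
  have hr : List.range (j + 2 + d) = List.range j ++ [j, j + 1] ++
      (List.range d).map (fun x => j + 2 + x) := by
    rw [List.range_add, List.range_succ, List.range_succ]; simp
  unfold stdTimes
  rw [hr]
  simp only [List.flatMap_append, List.flatMap_cons, List.flatMap_nil, List.append_nil]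
  have e1 : (List.range j).flatMap (fun k => posOf k (cryE j w)) =
      (List.range j).flatMap (fun k => posOf k w) := by
    apply List.flatMap_congr
    intro k hk
    rw [List.mem_range] at hk
    exact cry_pos_other j k w (by omega) (by omega)
  have e2 : ((List.range d).map (fun x => j + 2 + x)).flatMap (fun k => posOf k (cryE j w)) =
      ((List.range d).map (fun x => j + 2 + x)).flatMap (fun k => posOf k w) := by
    apply List.flatMap_congr
    intro k hk
    rw [List.mem_map] at hk
    obtain ⟨a, _, rfl⟩ := hk
    exact cry_pos_other j _ w (by omega) (by omega)
  rw [e1, e2]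
  exact (cry_plac j w).cong _ _

/-! ### Part B: the row machine -/

def nst (i : Bool) (s x : Option ℕ) : Option ℕ :=
  if i then some 0 else if x = s then x.map (· + 1) else s

def nout (i : Bool) (s x : Option ℕ) : Option ℕ :=
  if i then some 0 else if x = s then x.map (· + 1) else x

def rowSt (m : ℕ) (xs : ℕ → Option ℕ) : ℕ → Option ℕ
  | 0 => none
  | t + 1 => nst (decide (t = m)) (rowSt m xs t) (xs t)

def rowOut (m : ℕ) (xs : ℕ → Option ℕ) (t : ℕ) : Option ℕ :=
  nout (decide (t = m)) (rowSt m xs t) (xs t)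

theorem rowSt_succ (m : ℕ) (xs : ℕ → Option ℕ) (t : ℕ) :
    rowSt m xs (t + 1) = nst (decide (t = m)) (rowSt m xs t) (xs t) := rfl

def ltO : Option ℕ → Option ℕ → Prop
  | some p, some q => p < q
  | _, _ => False

def leO : Option ℕ → Option ℕ → Prop
  | some p, some q => p ≤ q
  | _, _ => False

/-- Relation for the first Knuth move. -/
def K1 (a b c t : ℕ) (s1 s2 s3 s2' s3' : Option ℕ) : Prop :=
  (t ≤ a ∧ s1 = none ∧ s2 = none ∧ s3 = none ∧ s2' = none ∧ s3' = none) ∨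
  (a < t ∧ t ≤ b ∧ s1 = none ∧ s2 = s3' ∧ s2.isSome ∧ s3 = none ∧ s2' = none) ∨
  (b < t ∧ t ≤ c ∧ s3 = none ∧ s2' = none ∧ s2 = s3' ∧ ltO s1 s2) ∨
  (c < t ∧ s2 = s3' ∧ s3 = s2' ∧ leO s3 s1 ∧ ltO s1 s2)

theorem K1_step {a b c t : ℕ} (hab : a < b) (hbc : b < c) {s1 s2 s3 s2' s3' x : Option ℕ}
    (hx : t = a ∨ t = b ∨ t = c → x = none)
    (h : K1 a b c t s1 s2 s3 s2' s3') {y u v w w'}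
    (hy : y = nout (decide (t = b)) s1 x)
    (hu : u = nout (decide (t = a)) s2 y)
    (hw : w = nout (decide (t = c)) s3 u)
    (hv : v = nout (decide (t = c)) s2' y)
    (hw' : w' = nout (decide (t = a)) s3' v) :
    w = w' ∧ K1 a b c (t + 1) (nst (decide (t = b)) s1 x) (nst (decide (t = a)) s2 y)
      (nst (decide (t = c)) s3 u) (nst (decide (t = c)) s2' y) (nst (decide (t = a)) s3' v) := by
  unfold nout at *
  unfold nst K1 at *
  subst hy hu hw hv hw'
  rcases h with ⟨h0, rfl, rfl, rfl, rfl, rfl⟩ | ⟨h0, h1, rfl, rfl, h2, rfl, rfl⟩ |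
    ⟨h0, h1, rfl, rfl, rfl, h2⟩ | ⟨h0, rfl, rfl, h2, h3⟩
  · cases x <;> grind
  · rcases s2 with _ | q
    · simp at h2
    · cases x <;> grind [ltO]
  · rcases s1 with _ | p <;> rcases s2 with _ | q <;> simp only [ltO] at h2
    cases x <;> grind [ltO, leO]
  · rcases s1 with _ | p <;> rcases s2 with _ | q <;> rcases s3 with _ | r <;> simp only [ltO, leO] at h2 h3
    cases x <;> grind [ltO, leO]

theorem K1_inv {a b c : ℕ} (hab : a < b) (hbc : b < c) (xs : ℕ → Option ℕ)
    (ha : xs a = none) (hb : xs b = none) (hc : xs c = none) (t : ℕ) :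
    K1 a b c t (rowSt b xs t) (rowSt a (rowOut b xs) t) (rowSt c (rowOut a (rowOut b xs)) t)
      (rowSt c (rowOut b xs) t) (rowSt a (rowOut c (rowOut b xs)) t) := by
  induction t with
  | zero => left; simp [rowSt]
  | succ t ih =>
    exact (K1_step hab hbc (x := xs t) (by rintro (rfl | rfl | rfl) <;> assumption) ih
      rfl rfl rfl rfl rfl).2

theorem rowOut_K1 {a b c : ℕ} (hab : a < b) (hbc : b < c) (xs : ℕ → Option ℕ)
    (ha : xs a = none) (hb : xs b = none) (hc : xs c = none) :
    rowOut c (rowOut a (rowOut b xs)) = rowOut a (rowOut c (rowOut b xs)) := by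
  funext t
  exact (K1_step hab hbc (x := xs t) (by rintro (rfl | rfl | rfl) <;> assumption)
    (K1_inv hab hbc xs ha hb hc t) rfl rfl rfl rfl rfl).1

/-- Relation for the second Knuth move. -/
def K2 (a b c t : ℕ) (s1 s2 s3 s1' s2' s3' : Option ℕ) : Prop :=
  (t ≤ a ∧ s1 = none ∧ s2 = none ∧ s3 = none ∧ s1' = none ∧ s2' = none ∧ s3' = none) ∨
  (a < t ∧ t ≤ b ∧ s1 = s2' ∧ s1.isSome ∧ s2 = none ∧ s3 = none ∧ s1' = none ∧ s3' = none) ∨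
  (b < t ∧ t ≤ c ∧ s2 = none ∧ s1' = none ∧ s1 = s2' ∧ s3 = s3' ∧ leO s3 s1) ∨
  (c < t ∧ s1 = s2' ∧ s2 = s1' ∧ s3 = s3' ∧ ltO s2 s3 ∧ leO s3 s1) ∨
  (c < t ∧ s1 = s1' ∧ s2 = s3' ∧ s3 = s2' ∧ leO s2 s1 ∧ ltO s1 s3)

theorem K2_step {a b c t : ℕ} (hab : a < b) (hbc : b < c) {s1 s2 s3 s1' s2' s3' x : Option ℕ}
    (hx : t = a ∨ t = b ∨ t = c → x = none)
    (h : K2 a b c t s1 s2 s3 s1' s2' s3') {y u y' u' w w'}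
    (hy : y = nout (decide (t = a)) s1 x)
    (hu : u = nout (decide (t = c)) s2 y)
    (hw : w = nout (decide (t = b)) s3 u)
    (hy' : y' = nout (decide (t = c)) s1' x)
    (hu' : u' = nout (decide (t = a)) s2' y')
    (hw' : w' = nout (decide (t = b)) s3' u') :
    w = w' ∧ K2 a b c (t + 1) (nst (decide (t = a)) s1 x) (nst (decide (t = c)) s2 y)
      (nst (decide (t = b)) s3 u) (nst (decide (t = c)) s1' x) (nst (decide (t = a)) s2' y')
      (nst (decide (t = b)) s3' u') := by
  unfold nout at *
  unfold nst K2 at *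
  subst hy hu hw hy' hu' hw'
  rcases h with ⟨h0, rfl, rfl, rfl, rfl, rfl, rfl⟩ | ⟨h0, h1, rfl, h2, rfl, rfl, rfl, rfl⟩ |
    ⟨h0, h1, rfl, rfl, rfl, rfl, h2⟩ | ⟨h0, rfl, rfl, rfl, h2, h3⟩ | ⟨h0, rfl, rfl, rfl, h2, h3⟩
  · cases x <;> grind
  · rcases s1 with _ | q
    · simp at h2
    · cases x <;> grind [leO]
  · rcases s1 with _ | p <;> rcases s3 with _ | q <;> simp only [leO] at h2
    cases x <;> grind [ltO, leO]
  · rcases s1 with _ | p <;> rcases s2 with _ | q <;> rcases s3 with _ | r <;> simp only [ltO, leO] at h2 h3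
    cases x <;> grind [ltO, leO]
  · rcases s1 with _ | p <;> rcases s2 with _ | q <;> rcases s3 with _ | r <;> simp only [ltO, leO] at h2 h3
    cases x <;> grind [ltO, leO]

theorem K2_inv {a b c : ℕ} (hab : a < b) (hbc : b < c) (xs : ℕ → Option ℕ)
    (ha : xs a = none) (hb : xs b = none) (hc : xs c = none) (t : ℕ) :
    K2 a b c t (rowSt a xs t) (rowSt c (rowOut a xs) t) (rowSt b (rowOut c (rowOut a xs)) t)
      (rowSt c xs t) (rowSt a (rowOut c xs) t) (rowSt b (rowOut a (rowOut c xs)) t) := by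
  induction t with
  | zero => left; simp [rowSt]
  | succ t ih =>
    exact (K2_step hab hbc (x := xs t) (by rintro (rfl | rfl | rfl) <;> assumption) ih
      rfl rfl rfl rfl rfl rfl).2

theorem rowOut_K2 {a b c : ℕ} (hab : a < b) (hbc : b < c) (xs : ℕ → Option ℕ)
    (ha : xs a = none) (hb : xs b = none) (hc : xs c = none) :
    rowOut b (rowOut c (rowOut a xs)) = rowOut b (rowOut a (rowOut c xs)) := by
  funext t
  exact (K2_step hab hbc (x := xs t) (by rintro (rfl | rfl | rfl) <;> assumption)
    (K2_inv hab hbc xs ha hb hc t) rfl rfl rfl rfl rfl rfl).1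

theorem rowSt_none_of_le (m : ℕ) (xs : ℕ → Option ℕ) (t : ℕ) (h : t ≤ m) : rowSt m xs t = none := by
  induction t with
  | zero => rfl
  | succ t ih =>
    rw [rowSt_succ, ih (by omega)]
    have : t ≠ m := by omega
    cases h : xs t <;> simp [nst, this]

theorem rowSt_isSome (m : ℕ) (xs : ℕ → Option ℕ) (t : ℕ) (h : m < t) : (rowSt m xs t).isSome := by
  induction t with
  | zero => omega
  | succ t ih =>
    rw [rowSt_succ]
    unfold nst
    by_cases h1 : t = m
    · simp [h1]
    · have := ih (by omega)
      obtain ⟨q, hq⟩ := Option.isSome_iff_exists.1 this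
      rw [hq]
      split_ifs <;> simp_all

theorem rowOut_isSome (m : ℕ) (xs : ℕ → Option ℕ) (t : ℕ) :
    (rowOut m xs t).isSome ↔ t = m ∨ (xs t).isSome := by
  unfold rowOut nout
  by_cases h1 : t = m
  · simp [h1]
  · cases xs t <;> simp [h1]
    split_ifs <;> simp

theorem rowOut_none {m : ℕ} {xs : ℕ → Option ℕ} {t : ℕ} :
    rowOut m xs t = none ↔ t ≠ m ∧ xs t = none := by
  have := rowOut_isSome m xs t
  rw [← Option.not_isSome_iff_eq_none, this]; simp

def rowFold (ms : List ℕ) (xs : ℕ → Option ℕ) : ℕ → Option ℕ :=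
  ms.foldl (fun x m => rowOut m x) xs

theorem rowFold_none {ms : List ℕ} {xs : ℕ → Option ℕ} {t : ℕ} :
    rowFold ms xs t = none ↔ t ∉ ms ∧ xs t = none := by
  induction ms generalizing xs with
  | nil => simp [rowFold]
  | cons m ms ih =>
    have := ih (xs := rowOut m xs)
    unfold rowFold at *
    rw [List.foldl_cons, this, rowOut_none]
    simp; tauto

theorem rowFold_append (u v : List ℕ) (xs : ℕ → Option ℕ) :
    rowFold (u ++ v) xs = rowFold v (rowFold u xs) := by
  simp [rowFold]

theorem rowFold_plac {u v : List ℕ} (h : Plac u v) : ∀ (xs : ℕ → Option ℕ), u.Nodup →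
    (∀ m ∈ u, xs m = none) → rowFold u xs = rowFold v xs := by
  induction h with
  | refl => intros; rfl
  | symm h ih =>
    intro xs hn hx
    exact (ih xs (h.perm.nodup_iff.2 hn) (fun m hm => hx m (h.perm.mem_iff.1 hm))).symm
  | trans h1 h2 ih1 ih2 =>
    intro xs hn hx
    rw [ih1 xs hn hx]
    exact ih2 xs (h1.perm.nodup_iff.1 hn) (fun m hm => hx m (h1.perm.mem_iff.2 hm))
  | k1 X Y a b c hab hbc =>
    intro xs hn hx
    have hn' := (List.nodup_append.1 hn).2.2
    rw [rowFold_append, rowFold_append]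
    have := rowOut_K1 hab hbc (rowFold X xs)
      (rowFold_none.2 ⟨fun h => hn' a h a (by simp) rfl, hx _ (by simp)⟩)
      (rowFold_none.2 ⟨fun h => hn' b h b (by simp) rfl, hx _ (by simp)⟩)
      (rowFold_none.2 ⟨fun h => hn' c h c (by simp) rfl, hx _ (by simp)⟩)
    simp only [rowFold, List.foldl_cons] at this ⊢
    rw [this]
  | k2 X Y a b c hab hbc =>
    intro xs hn hx
    have hn' := (List.nodup_append.1 hn).2.2
    rw [rowFold_append, rowFold_append]
    have := rowOut_K2 hab hbc (rowFold X xs)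
      (rowFold_none.2 ⟨fun h => hn' a h a (by simp) rfl, hx _ (by simp)⟩)
      (rowFold_none.2 ⟨fun h => hn' b h b (by simp) rfl, hx _ (by simp)⟩)
      (rowFold_none.2 ⟨fun h => hn' c h c (by simp) rfl, hx _ (by simp)⟩)
    simp only [rowFold, List.foldl_cons] at this ⊢
    rw [this]

/-! ### Part C: columns and the switch -/

def cnt (xs : ℕ → Option ℕ) : ℕ → ℕ → ℕ
  | 0, _ => 0
  | t + 1, r => cnt xs t r + if xs t = some r then 1 else 0

theorem cnt_succ (xs : ℕ → Option ℕ) (t r : ℕ) :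
    cnt xs (t + 1) r = cnt xs t r + if xs t = some r then 1 else 0 := rfl

def conj (xs : ℕ → Option ℕ) (t : ℕ) : Option ℕ := (xs t).map (cnt xs t)

def Valid (xs : ℕ → Option ℕ) : Prop := ∀ t r, xs t = some r → cnt (conj xs) t (cnt xs t r) = r

def Dual (f g : ℕ → ℕ) : Prop := ∀ r c, c < f r ↔ r < g c

theorem Dual.symm {f g : ℕ → ℕ} (h : Dual f g) : Dual g f := fun r c => (h c r).symm

theorem Dual.zero {f g : ℕ → ℕ} (h : Dual f g) : g (f 0) = 0 := by
  have := h 0 (f 0); omega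

theorem Dual.anti {f g : ℕ → ℕ} (h : Dual f g) (a : ℕ) : f (a + 1) ≤ f a := by
  have h1 := h a (f a); have h2 := h (a + 1) (f a); omega

theorem Dual.next {f g : ℕ → ℕ} (h : Dual f g) (a : ℕ) (ha : g (f a) = a) :
    g (f (a + 1)) + (if f a = f (a + 1) then 1 else 0) = a + 1 := by
  have h0 := h.anti a
  have h1 := h (a + 1) (f (a + 1)); have h2 := h a (f (a + 1))
  split_ifs with h3
  · rw [← h3]; omega
  · omega

theorem Dual.step {f g f' g' : ℕ → ℕ} (h : Dual f g) {r : ℕ} (hr : g (f r) = r)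
    (hf : ∀ a, f' a = f a + if r = a then 1 else 0)
    (hg : ∀ c, g' c = g c + if f r = c then 1 else 0) : Dual f' g' := by
  intro a c
  rw [hf, hg]
  have := h a c
  split_ifs with h1 h2 h2
  · subst h1; subst h2; omega
  · subst h1; omega
  · subst h2
    rw [hr] at this ⊢; omega
  · omega

theorem conj_conj {xs : ℕ → Option ℕ} (h : Valid xs) : conj (conj xs) = xs := by
  funext t
  cases hx : xs t with
  | none => simp [conj, hx]
  | some r =>
    have h1 : conj xs t = some (cnt xs t r) := by simp [conj, hx]
    rw [conj, h1, Option.map_some, h t r hx]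

theorem Valid.conj {xs : ℕ → Option ℕ} (h : Valid xs) : Valid (conj xs) := by
  intro t c hc
  rw [conj_conj h]
  cases hx : xs t with
  | none => simp [_root_.conj, hx] at hc
  | some r =>
    simp only [_root_.conj, hx, Option.map_some, Option.some.injEq] at hc
    rw [← hc, h t r hx]

theorem conj_eq_none {xs : ℕ → Option ℕ} {t : ℕ} : conj xs t = none ↔ xs t = none := by
  simp [conj]

theorem Valid.dual {xs : ℕ → Option ℕ} (h : Valid xs) (t : ℕ) :
    Dual (cnt xs t) (cnt (_root_.conj xs) t) := by
  induction t with
  | zero => intro r c; simp [cnt]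
  | succ t ih =>
    cases hx : xs t with
    | none =>
      intro r c
      have := ih r c
      simpa [cnt_succ, hx, _root_.conj] using this
    | some r =>
      refine ih.step (h t r hx) (fun a => ?_) (fun c => ?_)
      · rw [cnt_succ, hx]; simp
      · rw [cnt_succ]; simp [_root_.conj, hx]

theorem cnt_rowOut {m : ℕ} {xs : ℕ → Option ℕ} (hm : xs m = none) (t r : ℕ) :
    cnt (rowOut m xs) t r = cnt xs t r + if rowSt m xs t = some r then 1 else 0 := by
  induction t with
  | zero => simp [cnt, rowSt]
  | succ t ih =>
    rw [cnt_succ, cnt_succ, ih, rowSt_succ, rowOut]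
    by_cases h : t = m
    · subst h
      simp [nout, nst, hm, rowSt_none_of_le]
    · simp only [nout, nst, h, decide_false, Bool.false_eq_true, if_false]
      rcases xs t with _ | x <;> rcases rowSt m xs t with _ | s
      · simp
      · simp
      · simp
      · by_cases h2 : x = s
        · subst h2; simp
        · simp [h2]; omega

theorem rowSt_add {m : ℕ} {xs : ℕ → Option ℕ} (hv : Valid xs) (hm : xs m = none) (t a : ℕ)
    (ha : rowSt m xs t = some a) : cnt (conj xs) t (cnt xs t a) = a := by
  induction t generalizing a with
  | zero => simp [rowSt] at ha
  | succ t ih =>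
    have hd := hv.dual t
    rw [rowSt_succ] at ha
    by_cases h : t = m
    · subst h
      simp [nst] at ha
      subst ha
      exact (hv.dual (t + 1)).zero
    · simp only [nst, h, decide_false, Bool.false_eq_true, if_false] at ha
      rcases hx : xs t with _ | x <;> rcases hs : rowSt m xs t with _ | s <;> rw [hx, hs] at ha
      · simp at ha
      · simp at ha; subst ha
        simpa [cnt_succ, conj, hx] using ih _ hs
      · simp at ha
      · have h1 := hv t x hx
        have h2 := ih s hs
        by_cases h3 : x = s
        · subst h3
          simp at ha; subst ha
          have := hd.next x h1
          simp [cnt_succ, conj, hx]; omega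
        · simp [h3] at ha; subst ha
          simp only [cnt_succ, conj, hx, Option.some.injEq, h3, if_false, Option.map_some]
          rw [if_neg]
          · simpa using h2
          · intro h4
            simp at h4
            rw [h4, h2] at h1; omega

theorem cnt_conj_rowOut {m : ℕ} {xs : ℕ → Option ℕ} (hv : Valid xs) (hm : xs m = none) (t c : ℕ) :
    cnt (conj (rowOut m xs)) t c = cnt (conj xs) t c +
      if (rowSt m xs t).map (cnt xs t) = some c then 1 else 0 := by
  induction t with
  | zero => simp [cnt, rowSt]
  | succ t ih =>
    have hf : ∀ a, cnt xs (t + 1) a = cnt xs t a + if xs t = some a then 1 else 0 := fun a => rfl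
    have hc : conj (rowOut m xs) t = (rowOut m xs t).map
        (fun r => cnt xs t r + if rowSt m xs t = some r then 1 else 0) := by
      unfold conj
      congr 1
      funext r
      exact cnt_rowOut hm t r
    rw [cnt_succ, cnt_succ, ih, rowSt_succ, hc, rowOut]
    by_cases h : t = m
    · subst h
      simp [nout, nst, hm, rowSt_none_of_le, conj, hf]
    · simp only [nout, nst, h, decide_false, Bool.false_eq_true, if_false, conj]
      rcases Option.eq_none_or_eq_some (xs t) with hx | ⟨x, hx⟩ <;>
        rcases Option.eq_none_or_eq_some (rowSt m xs t) with hs | ⟨s, hs⟩ <;> simp only [hx, hs]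
      · simp
      · simp [hf, hx]
      · simp
      · by_cases h2 : x = s
        · subst h2; simp [hf, hx]
        · have h3 : s ≠ x := fun h => h2 h.symm
          simp [h2, hf, hx, h3]; omega

theorem Valid.rowOut {m : ℕ} {xs : ℕ → Option ℕ} (hv : Valid xs) (hm : xs m = none) :
    Valid (rowOut m xs) := by
  intro t r hr
  rw [cnt_rowOut hm, cnt_conj_rowOut hv hm]
  have hd := hv.dual t
  unfold _root_.rowOut at hr
  by_cases h : t = m
  · subst h
    simp [nout] at hr
    subst hr
    simp [rowSt_none_of_le, hd.zero]
  · simp only [nout, h, decide_false, Bool.false_eq_true, if_false] at hr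
    rcases hx : xs t with _ | x <;> rcases hs : rowSt m xs t with _ | s <;> rw [hx, hs] at hr
    · simp at hr
    · simp at hr
    · simp at hr; subst hr
      simpa using hv t x hx
    · have h1 := hv t x hx
      have h2 := rowSt_add hv hm t s hs
      by_cases h3 : x = s
      · subst h3
        simp at hr; subst hr
        have := hd.next x h1
        simpa using this
      · simp [h3] at hr; subst hr
        have h4 : s ≠ x := fun h => h3 h.symm
        simp only [Option.some.injEq, h4, if_false, Option.map_some, Nat.add_zero]
        rw [if_neg]
        · simpa using h1
        · intro h4
          rw [← h4, h2] at h1; omega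

def colOut (m : ℕ) (xs : ℕ → Option ℕ) : ℕ → Option ℕ := conj (rowOut m (conj xs))

theorem Valid.colOut {m : ℕ} {xs : ℕ → Option ℕ} (hv : Valid xs) (hm : xs m = none) :
    Valid (colOut m xs) := (hv.conj.rowOut (conj_eq_none.2 hm)).conj

theorem colOut_none {m : ℕ} {xs : ℕ → Option ℕ} {t : ℕ} :
    colOut m xs t = none ↔ t ≠ m ∧ xs t = none := by
  rw [colOut, conj_eq_none, rowOut_none, conj_eq_none]

/-- The relation between the states of row-then-column and column-then-row. -/
def SRel (f g : ℕ → ℕ) : Option ℕ → Option ℕ → Option ℕ → Option ℕ → Prop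
  | none, none, none, none => True
  | some a, none, none, some a' => a' = a
  | none, some b, some b', none => b' = b
  | some a, some b, some b', some a' =>
    (a' = a ∧ b' = b ∧ f a ≠ b) ∨
    (b = f a + 1 ∧ b' = f a ∧ a' = a ∧ g (f a + 1) = a) ∨
    (b = f a ∧ b' = f a ∧ a' = a + 1 ∧ f (a + 1) = f a)
  | _, _, _, _ => False

theorem SRel_step {f g f' g' : ℕ → ℕ} (hd : Dual f g) {a b b' a' x : Option ℕ} {i i' : Bool}
    (hR : SRel f g a b b' a')
    (hx : ∀ r, x = some r → g (f r) = r)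
    (ha : ∀ r, a = some r → g (f r) = r)
    (hb : ∀ c, b' = some c → f (g c) = c)
    (hi : i = true → x = none ∧ a = none ∧ i' = false) (hi' : i' = true → x = none ∧ b = none)
    (hf : ∀ r, f' r = f r + if x = some r then 1 else 0)
    (hg : ∀ c, g' c = g c + if x.map f = some c then 1 else 0)
    {r1 c1 c2 r2 c1' r1' r2' : Option ℕ}
    (h1 : r1 = nout i a x)
    (h2 : c1 = r1.map (fun r => f r + if a = some r then 1 else 0))
    (h3 : c2 = nout i' b c1)
    (h4 : r2 = c2.map (fun c => g c + (if a.map f = some c then 1 else 0) + if b = some c then 1 else 0))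
    (h5 : c1' = nout i' b' (x.map f))
    (h6 : r1' = c1'.map (fun c => g c + if b' = some c then 1 else 0))
    (h7 : r2' = nout i a' r1') :
    r2 = r2' ∧ SRel f' g' (nst i a x) (nst i' b c1) (nst i' b' (x.map f)) (nst i a' r1') := by
  subst h1 h2 h3 h4 h5 h6 h7
  by_cases hi0 : i = true
  · obtain ⟨rfl, rfl, rfl⟩ := hi hi0
    subst hi0
    simp at hf hg
    obtain rfl : f' = f := funext hf
    obtain rfl : g' = g := funext hg
    have hz := hd.zero
    have hz1 := hd 0 (f' 0 + 1)
    rcases b with _ | b <;> rcases b' with _ | b' <;> rcases a' with _ | a' <;> simp only [SRel] at hR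
    · simp [nout, hz, nst, SRel]
    · subst hR
      by_cases h : f' 0 = b'
      · subst h; simp [nout, nst, SRel]; omega
      · have h' : b' ≠ f' 0 := fun e => h e.symm
        simp [nst, nout, SRel, hz, h', h]
  · by_cases hi1 : i' = true
    · obtain ⟨rfl, rfl⟩ := hi' hi1
      subst hi1
      simp at hi0
      subst hi0
      simp at hf hg
      obtain rfl : f' = f := funext hf
      obtain rfl : g' = g := funext hg
      have hz := hd.symm.zero
      rcases a with _ | a <;> rcases b' with _ | b' <;> rcases a' with _ | a' <;> simp only [SRel] at hR
      · simp [nout, nst, SRel]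
      · subst hR
        have ha := ha _ rfl
        by_cases h : f' a' = 0
        · have h9 := hd.anti a'
          rw [h] at ha
          simp [nst, nout, SRel, ha, h]; omega
        · have : g' 0 ≠ a' := fun e => h (by rw [← e, hz])
          simp [nst, nout, SRel, this, h]
    · simp at hi0 hi1
      subst hi0; subst hi1
      rcases x with _ | x
      · simp at hf hg
        obtain rfl : f' = f := funext hf
        obtain rfl : g' = g := funext hg
        have e1 : ∀ s, nout false s none = none := by intro s; simp [nout]
        have e2 : ∀ s, nst false s none = s := by intro s; cases s <;> simp [nst]
        simp only [e1, Option.map_none, e2]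
        simpa using hR
      · have hx := hx x rfl
        clear hi hi'
        simp only [Option.map_some, Option.some.injEq] at hf hg
        simp only [nout, nst, Bool.false_eq_true, if_false, Option.map_some]
        rcases a with _ | a <;> rcases b with _ | b <;> rcases b' with _ | b' <;>
          rcases a' with _ | a' <;> simp only [SRel] at hR
        · simp [SRel, hx]
        · subst hR
          by_cases h : f x = b'
          · simp [h, SRel]
          · have h' : ¬ b' = f x := fun e => h e.symm
            simp [h, h', SRel, hx]
        · subst hR
          have ha := ha _ rfl
          by_cases h : x = a'
          · subst h
            have := hd.next x hx
            simp [SRel, hx, this]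
          · have h' : ¬ a' = x := fun e => h e.symm
            have h2 : ¬ f a' = f x := fun e => h (by rw [← ha, ← hx, e])
            simp [h, h', h2, SRel, hx]
        · have ha := ha _ rfl
          have hb := hb _ rfl
          have a1 := hd.anti a
          have a2 := hd.next a ha
          have a3 := hd.symm.anti b'
          have d1 := hd a b'
          have d2 := hd a (b' + 1)
          have d3 := hd (a + 1) b'
          have d4 := hd (a + 1) (b' + 1)
          have d5 := hd a (b' + 1 + 1)
          have d6 := hd (a + 1) (b' + 1 + 1)
          have d7 := hd (a + 1 + 1) b'
          have d8 := hd (a + 1 + 1) (b' + 1)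
          have hxb : f x = b' → x = g b' := fun e => by rw [← e, hx]
          have hxa : f x = f a → x = a := fun e => by rw [← hx, e, ha]
          clear hxb
          rcases hR with ⟨rfl, rfl, hne⟩ | ⟨rfl, rfl, rfl, h9⟩ | ⟨rfl, rfl, rfl, h9⟩
          · by_cases h : x = a'
            · subst h
              have hne' : ¬ b' = f x := fun e => hne e.symm
              by_cases h2 : f (x + 1) = b'
              · rw [h2] at a2
                simp [h2, hne, hne', hx, SRel, hf, hg]
                by_cases h5 : f x = b' + 1
                · rw [← h5, hx]; simp
                · simp [h5, hne] at a2 ⊢; omega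
              · have h2' : ¬ b' = f (x + 1) := fun e => h2 e.symm
                simp [h2, h2', hne, hne', hx, SRel, hf, hg]
                exact a2
            · have h' : ¬ a' = x := fun e => h e.symm
              have h3 : ¬ f x = f a' := fun e => h (hxa e)
              have h3' : ¬ f a' = f x := fun e => h3 e.symm
              by_cases h2 : f x = b'
              · subst h2
                simp [h, h', h3, h3', hx, SRel, hf, hg]
                have e1 := hd a' (f x)
                have e2 := hd a' (f x + 1)
                have e3 := hd (a' + 1) (f x)
                have e4 := hd.symm.anti (f x)
                by_cases h5 : g (f x + 1) = a'
                · have h6 : f a' = f x + 1 := by omega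
                  simp [h5, h6, h]
                  split_ifs with h7
                  · rw [← h7]
                  · omega
                · have h6 : ¬ f a' = f x + 1 := fun e => h5 (by rw [← e, ha])
                  simp [h5, h6, h]
              · have h2' : ¬ b' = f x := fun e => h2 e.symm
                simp [h, h', h2, h2', hne, h3, h3', hx, SRel, hf, hg]
          · by_cases h : x = a'
            · subst h
              simp [hx, SRel, hf, hg, h9]
              have h5 : ¬ f (x + 1) = f x + 1 := by omega
              have h6 : ¬ f x + 1 = f (x + 1) := by omega
              simp [h5, h6, a2]
            · have h' : ¬ a' = x := fun e => h e.symm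
              have h3 : ¬ f x = f a' := fun e => h (hxa e)
              have h3' : ¬ f a' = f x := fun e => h3 e.symm
              have h4 : ¬ f x = f a' + 1 := fun e => by rw [e] at hx; omega
              have h4' : ¬ f a' + 1 = f x := fun e => h4 e.symm
              simp [h, h', h3, h3', h4, h4', hx, SRel, hf, hg, h9]
          · by_cases h : x = a
            · subst h
              simp [hx, SRel, hf, hg, h9]
              have e4 := hd.symm.anti (f x)
              have h5 : ¬ g (f x + 1) = x + 1 := by omega
              simp [h5, h9]
            · have h' : ¬ a = x := fun e => h e.symm
              have h3 : ¬ f x = f a := fun e => h (hxa e)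
              have h3' : ¬ f a = f x := fun e => h3 e.symm
              have h4 : ¬ x = a + 1 := fun e => by rw [e, h9] at hx; omega
              have h4' : ¬ a + 1 = x := fun e => h4 e.symm
              simp [h, h', h3, h3', h4, h4', hx, SRel, hf, hg, h9]

theorem switch {m m' : ℕ} {xs : ℕ → Option ℕ} (hv : Valid xs) (hm : xs m = none)
    (hm' : xs m' = none) (hne : m ≠ m') :
    colOut m' (rowOut m xs) = rowOut m (colOut m' xs) := by
  have hc' : conj xs m' = none := conj_eq_none.2 hm'
  have hv1 := hv.rowOut hm
  have hv2 := hv.conj.rowOut hc'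
  have hm1 : conj (rowOut m xs) m' = none := conj_eq_none.2 (rowOut_none.2 ⟨hne.symm, hm'⟩)
  have E1 : ∀ t, conj (rowOut m xs) t = (rowOut m xs t).map
      (fun r => cnt xs t r + if rowSt m xs t = some r then 1 else 0) := by
    intro t; unfold conj; congr 1; funext r; exact cnt_rowOut hm t r
  have E2 : ∀ t, colOut m' (rowOut m xs) t = (rowOut m' (conj (rowOut m xs)) t).map
      (fun c => cnt (conj xs) t c + (if (rowSt m xs t).map (cnt xs t) = some c then 1 else 0) +
        if rowSt m' (conj (rowOut m xs)) t = some c then 1 else 0) := by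
    intro t; unfold colOut; rw [conj]; congr 1; funext r
    rw [cnt_rowOut hm1, cnt_conj_rowOut hv hm]
  have E3 : ∀ t, colOut m' xs t = (rowOut m' (conj xs) t).map
      (fun c => cnt (conj xs) t c + if rowSt m' (conj xs) t = some c then 1 else 0) := by
    intro t; unfold colOut; rw [conj]; congr 1; funext r
    rw [cnt_rowOut hc']
  have key : ∀ t, SRel (cnt xs t) (cnt (conj xs) t) (rowSt m xs t) (rowSt m' (conj (rowOut m xs)) t)
      (rowSt m' (conj xs) t) (rowSt m (colOut m' xs) t) →
      colOut m' (rowOut m xs) t = rowOut m (colOut m' xs) t ∧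
      SRel (cnt xs (t + 1)) (cnt (conj xs) (t + 1)) (rowSt m xs (t + 1))
      (rowSt m' (conj (rowOut m xs)) (t + 1))
      (rowSt m' (conj xs) (t + 1)) (rowSt m (colOut m' xs) (t + 1)) := by
    intro t hR
    refine SRel_step (hv.dual t) (i := decide (t = m)) (i' := decide (t = m')) (x := xs t) hR
      (fun r hr => hv t r hr) (fun r hr => rowSt_add hv hm t r hr) ?_ ?_ ?_ (fun r => rfl)
      (fun c => rfl) rfl (E1 t) rfl (E2 t) rfl (E3 t) rfl
    · intro c hc
      have := rowSt_add hv.conj hc' t c hc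
      rwa [conj_conj hv] at this
    · intro h
      simp at h; subst h
      exact ⟨hm, rowSt_none_of_le _ _ _ le_rfl, by simp [hne]⟩
    · intro h
      simp at h; subst h
      exact ⟨hm', rowSt_none_of_le _ _ _ le_rfl⟩
  have inv : ∀ t, SRel (cnt xs t) (cnt (conj xs) t) (rowSt m xs t)
      (rowSt m' (conj (rowOut m xs)) t)
      (rowSt m' (conj xs) t) (rowSt m (colOut m' xs) t) := by
    intro t
    induction t with
    | zero => simp [rowSt, SRel]
    | succ t ih => exact (key t ih).2
  funext t
  exact (key t (inv t)).1

/-! ### Part D: the shifted machine and the doubling -/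

def sfn (X : ℕ → Option (ℕ × ℕ)) (t r : ℕ) : ℕ := r + cnt (fun s => (X s).map Prod.fst) t r
def sgn (X : ℕ → Option (ℕ × ℕ)) (t c : ℕ) : ℕ := cnt (fun s => (X s).map Prod.snd) t c

def SAdd (f g : ℕ → ℕ) (A : ℕ × ℕ) : Prop := f A.1 = A.2 ∧ g A.2 = A.1 ∧ A.1 ≤ A.2

def SV (X : ℕ → Option (ℕ × ℕ)) : Prop := ∀ t A, X t = some A → SAdd (sfn X t) (sgn X t) A

def SD (f g : ℕ → ℕ) : Prop :=
  (∀ r c, r ≤ c → (c < f r ↔ r < g c)) ∧ (∀ c, g c ≤ c + 1) ∧ (∀ r, r ≤ f r)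

theorem sfn_succ (X : ℕ → Option (ℕ × ℕ)) (t r : ℕ) :
    sfn X (t + 1) r = sfn X t r + if (X t).map Prod.fst = some r then 1 else 0 := by
  simp [sfn, cnt_succ]; omega

theorem sgn_succ (X : ℕ → Option (ℕ × ℕ)) (t c : ℕ) :
    sgn X (t + 1) c = sgn X t c + if (X t).map Prod.snd = some c then 1 else 0 := by
  simp [sgn, cnt_succ]

theorem SD.step {f g f' g' : ℕ → ℕ} (h : SD f g) {A : ℕ × ℕ} (hA : SAdd f g A)
    (hf : ∀ a, f' a = f a + if A.1 = a then 1 else 0)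
    (hg : ∀ c, g' c = g c + if A.2 = c then 1 else 0) : SD f' g' := by
  obtain ⟨h1, h2, h3⟩ := hA
  obtain ⟨d1, d2, d3⟩ := h
  refine ⟨fun r c hrc => ?_, fun c => ?_, fun r => ?_⟩
  · rw [hf, hg]
    have := d1 r c hrc
    split_ifs with h4 h5 h5
    · subst h4; subst h5; omega
    · subst h4; omega
    · subst h5; omega
    · omega
  · rw [hg]
    have := d2 c
    split_ifs with h4
    · subst h4; omega
    · omega
  · rw [hf]; have := d3 r; omega

theorem SV.sd {X : ℕ → Option (ℕ × ℕ)} (h : SV X) (t : ℕ) : SD (sfn X t) (sgn X t) := by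
  induction t with
  | zero => refine ⟨?_, ?_, ?_⟩ <;> simp [sfn, sgn, cnt]
  | succ t ih =>
    rcases hx : X t with _ | A
    · have e1 : sfn X (t + 1) = sfn X t := by funext r; simp [sfn_succ, hx]
      have e2 : sgn X (t + 1) = sgn X t := by funext r; simp [sgn_succ, hx]
      rw [e1, e2]; exact ih
    · refine ih.step (h t A hx) (fun a => ?_) (fun a => ?_)
      · simp [sfn_succ, hx]
      · simp [sgn_succ, hx]

def mNext (f g : ℕ → ℕ) (s : (ℕ × ℕ) × Bool) : (ℕ × ℕ) × Bool :=
  if s.2 = false ∧ s.1.1 ≠ s.1.2 then ((s.1.1 + 1, f (s.1.1 + 1)), false)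
  else ((g (s.1.2 + 1), s.1.2 + 1), true)

def mst (i : Bool) (f g : ℕ → ℕ) (s : Option ((ℕ × ℕ) × Bool)) (x : Option (ℕ × ℕ)) :
    Option ((ℕ × ℕ) × Bool) :=
  if i then some ((0, f 0), false)
  else if x = s.map Prod.fst then s.map (mNext f g) else s

def mout (i : Bool) (f g : ℕ → ℕ) (s : Option ((ℕ × ℕ) × Bool)) (x : Option (ℕ × ℕ)) :
    Option (ℕ × ℕ) :=
  if i then some (0, f 0)
  else if x = s.map Prod.fst then (s.map (mNext f g)).map Prod.fst else x

def mSt (m : ℕ) (X : ℕ → Option (ℕ × ℕ)) : ℕ → Option ((ℕ × ℕ) × Bool)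
  | 0 => none
  | t + 1 => mst (decide (t = m)) (sfn X t) (sgn X t) (mSt m X t) (X t)

def mOut (m : ℕ) (X : ℕ → Option (ℕ × ℕ)) (t : ℕ) : Option (ℕ × ℕ) :=
  mout (decide (t = m)) (sfn X t) (sgn X t) (mSt m X t) (X t)

theorem mSt_succ (m : ℕ) (X : ℕ → Option (ℕ × ℕ)) (t : ℕ) :
    mSt m X (t + 1) = mst (decide (t = m)) (sfn X t) (sgn X t) (mSt m X t) (X t) := rfl

theorem mSt_none_of_le (m : ℕ) (X : ℕ → Option (ℕ × ℕ)) (t : ℕ) (h : t ≤ m) : mSt m X t = none := by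
  induction t with
  | zero => rfl
  | succ t ih =>
    have : t ≠ m := by omega
    simp [mSt_succ, mst, ih (by omega), this]

theorem mOut_none {m : ℕ} {X : ℕ → Option (ℕ × ℕ)} {t : ℕ} :
    mOut m X t = none ↔ t ≠ m ∧ X t = none := by
  unfold mOut mout
  by_cases h : t = m
  · simp [h]
  · simp only [h, decide_false, Bool.false_eq_true, if_false, ne_eq, not_false_eq_true, true_and]
    rcases X t with _ | x <;> rcases mSt m X t with _ | s
    · simp
    · simp
    · simp
    · split_ifs <;> simp

theorem mNext_add {f g : ℕ → ℕ} (hd : SD f g) {A : ℕ × ℕ} (hA : SAdd f g A) (p : Bool) :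
    SAdd (fun r => f r + if A.1 = r then 1 else 0) (fun c => g c + if A.2 = c then 1 else 0)
      (mNext f g (A, p)).1 ∧
    ((mNext f g (A, p)).2 = false → A.1 ≠ (mNext f g (A, p)).1.1) ∧
    ((mNext f g (A, p)).2 = true → A.2 ≠ (mNext f g (A, p)).1.2) := by
  obtain ⟨h1, h2, h3⟩ := hA
  obtain ⟨d1, d2, d3⟩ := hd
  obtain ⟨r, c⟩ := A
  simp only at h1 h2 h3
  by_cases h : p = false ∧ r ≠ c
  · have e : mNext f g ((r, c), p) = ((r + 1, f (r + 1)), false) := if_pos h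
    rw [e]
    have hrc : r < c := by omega
    have e3 := d3 (r + 1)
    have e1 := d1 r (f (r + 1)) (by omega)
    have e2 := d1 (r + 1) (f (r + 1)) e3
    have e4 := d1 (r + 1) c (by omega)
    refine ⟨⟨?_, ?_, ?_⟩, ?_, ?_⟩ <;> simp
    · split_ifs with h5
      · rw [← h5, h2]
      · omega
    · exact e3
  · have e : mNext f g ((r, c), p) = ((g (c + 1), c + 1), true) := if_neg h
    rw [e]
    have e1 := d1 r c h3
    have e0 := d2 (c + 1)
    have e2 := d1 c c le_rfl
    have e3 := d1 (c + 1) (c + 1) le_rfl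
    have e4 := d1 c (c + 1) (by omega)
    have e5 : g (c + 1) ≤ c := by omega
    have e6 := d1 (g (c + 1)) c e5
    have e7 := d1 (g (c + 1)) (c + 1) (by omega)
    have e8 := d1 r (c + 1) (by omega)
    refine ⟨⟨?_, ?_, ?_⟩, ?_, ?_⟩ <;> simp
    · split_ifs with h5
      · rw [← h5, h1]
      · omega
    · omega

theorem SD.zero {f g : ℕ → ℕ} (h : SD f g) : SAdd f g (0, f 0) := by
  have := h.1 0 (f 0) (by omega)
  refine ⟨rfl, ?_, by simp⟩
  simp; omega

theorem mSt_add {m : ℕ} {X : ℕ → Option (ℕ × ℕ)} (hv : SV X) (hm : X m = none) (t : ℕ)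
    (s : (ℕ × ℕ) × Bool) (hs : mSt m X t = some s) : SAdd (sfn X t) (sgn X t) s.1 := by
  induction t generalizing s with
  | zero => simp [mSt] at hs
  | succ t ih =>
    have hd := hv.sd t
    have hd' := hv.sd (t + 1)
    rw [mSt_succ] at hs
    have hf := sfn_succ X t
    have hg := sgn_succ X t
    by_cases h : t = m
    · subst h
      simp [mst] at hs
      subst hs
      have e : sfn X t 0 = sfn X (t + 1) 0 := by rw [hf]; simp [hm]
      rw [e]
      exact hd'.zero
    · simp only [mst, h, decide_false, Bool.false_eq_true, if_false] at hs
      rcases hx : X t with _ | x <;> rcases hs0 : mSt m X t with _ | s0 <;> rw [hx, hs0] at hs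
      · simp at hs
      · simp at hs; subst hs
        have := ih _ hs0
        simp [hx] at hf hg
        simpa [SAdd, hf, hg] using this
      · simp at hs
      · have h1 := hv t x hx
        have h2 := ih _ hs0
        obtain ⟨A, p⟩ := s0
        simp [hx] at hf hg
        have hf' : sfn X (t + 1) = _ := funext hf
        have hg' : sgn X (t + 1) = _ := funext hg
        by_cases h3 : x = A
        · subst h3
          simp at hs; subst hs
          rw [hf', hg']
          exact (mNext_add hd h1 p).1
        · simp [h3] at hs; subst hs
          obtain ⟨a1, a2, a3⟩ := h1
          obtain ⟨b1, b2, b3⟩ := h2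
          have n1 : x.1 ≠ A.1 := fun e => h3 (Prod.ext e (by rw [← a1, e, b1]))
          have n2 : x.2 ≠ A.2 := fun e => h3 (Prod.ext (by rw [← a2, e, b2]) e)
          simp only at b1 b2 b3
          refine ⟨?_, ?_, b3⟩
          · rw [hf]; simp [n1, b1]
          · rw [hg]; simp [n2, b2]

theorem sfn_mOut {m : ℕ} {X : ℕ → Option (ℕ × ℕ)} (hm : X m = none) (t r : ℕ) :
    sfn (mOut m X) t r = sfn X t r + if (mSt m X t).map (fun s => s.1.1) = some r then 1 else 0 := by
  induction t with
  | zero => simp [sfn, cnt, mSt]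
  | succ t ih =>
    rw [sfn_succ, sfn_succ, ih, mSt_succ, mOut]
    by_cases h : t = m
    · subst h
      simp [mout, mst, hm, mSt_none_of_le]
    · simp only [mout, mst, h, decide_false, Bool.false_eq_true, if_false]
      rcases Option.eq_none_or_eq_some (X t) with hx | ⟨x, hx⟩ <;>
        rcases Option.eq_none_or_eq_some (mSt m X t) with hs | ⟨s, hs⟩ <;> simp only [hx, hs]
      · simp
      · simp
      · simp
      · by_cases h2 : x = s.1
        · subst h2; simp
        · simp [h2]; omega

theorem sgn_mOut {m : ℕ} {X : ℕ → Option (ℕ × ℕ)} (hm : X m = none) (t r : ℕ) :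
    sgn (mOut m X) t r = sgn X t r + if (mSt m X t).map (fun s => s.1.2) = some r then 1 else 0 := by
  induction t with
  | zero => simp [sgn, cnt, mSt]
  | succ t ih =>
    rw [sgn_succ, sgn_succ, ih, mSt_succ, mOut]
    by_cases h : t = m
    · subst h
      simp [mout, mst, hm, mSt_none_of_le]
    · simp only [mout, mst, h, decide_false, Bool.false_eq_true, if_false]
      rcases Option.eq_none_or_eq_some (X t) with hx | ⟨x, hx⟩ <;>
        rcases Option.eq_none_or_eq_some (mSt m X t) with hs | ⟨s, hs⟩ <;> simp only [hx, hs]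
      · simp
      · simp
      · simp
      · by_cases h2 : x = s.1
        · subst h2; simp
        · simp [h2]; omega

theorem SV.mOut {m : ℕ} {X : ℕ → Option (ℕ × ℕ)} (hv : SV X) (hm : X m = none) :
    SV (mOut m X) := by
  intro t B hB
  have hd := hv.sd t
  have hf := sfn_mOut hm t
  have hg := sgn_mOut hm t
  unfold _root_.mOut at hB
  by_cases h : t = m
  · subst h
    simp [mout] at hB
    subst hB
    have := hd.zero
    simp [mSt_none_of_le] at hf hg
    simpa [SAdd, hf, hg] using this
  · simp only [mout, h, decide_false, Bool.false_eq_true, if_false] at hB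
    rcases hx : X t with _ | x <;> rcases hs : mSt m X t with _ | s <;> rw [hx, hs] at hB
    · simp at hB
    · simp at hB
    · simp at hB; subst hB
      simp [hs] at hf hg
      have := hv t x hx
      simpa [SAdd, hf, hg] using this
    · have h1 := hv t x hx
      have h2 := mSt_add hv hm t s hs
      obtain ⟨A, p⟩ := s
      simp [hs] at hf hg
      by_cases h3 : x = A
      · subst h3
        simp at hB; subst hB
        rw [funext hf, funext hg]
        exact (mNext_add hd h1 p).1
      · simp [h3] at hB; subst hB
        obtain ⟨a1, a2, a3⟩ := h1
        obtain ⟨b1, b2, b3⟩ := h2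
        have n1 : A.1 ≠ x.1 := fun e => h3 (Prod.ext e.symm (by rw [← a1, ← e, b1]))
        have n2 : A.2 ≠ x.2 := fun e => h3 (Prod.ext (by rw [← a2, ← e, b2]) e.symm)
        refine ⟨?_, ?_, a3⟩
        · rw [hf]; simp [n1, a1]
        · rw [hg]; simp [n2, a2]

def dbl (X : ℕ → Option (ℕ × ℕ)) (n : ℕ) : Option ℕ :=
  if n % 2 = 0 then (X (n / 2)).map Prod.snd else (X (n / 2)).map Prod.fst

theorem dbl_even (X : ℕ → Option (ℕ × ℕ)) (t : ℕ) : dbl X (2 * t) = (X t).map Prod.snd := by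
  simp [dbl]

theorem dbl_odd (X : ℕ → Option (ℕ × ℕ)) (t : ℕ) : dbl X (2 * t + 1) = (X t).map Prod.fst := by
  have : (2 * t + 1) / 2 = t := by omega
  simp [dbl, this]

theorem dbl_inj {X Y : ℕ → Option (ℕ × ℕ)} (h : dbl X = dbl Y) : X = Y := by
  funext t
  have h1 := congrFun h (2 * t)
  have h2 := congrFun h (2 * t + 1)
  rw [dbl_even, dbl_even] at h1
  rw [dbl_odd, dbl_odd] at h2
  revert h1 h2
  rcases X t with _ | ⟨a, b⟩ <;> rcases Y t with _ | ⟨c, d⟩ <;> simp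
  intro h1 h2; exact ⟨h2, h1⟩

theorem cnt_dbl (X : ℕ → Option (ℕ × ℕ)) (t i : ℕ) :
    cnt (dbl X) (2 * t) i + i = sfn X t i + sgn X t i := by
  induction t with
  | zero => simp [cnt, sfn, sgn]
  | succ t ih =>
    have : 2 * (t + 1) = 2 * t + 1 + 1 := by ring
    rw [this, cnt_succ, cnt_succ, sfn_succ, sgn_succ, dbl_even, dbl_odd]
    omega

theorem cnt_dbl' (X : ℕ → Option (ℕ × ℕ)) (t i : ℕ) :
    cnt (dbl X) (2 * t + 1) i + i = sfn X t i + sgn X t i +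
      if (X t).map Prod.snd = some i then 1 else 0 := by
  rw [cnt_succ, dbl_even]
  have := cnt_dbl X t i
  omega

theorem SV.diag {f g : ℕ → ℕ} (hd : SD f g) {r c : ℕ} (hA : SAdd f g (r, c)) :
    f c = c ∧ g r + (if c = r then 1 else 0) = r + 1 := by
  obtain ⟨h1, h2, h3⟩ := hA
  obtain ⟨d1, d2, d3⟩ := hd
  simp only at h1 h2 h3
  have e1 := d1 c c le_rfl
  have e2 := d1 r r le_rfl
  have e3 := d2 r
  have e4 := d3 c
  refine ⟨by omega, ?_⟩
  split_ifs with h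
  · subst h; omega
  · omega

theorem conj_dbl {X : ℕ → Option (ℕ × ℕ)} (hv : SV X) (t : ℕ) :
    conj (dbl X) (2 * t) = (X t).map Prod.fst ∧
    conj (dbl X) (2 * t + 1) = (X t).map (fun A => A.2 + 1) := by
  unfold conj
  rw [dbl_even, dbl_odd]
  rcases hx : X t with _ | ⟨r, c⟩
  · simp
  · have h1 := hv t _ hx
    obtain ⟨h2, h3⟩ := SV.diag (hv.sd t) h1
    obtain ⟨a1, a2, a3⟩ := h1
    simp only at a1 a2 a3
    have e1 := cnt_dbl X t c
    have e2 := cnt_dbl' X t r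
    simp [hx] at e2
    simp
    constructor <;> omega

theorem cnt_conj_dbl {X : ℕ → Option (ℕ × ℕ)} (hv : SV X) (t i : ℕ) :
    cnt (conj (dbl X)) (2 * t) i + i = sfn X t i + if i = 0 then 0 else sgn X t (i - 1) := by
  induction t with
  | zero => simp [cnt, sfn, sgn]
  | succ t ih =>
    have : 2 * (t + 1) = 2 * t + 1 + 1 := by ring
    rw [this, cnt_succ, cnt_succ, sfn_succ, sgn_succ, (conj_dbl hv t).1, (conj_dbl hv t).2]
    have e : (if (X t).map (fun A => A.2 + 1) = some i then 1 else 0) =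
        if i = 0 then 0 else if (X t).map Prod.snd = some (i - 1) then 1 else 0 := by
      rcases X t with _ | ⟨r, c⟩
      · simp
      · rcases i with _ | i <;> simp
    rw [e]
    split_ifs at * <;> omega

theorem cnt_conj_dbl' {X : ℕ → Option (ℕ × ℕ)} (hv : SV X) (t i : ℕ) :
    cnt (conj (dbl X)) (2 * t + 1) i + i = sfn X t i + (if i = 0 then 0 else sgn X t (i - 1)) +
      if (X t).map Prod.fst = some i then 1 else 0 := by
  rw [cnt_succ, (conj_dbl hv t).1]
  have := cnt_conj_dbl hv t i
  omega

theorem valid_dbl {X : ℕ → Option (ℕ × ℕ)} (hv : SV X) : Valid (dbl X) := by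
  intro n r hr
  have key : ∀ n r, dbl X n = some r → conj (dbl X) n = some (cnt (dbl X) n r) := by
    intro n r h; simp [conj, h]
  have hk := key n r hr
  obtain ⟨t, rfl | rfl⟩ : ∃ t, n = 2 * t ∨ n = 2 * t + 1 := ⟨n / 2, by omega⟩
  · rw [(conj_dbl hv t).1] at hk
    rw [dbl_even] at hr
    rcases hx : X t with _ | ⟨a, c⟩
    · simp [hx] at hr
    · simp [hx] at hr hk
      subst hr
      rw [← hk]
      have h1 := hv t _ hx
      obtain ⟨h2, h3⟩ := SV.diag (hv.sd t) h1
      obtain ⟨a1, a2, a3⟩ := h1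
      obtain ⟨d1, d2, d3⟩ := hv.sd t
      have e1 := cnt_conj_dbl hv t a
      simp only at a1 a2 a3
      rcases a with _ | a
      · simp at e1; omega
      · simp at e1
        have := d1 a a le_rfl
        have := d1 a c (by omega)
        have := d2 a
        omega
  · rw [(conj_dbl hv t).2] at hk
    rw [dbl_odd] at hr
    rcases hx : X t with _ | ⟨a, c⟩
    · simp [hx] at hr
    · simp [hx] at hr hk
      subst hr
      rw [← hk]
      have h1 := hv t _ hx
      obtain ⟨a1, a2, a3⟩ := h1
      obtain ⟨d1, d2, d3⟩ := hv.sd t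
      have e1 := cnt_conj_dbl' hv t (c + 1)
      simp [hx] at e1
      simp only at a1 a2 a3
      have := d1 c c le_rfl
      have := d1 c (c + 1) (by omega)
      have := d1 (c + 1) (c + 1) le_rfl
      have := d2 (c + 1)
      have := d3 (c + 1)
      split_ifs at e1 <;> omega

/-! Single steps of the row-then-column machine. -/

section RC
variable {m1 m2 : ℕ} {xs : ℕ → Option ℕ}

def rcSt (m1 m2 : ℕ) (xs : ℕ → Option ℕ) (t : ℕ) : Option ℕ := rowSt m2 (conj (rowOut m1 xs)) t

theorem rc_formula (hv : Valid xs) (h1 : xs m1 = none) (h2 : xs m2 = none) (hne : m1 ≠ m2) (t : ℕ) :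
    conj (rowOut m1 xs) t = (rowOut m1 xs t).map
      (fun r => cnt xs t r + if rowSt m1 xs t = some r then 1 else 0) ∧
    colOut m2 (rowOut m1 xs) t = (rowOut m2 (conj (rowOut m1 xs)) t).map
      (fun c => cnt (conj xs) t c + (if (rowSt m1 xs t).map (cnt xs t) = some c then 1 else 0) +
        if rcSt m1 m2 xs t = some c then 1 else 0) := by
  have hm1 : conj (rowOut m1 xs) m2 = none := conj_eq_none.2 (rowOut_none.2 ⟨hne.symm, h2⟩)
  constructor
  · unfold conj; congr 1; funext r; exact cnt_rowOut h1 t r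
  · unfold colOut; rw [conj]; congr 1; funext r
    rw [cnt_rowOut hm1, cnt_conj_rowOut hv h1]; rfl

/-- One step of the machine, in closed form. -/
theorem rc_step (hv : Valid xs) (h1 : xs m1 = none) (h2 : xs m2 = none) (hne : m1 ≠ m2) (t : ℕ)
    {x a b : ℕ} (hx : xs t = some x) (ha : rowSt m1 xs t = some a) (hb : rcSt m1 m2 xs t = some b) :
    (x ≠ a → cnt xs t x ≠ b → rowSt m1 xs (t + 1) = some a ∧ rcSt m1 m2 xs (t + 1) = some b ∧
      colOut m2 (rowOut m1 xs) t = some x) ∧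
    (x ≠ a → cnt xs t x = b → rowSt m1 xs (t + 1) = some a ∧ rcSt m1 m2 xs (t + 1) = some (b + 1) ∧
      colOut m2 (rowOut m1 xs) t =
        some (cnt (conj xs) t (b + 1) + if cnt xs t a = b + 1 then 1 else 0)) ∧
    (x = a → cnt xs t (a + 1) ≠ b → rowSt m1 xs (t + 1) = some (a + 1) ∧
      rcSt m1 m2 xs (t + 1) = some b ∧ colOut m2 (rowOut m1 xs) t = some (a + 1)) ∧
    (x = a → cnt xs t (a + 1) = b → rowSt m1 xs (t + 1) = some (a + 1) ∧
      rcSt m1 m2 xs (t + 1) = some (b + 1) ∧ colOut m2 (rowOut m1 xs) t =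
        some (cnt (conj xs) t (b + 1) + if cnt xs t a = b + 1 then 1 else 0)) := by
  obtain ⟨E1, E2⟩ := rc_formula hv h1 h2 hne t
  have t1 : t ≠ m1 := by rintro rfl; simp [h1] at hx
  have t2 : t ≠ m2 := by rintro rfl; simp [h2] at hx
  have ga := rowSt_add hv h1 t a ha
  have gx := hv t x hx
  have hn := (hv.dual t).next a ga
  have R : rowOut m1 xs t = if x = a then some (x + 1) else some x := by
    simp [rowOut, nout, t1, hx, ha]
  have S : rowSt m1 xs (t + 1) = if x = a then some (x + 1) else some a := by
    simp [rowSt_succ, nst, t1, hx, ha]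
  have B : rcSt m1 m2 xs (t + 1) = nst false (some b) (conj (rowOut m1 xs) t) := by
    unfold rcSt at hb ⊢
    rw [rowSt_succ, hb]; simp [t2]
  have B2 : rowOut m2 (conj (rowOut m1 xs)) t = nout false (some b) (conj (rowOut m1 xs) t) := by
    unfold rcSt at hb
    rw [rowOut, hb]; simp [t2]
  rw [B2, E1, R, ha, hb] at E2
  rw [B, E1, R, S, E2, ha]
  refine ⟨fun p q => ?_, fun p q => ?_, fun p q => ?_, fun p q => ?_⟩
  · have p' : ¬ a = x := fun e => p e.symm
    have q' : ¬ b = cnt xs t x := fun e => q e.symm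
    have p'' : ¬ cnt xs t a = cnt xs t x := fun e => p' (by rw [← ga, ← gx, e])
    simp [p, q, p', q', p'', nst, nout, gx]
  · have p' : ¬ a = x := fun e => p e.symm
    simp [p, q, p', nst, nout]
  · subst p
    have q' : ¬ b = cnt xs t (x + 1) := fun e => q e.symm
    simp [q, q', nst, nout, hn]
  · subst p
    simp [q, nst, nout]

theorem rc_none (hv : Valid xs) (h1 : xs m1 = none) (h2 : xs m2 = none) (hne : m1 ≠ m2) (t : ℕ)
    (t1 : t ≠ m1) (t2 : t ≠ m2) (hx : xs t = none) :
    rowSt m1 xs (t + 1) = rowSt m1 xs t ∧ rcSt m1 m2 xs (t + 1) = rcSt m1 m2 xs t ∧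
    colOut m2 (rowOut m1 xs) t = none := by
  have hR : conj (rowOut m1 xs) t = none := conj_eq_none.2 (rowOut_none.2 ⟨t1, hx⟩)
  refine ⟨?_, ?_, ?_⟩
  · rw [rowSt_succ, hx]; cases rowSt m1 xs t <;> simp [nst, t1]
  · unfold rcSt; rw [rowSt_succ, hR]; cases rowSt m2 (conj (rowOut m1 xs)) t <;> simp [nst, t2]
  · rw [colOut_none]; exact ⟨t2, rowOut_none.2 ⟨t1, hx⟩⟩

theorem rc_early (hv : Valid xs) (h1 : xs m1 = none) (h2 : xs m2 = none) (hne : m1 ≠ m2) (t : ℕ)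
    {x : ℕ} (hx : xs t = some x) (ha : rowSt m1 xs t = none) (hb : rcSt m1 m2 xs t = none) :
    rowSt m1 xs (t + 1) = none ∧ rcSt m1 m2 xs (t + 1) = none ∧
    colOut m2 (rowOut m1 xs) t = some x := by
  obtain ⟨E1, E2⟩ := rc_formula hv h1 h2 hne t
  have t1 : t ≠ m1 := by rintro rfl; simp [h1] at hx
  have t2 : t ≠ m2 := by rintro rfl; simp [h2] at hx
  have gx := hv t x hx
  have R : rowOut m1 xs t = some x := by
    simp [rowOut, nout, t1, hx, ha]
  have B2 : rowOut m2 (conj (rowOut m1 xs)) t = nout false none (conj (rowOut m1 xs) t) := by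
    unfold rcSt at hb
    rw [rowOut, hb]; simp [t2]
  refine ⟨?_, ?_, ?_⟩
  · simp [rowSt_succ, nst, t1, hx, ha]
  · unfold rcSt at hb ⊢
    rw [rowSt_succ, hb, E1, R]; simp [nst, t2]
  · rw [E2, B2, E1, R, ha, hb]; simp [nout, gx]

theorem rc_insC (hv : Valid xs) (h1 : xs m1 = none) (h2 : xs m2 = none) (hne : m1 ≠ m2)
    (ha : rowSt m1 xs m2 = none) :
    rowSt m1 xs (m2 + 1) = none ∧ rcSt m1 m2 xs (m2 + 1) = some 0 ∧
    colOut m2 (rowOut m1 xs) m2 = some (cnt (conj xs) m2 0) := by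
  obtain ⟨E1, E2⟩ := rc_formula hv h1 h2 hne m2
  have t1 : m2 ≠ m1 := hne.symm
  refine ⟨?_, ?_, ?_⟩
  · simp [rowSt_succ, nst, t1, h2, ha]
  · unfold rcSt
    rw [rowSt_succ]; simp [nst]
  · rw [E2, ha, rowOut]; simp [nout, rcSt, rowSt_none_of_le]

theorem rc_insR (hv : Valid xs) (h1 : xs m1 = none) (h2 : xs m2 = none) (hne : m1 ≠ m2)
    {b : ℕ} (hb : rcSt m1 m2 xs m1 = some b) :
    (cnt xs m1 0 = b → rowSt m1 xs (m1 + 1) = some 0 ∧ rcSt m1 m2 xs (m1 + 1) = some (b + 1) ∧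
      colOut m2 (rowOut m1 xs) m1 = some (cnt (conj xs) m1 (b + 1))) ∧
    (cnt xs m1 0 ≠ b → rowSt m1 xs (m1 + 1) = some 0 ∧ rcSt m1 m2 xs (m1 + 1) = some b ∧
      colOut m2 (rowOut m1 xs) m1 = some 0) := by
  obtain ⟨E1, E2⟩ := rc_formula hv h1 h2 hne m1
  have ha := rowSt_none_of_le m1 xs m1 le_rfl
  have R : rowOut m1 xs m1 = some 0 := by simp [rowOut, nout]
  have S : rowSt m1 xs (m1 + 1) = some 0 := by simp [rowSt_succ, nst]
  have hz := (hv.dual m1).zero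
  have B : rcSt m1 m2 xs (m1 + 1) = nst false (some b) (conj (rowOut m1 xs) m1) := by
    unfold rcSt at hb ⊢
    rw [rowSt_succ, hb]; simp [hne]
  have B2 : rowOut m2 (conj (rowOut m1 xs)) m1 = nout false (some b) (conj (rowOut m1 xs) m1) := by
    unfold rcSt at hb
    rw [rowOut, hb]; simp [hne]
  rw [B2, E1, R, ha, hb] at E2
  rw [B, E1, R, S, E2, ha]
  refine ⟨fun q => ?_, fun q => ?_⟩
  · simp [q, nst, nout]
  · have q' : ¬ b = cnt xs m1 0 := fun e => q e.symm
    simp [q, q', nst, nout, hz]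

end RC

def mPure (s : (ℕ × ℕ) × Bool) : Prop := s.2 = false ∧ s.1.1 ≠ s.1.2

instance (s : (ℕ × ℕ) × Bool) : Decidable (mPure s) := by unfold mPure; infer_instance

def corrA (s : (ℕ × ℕ) × Bool) : ℕ := if mPure s then s.1.1 else s.1.2
def corrB (s : (ℕ × ℕ) × Bool) : ℕ := if mPure s then s.1.1 else s.1.2 + 1

theorem SD.above {f g : ℕ → ℕ} (hd : SD f g) {c : ℕ} (h : f c = c) :
    g (c + 1) ≤ c ∧ f (c + 1) = c + 1 := by
  obtain ⟨d1, d2, d3⟩ := hd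
  have k1 := d1 (c + 1) (c + 1) le_rfl
  have k2 := d1 c (c + 1) (by omega)
  have k4 := d3 (c + 1)
  have l : g (c + 1) ≤ c := by omega
  exact ⟨l, by omega⟩

theorem SD.pure_next {f g : ℕ → ℕ} (hd : SD f g) {r c : ℕ} (hA : SAdd f g (r, c)) (h : r ≠ c) :
    g (r + 1) = (if c = r + 1 then r else if r + 1 = f (r + 1) then r + 1 else r + 2) ∧
    (c = r + 1 → f (r + 1) = r + 1) := by
  obtain ⟨d1, d2, d3⟩ := hd
  obtain ⟨b1, b2, b3⟩ := hA
  simp only at b1 b2 b3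
  have k1 := d1 (r + 1) (r + 1) le_rfl
  have k2 := d1 r (r + 1) (by omega)
  have k5 := d3 (r + 1)
  have k8 := d2 (r + 1)
  constructor
  · split_ifs with w1 w2
    · rw [← w1, b2]
    · omega
    · omega
  · rintro rfl; omega

set_option maxHeartbeats 1000000
section
variable {X : ℕ → Option (ℕ × ℕ)} {m : ℕ}

theorem dbl_step_pure (hv : SV X) (hm : X m = none) (t : ℕ) (htm : t ≠ m)
    {r c r0 c0 : ℕ} (hx : X t = some (r, c)) (hA : SAdd (sfn X t) (sgn X t) (r0, c0))
    (hne : r0 ≠ c0)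
    (ha : rowSt (2 * m + 1) (dbl X) (2 * t) = some r0)
    (hb : rcSt (2 * m + 1) (2 * m) (dbl X) (2 * t) = some r0) :
    ((r, c) ≠ (r0, c0) → rowSt (2 * m + 1) (dbl X) (2 * (t + 1)) = some r0 ∧
      rcSt (2 * m + 1) (2 * m) (dbl X) (2 * (t + 1)) = some r0 ∧
      colOut (2 * m) (rowOut (2 * m + 1) (dbl X)) (2 * t) = some c ∧
      colOut (2 * m) (rowOut (2 * m + 1) (dbl X)) (2 * t + 1) = some r) ∧
    ((r, c) = (r0, c0) → rowSt (2 * m + 1) (dbl X) (2 * (t + 1)) = some (r0 + 1) ∧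
      rcSt (2 * m + 1) (2 * m) (dbl X) (2 * (t + 1)) =
        some (if r0 + 1 = sfn X t (r0 + 1) then r0 + 2 else r0 + 1) ∧
      colOut (2 * m) (rowOut (2 * m + 1) (dbl X)) (2 * t) = some (sfn X t (r0 + 1)) ∧
      colOut (2 * m) (rowOut (2 * m + 1) (dbl X)) (2 * t + 1) = some (r0 + 1)) := by
  have hV := valid_dbl hv
  have o1 : dbl X (2 * m + 1) = none := by rw [dbl_odd, hm]; rfl
  have o2 : dbl X (2 * m) = none := by rw [dbl_even, hm]; rfl
  have on : 2 * m + 1 ≠ 2 * m := by omega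
  have hx0 : dbl X (2 * t) = some c := by rw [dbl_even, hx]; rfl
  have hx1 : dbl X (2 * t + 1) = some r := by rw [dbl_odd, hx]; rfl
  have hX := hv t _ hx
  have hd := hv.sd t
  obtain ⟨q1, q2⟩ := SV.diag hd hX
  obtain ⟨q3, q4⟩ := SV.diag hd hA
  have F0 := cnt_dbl X t
  have F1 := cnt_dbl' X t
  have G0 := cnt_conj_dbl hv t
  have G1 := cnt_conj_dbl' hv t
  have S0 := rc_step hV o1 o2 on (2 * t) hx0 ha hb
  have hd' := hd
  have hA' := hA
  obtain ⟨a1, a2, a3⟩ := hX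
  obtain ⟨b1, b2, b3⟩ := hA
  obtain ⟨d1, d2, d3⟩ := hd
  simp only [hx, Option.map_some, Option.some.injEq] at a1 a2 a3 b1 b2 b3 F1 G1
  generalize sfn X t = f at *
  generalize sgn X t = g at *
  rw [if_neg (by omega)] at q4
  have c1 : c ≠ r0 := by rintro rfl; omega
  have c2 : cnt (dbl X) (2 * t) c = r := by have := F0 c; omega
  have e2 : 2 * (t + 1) = 2 * t + 1 + 1 := by ring
  rw [e2]
  constructor
  · intro hne2
    have nr : r ≠ r0 := by rintro rfl; apply hne2; rw [← a1, b1]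
    have nc : c ≠ c0 := by rintro rfl; apply hne2; rw [← a2, b2]
    obtain ⟨s1, s2, s3⟩ := S0.1 c1 (by omega)
    have S1 := rc_step hV o1 o2 on (2 * t + 1) hx1 s1 s2
    have c3 : cnt (dbl X) (2 * t + 1) r ≠ r0 := by
      have h5 := F1 r
      have h6 : cnt (dbl X) (2 * t + 1) r = c + 1 := by
        split_ifs at q2 h5 <;> omega
      intro h7
      have := d1 c r0 (by omega)
      omega
    obtain ⟨u1, u2, u3⟩ := S1.1 nr c3
    exact ⟨u1, u2, s3, u3⟩
  · intro he
    obtain ⟨rfl, rfl⟩ := Prod.mk.inj he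
    obtain ⟨s1, s2, s3⟩ := S0.2.1 c1 c2
    have S1 := rc_step hV o1 o2 on (2 * t + 1) hx1 s1 s2
    have g0 := G0 (r + 1)
    have f0 := F0 r
    have f1 := F1 (r + 1)
    have f2 := F1 r
    have g1 := G1 (r + 2)
    simp only [Nat.add_eq_zero_iff, one_ne_zero, and_false, if_false, Nat.add_sub_cancel] at g0
    rw [if_neg (by omega)] at s3
    have k5 := d3 (r + 1)
    clear d1 d2 d3
    obtain ⟨l0, l00⟩ := hd'.pure_next hA' hne
    have s3' : colOut (2 * m) (rowOut (2 * m + 1) (dbl X)) (2 * t) = some (f (r + 1)) := by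
      rw [s3]; congr 1; omega
    have e5 : r + 2 - 1 = r + 1 := rfl
    rw [e5] at g1
    rw [if_neg (by omega), if_neg (by omega)] at g1
    rw [if_neg (by omega)] at f2
    have e6 : r + 1 + 1 = r + 2 := rfl
    rw [e6] at S1
    clear s3 S0 F0 F1 G0 G1
    by_cases hdg : r + 1 = f (r + 1)
    · rw [if_pos hdg]
      obtain ⟨u1, u2, u3⟩ := S1.2.2.2 rfl (by clear S1; split_ifs at f1 l0 <;> omega)
      refine ⟨u1, u2, s3', ?_⟩
      rw [u3]; congr 1
      have l4 := (hd'.above hdg.symm).2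
      rw [e6] at l4
      rw [l4] at g1
      clear S1 u1 u2 u3 s1 s2 s3'
      split_ifs at f1 l0 ⊢ <;> omega
    · rw [if_neg hdg]
      obtain ⟨u1, u2, u3⟩ := S1.2.2.1 rfl (by clear S1; split_ifs at f1 l0 <;> omega)
      exact ⟨u1, u2, s3', u3⟩

theorem dbl_step_prim (hv : SV X) (hm : X m = none) (t : ℕ) (htm : t ≠ m)
    {r c r0 c0 : ℕ} (hx : X t = some (r, c)) (hA : SAdd (sfn X t) (sgn X t) (r0, c0))
    (ha : rowSt (2 * m + 1) (dbl X) (2 * t) = some c0)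
    (hb : rcSt (2 * m + 1) (2 * m) (dbl X) (2 * t) = some (c0 + 1)) :
    ((r, c) ≠ (r0, c0) → rowSt (2 * m + 1) (dbl X) (2 * (t + 1)) = some c0 ∧
      rcSt (2 * m + 1) (2 * m) (dbl X) (2 * (t + 1)) = some (c0 + 1) ∧
      colOut (2 * m) (rowOut (2 * m + 1) (dbl X)) (2 * t) = some c ∧
      colOut (2 * m) (rowOut (2 * m + 1) (dbl X)) (2 * t + 1) = some r) ∧
    ((r, c) = (r0, c0) → rowSt (2 * m + 1) (dbl X) (2 * (t + 1)) = some (c0 + 1) ∧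
      rcSt (2 * m + 1) (2 * m) (dbl X) (2 * (t + 1)) = some (c0 + 2) ∧
      colOut (2 * m) (rowOut (2 * m + 1) (dbl X)) (2 * t) = some (c0 + 1) ∧
      colOut (2 * m) (rowOut (2 * m + 1) (dbl X)) (2 * t + 1) = some (sgn X t (c0 + 1))) := by
  have hV := valid_dbl hv
  have o1 : dbl X (2 * m + 1) = none := by rw [dbl_odd, hm]; rfl
  have o2 : dbl X (2 * m) = none := by rw [dbl_even, hm]; rfl
  have on : 2 * m + 1 ≠ 2 * m := by omega
  have hx0 : dbl X (2 * t) = some c := by rw [dbl_even, hx]; rfl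
  have hx1 : dbl X (2 * t + 1) = some r := by rw [dbl_odd, hx]; rfl
  have hX := hv t _ hx
  have hd := hv.sd t
  obtain ⟨q1, q2⟩ := SV.diag hd hX
  obtain ⟨q3, q4⟩ := SV.diag hd hA
  have F0 := cnt_dbl X t
  have F1 := cnt_dbl' X t
  have G0 := cnt_conj_dbl hv t
  have G1 := cnt_conj_dbl' hv t
  have S0 := rc_step hV o1 o2 on (2 * t) hx0 ha hb
  have hd' := hd
  have hA' := hA
  obtain ⟨a1, a2, a3⟩ := hX
  obtain ⟨b1, b2, b3⟩ := hA
  obtain ⟨d1, d2, d3⟩ := hd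
  simp only [hx, Option.map_some, Option.some.injEq] at a1 a2 a3 b1 b2 b3 F1 G1
  generalize sfn X t = f at *
  generalize sgn X t = g at *
  have c2 : cnt (dbl X) (2 * t) c = r := by have := F0 c; omega
  have e2 : 2 * (t + 1) = 2 * t + 1 + 1 := by ring
  rw [e2]
  have c3 : cnt (dbl X) (2 * t + 1) r = c + 1 := by
    have := F1 r
    split_ifs at * <;> omega
  constructor
  · intro hne2
    have nr : r ≠ r0 := by rintro rfl; apply hne2; rw [← a1, b1]
    have nc : c ≠ c0 := by rintro rfl; apply hne2; rw [← a2, b2]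
    have k1 := d1 r0 c0 b3
    have k2 := d1 r c a3
    have k3 := d1 r r le_rfl
    have k4 := d1 c0 c0 le_rfl
    have k5 := d1 (c0 + 1) (c0 + 1) le_rfl
    have k6 := d1 c0 (c0 + 1) (by omega)
    have k7 := d2 c0
    have k8 := d2 (c0 + 1)
    have k9 := d3 (c0 + 1)
    have r1 : r ≠ c0 + 1 := by rintro rfl; split_ifs at q2 <;> omega
    have r2 : r ≠ c0 := by rintro rfl; split_ifs at q2 q4 <;> omega
    obtain ⟨s1, s2, s3⟩ := S0.1 nc (by omega)
    have S1 := rc_step hV o1 o2 on (2 * t + 1) hx1 s1 s2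
    obtain ⟨u1, u2, u3⟩ := S1.1 r2 (by omega)
    exact ⟨u1, u2, s3, u3⟩
  · intro he
    obtain ⟨rfl, rfl⟩ := Prod.mk.inj he
    clear d1 d2 d3
    obtain ⟨l1, l2⟩ := hd'.above q3
    obtain ⟨l3, l4⟩ := hd'.above l2
    have e7 : c + 1 + 1 = c + 2 := rfl
    rw [e7] at l3 l4
    have f0 := F0 (c + 1)
    have f1 := F1 (c + 1)
    have g1 := G1 (c + 2)
    have e5 : c + 2 - 1 = c + 1 := rfl
    rw [e5] at g1
    rw [if_neg (by omega), if_neg (by omega)] at g1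
    rw [if_neg (by omega)] at f1
    obtain ⟨s1, s2, s3⟩ := S0.2.2.1 rfl (by omega)
    have S1 := rc_step hV o1 o2 on (2 * t + 1) hx1 s1 s2
    obtain ⟨u1, u2, u3⟩ := S1.2.1 (by omega) (by omega)
    refine ⟨u1, u2, s3, ?_⟩
    rw [e7] at u3
    rw [u3, if_neg (by omega)]; congr 1
    omega

theorem dbl_step (hv : SV X) (hm : X m = none) (t : ℕ)
    (ha : rowSt (2 * m + 1) (dbl X) (2 * t) = (mSt m X t).map corrA)
    (hb : rcSt (2 * m + 1) (2 * m) (dbl X) (2 * t) = (mSt m X t).map corrB) :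
    rowSt (2 * m + 1) (dbl X) (2 * (t + 1)) = (mSt m X (t + 1)).map corrA ∧
    rcSt (2 * m + 1) (2 * m) (dbl X) (2 * (t + 1)) = (mSt m X (t + 1)).map corrB ∧
    colOut (2 * m) (rowOut (2 * m + 1) (dbl X)) (2 * t) = (mOut m X t).map Prod.snd ∧
    colOut (2 * m) (rowOut (2 * m + 1) (dbl X)) (2 * t + 1) = (mOut m X t).map Prod.fst := by
  have hV := valid_dbl hv
  have o1 : dbl X (2 * m + 1) = none := by rw [dbl_odd, hm]; rfl
  have o2 : dbl X (2 * m) = none := by rw [dbl_even, hm]; rfl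
  have on : 2 * m + 1 ≠ 2 * m := by omega
  have e2 : 2 * (t + 1) = 2 * t + 1 + 1 := by ring
  have hadd := mSt_add hv hm t
  rw [mSt_succ, mOut]
  by_cases htm : t = m
  · subst htm
    have hn := mSt_none_of_le t X t le_rfl
    rw [hn] at ha
    obtain ⟨s1, s2, s3⟩ := rc_insC hV o1 o2 on ha
    have S := rc_insR hV o1 o2 on s2
    have F1 := cnt_dbl' X t 0
    have G0 := cnt_conj_dbl hv t 0
    have G1 := cnt_conj_dbl' hv t 1
    simp [hm] at F1 G0 G1
    obtain ⟨d1, d2, d3⟩ := hv.sd t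
    have k1 := d1 0 0 le_rfl
    have k2 := d1 0 1 (by omega)
    have k3 := d1 1 1 (by omega)
    have k4 := d2 0
    have k5 := d2 1
    have k6 := d3 1
    rw [e2]
    simp only [mst, mout, decide_true, if_true, Option.map_some]
    by_cases h0 : sfn X t 0 = 0
    · obtain ⟨u1, u2, u3⟩ := S.1 (by omega)
      refine ⟨?_, ?_, ?_, ?_⟩
      · rw [u1]; simp [corrA]; omega
      · rw [u2]; simp [corrB, mPure, h0]
      · rw [s3]; congr 1
      · rw [u3]; congr 1; simp only [Nat.zero_add]; omega
    · obtain ⟨u1, u2, u3⟩ := S.2 (by omega)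
      refine ⟨?_, ?_, ?_, u3⟩
      · rw [u1]; simp [corrA, mPure]; try omega
      · rw [u2]; simp [corrB, mPure]; try omega
      · rw [s3]; congr 1
  · simp only [mst, mout, htm, decide_false, Bool.false_eq_true, if_false]
    rcases hx : X t with _ | ⟨r, c⟩
    · have z0 : dbl X (2 * t) = none := by rw [dbl_even, hx]; rfl
      have z1 : dbl X (2 * t + 1) = none := by rw [dbl_odd, hx]; rfl
      obtain ⟨s1, s2, s3⟩ := rc_none hV o1 o2 on (2 * t) (by omega) (by omega) z0
      obtain ⟨u1, u2, u3⟩ := rc_none hV o1 o2 on (2 * t + 1) (by omega) (by omega) z1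
      rw [e2, u1, u2, u3, s1, s2, s3, ha, hb]
      rcases mSt m X t <;> simp
    · have hx0 : dbl X (2 * t) = some c := by rw [dbl_even, hx]; rfl
      have hx1 : dbl X (2 * t + 1) = some r := by rw [dbl_odd, hx]; rfl
      rcases hs : mSt m X t with _ | ⟨⟨r0, c0⟩, p⟩
      · rw [hs] at ha hb
        obtain ⟨s1, s2, s3⟩ := rc_early hV o1 o2 on (2 * t) hx0 ha hb
        obtain ⟨u1, u2, u3⟩ := rc_early hV o1 o2 on (2 * t + 1) hx1 s1 s2
        rw [e2, u1, u2, u3, s3]; simp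
      · have hA := hadd _ hs
        rw [hs] at ha hb
        by_cases hp : mPure ((r0, c0), p)
        · simp only [corrA, corrB, hp, Option.map_some, if_true] at ha hb
          have K := dbl_step_pure hv hm t htm hx hA hp.2 ha hb
          by_cases he : (r, c) = (r0, c0)
          · obtain ⟨k1, k2, k3, k4⟩ := K.2 he
            rw [k1, k2, k3, k4, he]
            have hp' : p = false ∧ r0 ≠ c0 := hp
            simp only [Option.map_some, if_true, mNext, if_pos hp', true_and]
            refine ⟨?_, ?_⟩
            · simp [corrA, mPure]; try omega
            · simp [corrB, mPure]
              split_ifs with h7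
              · rw [← h7]
              · rfl
          · obtain ⟨k1, k2, k3, k4⟩ := K.1 he
            rw [k1, k2, k3, k4]
            simp [he, corrA, corrB, hp]
        · simp only [corrA, corrB, hp, Option.map_some, if_false] at ha hb
          have K := dbl_step_prim hv hm t htm hx hA ha hb
          by_cases he : (r, c) = (r0, c0)
          · obtain ⟨k1, k2, k3, k4⟩ := K.2 he
            rw [k1, k2, k3, k4, he]
            have hp' : ¬ (p = false ∧ r0 ≠ c0) := hp
            simp only [Option.map_some, if_true, mNext, if_neg hp', true_and]
            simp [corrA, corrB, mPure]
          · obtain ⟨k1, k2, k3, k4⟩ := K.1 he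
            rw [k1, k2, k3, k4]
            simp [he, corrA, corrB, hp]

theorem dbl_mOut (hv : SV X) (hm : X m = none) :
    colOut (2 * m) (rowOut (2 * m + 1) (dbl X)) = dbl (mOut m X) := by
  have key : ∀ t, rowSt (2 * m + 1) (dbl X) (2 * t) = (mSt m X t).map corrA ∧
      rcSt (2 * m + 1) (2 * m) (dbl X) (2 * t) = (mSt m X t).map corrB := by
    intro t
    induction t with
    | zero => exact ⟨rfl, rfl⟩
    | succ t ih => exact ⟨(dbl_step hv hm t ih.1 ih.2).1, (dbl_step hv hm t ih.1 ih.2).2.1⟩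
  funext n
  obtain ⟨t, rfl | rfl⟩ : ∃ t, n = 2 * t ∨ n = 2 * t + 1 := ⟨n / 2, by omega⟩
  · rw [dbl_even]; exact (dbl_step hv hm t (key t).1 (key t).2).2.2.1
  · rw [dbl_odd]; exact (dbl_step hv hm t (key t).1 (key t).2).2.2.2

end

/-! Folds -/

def mFold (ms : List ℕ) (X : ℕ → Option (ℕ × ℕ)) : ℕ → Option (ℕ × ℕ) :=
  ms.foldl (fun x m => mOut m x) X

def colFold (ms : List ℕ) (xs : ℕ → Option ℕ) : ℕ → Option ℕ :=
  ms.foldl (fun x m => colOut m x) xs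

theorem rowFold_cons (m : ℕ) (ms : List ℕ) (xs : ℕ → Option ℕ) :
    rowFold (m :: ms) xs = rowFold ms (rowOut m xs) := rfl

theorem Valid.rowFold {ms : List ℕ} : ∀ {xs : ℕ → Option ℕ}, Valid xs → ms.Nodup →
    (∀ m ∈ ms, xs m = none) → Valid (rowFold ms xs) := by
  induction ms with
  | nil => intro xs h _ _; exact h
  | cons m ms ih =>
    intro xs h hn hx
    rw [List.nodup_cons] at hn
    refine ih (h.rowOut (hx m (by simp))) hn.2 (fun k hk => rowOut_none.2 ⟨?_, hx k (by simp [hk])⟩)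
    rintro rfl; exact hn.1 hk

theorem colFold_eq {ms : List ℕ} : ∀ {xs : ℕ → Option ℕ}, Valid xs → ms.Nodup →
    (∀ m ∈ ms, xs m = none) → colFold ms xs = conj (rowFold ms (conj xs)) := by
  induction ms with
  | nil => intro xs h _ _; exact (conj_conj h).symm
  | cons m ms ih =>
    intro xs h hn hx
    rw [List.nodup_cons] at hn
    have hm := hx m (by simp)
    have e : colFold (m :: ms) xs = colFold ms (colOut m xs) := rfl
    rw [e, ih (h.colOut hm) hn.2 (fun k hk => colOut_none.2 ⟨?_, hx k (by simp [hk])⟩), colOut,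
      conj_conj (h.conj.rowOut (conj_eq_none.2 hm)), rowFold_cons]
    rintro rfl; exact hn.1 hk

theorem colOut_rowFold {us : List ℕ} : ∀ {xs : ℕ → Option ℕ} {m : ℕ}, Valid xs → us.Nodup →
    (∀ k ∈ us, xs k = none) → xs m = none → m ∉ us →
    colOut m (rowFold us xs) = rowFold us (colOut m xs) := by
  induction us with
  | nil => intro xs m h _ _ _ _; rfl
  | cons u us ih =>
    intro xs m h hn hx hm hmu
    rw [List.nodup_cons] at hn
    simp at hmu
    have hu := hx u (by simp)
    rw [rowFold_cons, rowFold_cons, ih (h.rowOut hu) hn.2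
      (fun k hk => rowOut_none.2 ⟨?_, hx k (by simp [hk])⟩) (rowOut_none.2 ⟨hmu.1, hm⟩) hmu.2,
      switch h hu hm (fun e => hmu.1 e.symm)]
    rintro rfl; exact hn.1 hk

theorem mFold_cons (m : ℕ) (ms : List ℕ) (X : ℕ → Option (ℕ × ℕ)) :
    mFold (m :: ms) X = mFold ms (mOut m X) := rfl

theorem dbl_mFold {ms : List ℕ} : ∀ {X : ℕ → Option (ℕ × ℕ)}, SV X → ms.Nodup →
    (∀ k ∈ ms, X k = none) →
    dbl (mFold ms X) = colFold (ms.map (2 * ·)) (rowFold (ms.map (2 * · + 1)) (dbl X)) := by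
  induction ms with
  | nil => intro X h _ _; rfl
  | cons m ms ih =>
    intro X h hn hx
    rw [List.nodup_cons] at hn
    have hm := hx m (by simp)
    have hV := valid_dbl h
    have o1 : dbl X (2 * m + 1) = none := by rw [dbl_odd, hm]; rfl
    have o2 : dbl X (2 * m) = none := by rw [dbl_even, hm]; rfl
    rw [mFold_cons, ih (h.mOut hm) hn.2 (fun k hk => mOut_none.2 ⟨?_, hx k (by simp [hk])⟩)]
    · rw [← dbl_mOut h hm, List.map_cons, List.map_cons, rowFold_cons]
      have e : ∀ xs, colFold (2 * m :: ms.map (2 * ·)) xs =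
        colFold (ms.map (2 * ·)) (colOut (2 * m) xs) := fun _ => rfl
      rw [e, colOut_rowFold (hV.rowOut o1)]
      · exact hn.2.map (fun a b hab => by simpa using hab)
      · intro k hk
        obtain ⟨i, hi, rfl⟩ := List.mem_map.1 hk
        refine rowOut_none.2 ⟨?_, by rw [dbl_odd, hx i (by simp [hi])]; rfl⟩
        intro h2
        have : i = m := by omega
        subst this; exact hn.1 hi
      · exact rowOut_none.2 ⟨by omega, o2⟩
      · intro hk
        obtain ⟨i, hi, h2⟩ := List.mem_map.1 hk
        omega
    · rintro rfl; exact hn.1 hk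

theorem mFold_plac {u v : List ℕ} (h : Plac u v) (hn : u.Nodup) :
    mFold u (fun _ => none) = mFold v (fun _ => none) := by
  have hn' : v.Nodup := h.perm.nodup_iff.1 hn
  have hS : SV (fun _ => none) := by intro t A hA; simp at hA
  have hV := valid_dbl hS
  have hd : ∀ n, dbl (fun _ => none) n = none := by intro n; simp [dbl]
  apply dbl_inj
  have i1 : Function.Injective (2 * · + 1 : ℕ → ℕ) := fun a b hab => by simpa using hab
  have i2 : Function.Injective (2 * · : ℕ → ℕ) := fun a b hab => by simpa using hab
  have m1 : StrictMono (2 * · + 1 : ℕ → ℕ) := fun a b hab => by simp only; omega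
  have m2 : StrictMono (2 * · : ℕ → ℕ) := fun a b hab => by simp only; omega
  rw [dbl_mFold hS hn (fun _ _ => rfl), dbl_mFold hS hn' (fun _ _ => rfl)]
  rw [← rowFold_plac (h.map _ m1) _ (hn.map i1) (fun _ _ => hd _)]
  have hW := Valid.rowFold hV (hn.map i1) (fun _ _ => hd _)
  have hz : ∀ k ∈ u.map (2 * ·), rowFold (u.map (2 * · + 1)) (dbl fun _ => none) k = none := by
    intro k hk
    rw [rowFold_none]
    refine ⟨?_, hd _⟩
    intro hk2
    obtain ⟨i, hi, h1⟩ := List.mem_map.1 hk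
    obtain ⟨i', hi', h2⟩ := List.mem_map.1 hk2
    omega
  have hz' : ∀ k ∈ v.map (2 * ·), rowFold (u.map (2 * · + 1)) (dbl fun _ => none) k = none := by
    intro k hk
    exact hz k ((h.map _ m2).perm.mem_iff.2 hk)
  rw [colFold_eq hW (hn.map i2) hz, colFold_eq hW (hn'.map i2) hz']
  rw [rowFold_plac (h.map _ m2) _ (hn.map i2) (fun k hk => conj_eq_none.2 (hz k hk))]

/-! ### Part E: the row machine and RSK -/

def chainR (val : ℕ → ℕ) : List ℕ → (ℕ → Option ℕ) → ℕ → List (ℕ × Option ℕ)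
  | [], _, _ => []
  | m :: ms, xs, t => (val m, rowSt m xs t) :: chainR val ms (rowOut m xs) t

theorem chainR_append (val : ℕ → ℕ) (us vs : List ℕ) : ∀ (xs : ℕ → Option ℕ) (t : ℕ),
    chainR val (us ++ vs) xs t = chainR val us xs t ++ chainR val vs (rowFold us xs) t := by
  induction us with
  | nil => intros; rfl
  | cons u us ih => intro xs t; simp [chainR, ih, rowFold_cons]

theorem chainR_mem {val : ℕ → ℕ} {ms : List ℕ} : ∀ {xs : ℕ → Option ℕ} {t : ℕ} {b : ℕ × Option ℕ},
    b ∈ chainR val ms xs t → ∃ m ∈ ms, b.1 = val m ∧ (t ≤ m → b.2 = none) := by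
  induction ms with
  | nil => intro xs t b h; simp [chainR] at h
  | cons u us ih =>
    intro xs t b h
    simp only [chainR, List.mem_cons] at h
    rcases h with rfl | h
    · exact ⟨u, by simp, rfl, fun h => rowSt_none_of_le _ _ _ h⟩
    · obtain ⟨m, h1, h2⟩ := ih h
      exact ⟨m, by simp [h1], h2⟩

def R1 (a b : ℕ × Option ℕ) : Prop :=
  a.1 ≤ b.1 ∧ (a.1 = b.1 → ∀ ra rb, a.2 = some ra → b.2 = some rb → rb ≤ ra)

def S1 (v r : ℕ) (b : ℕ × Option ℕ) : Prop :=
  v ≤ b.1 ∧ (v = b.1 → ∀ rb, b.2 = some rb → rb < r)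

theorem row_hit {m t r : ℕ} {xs : ℕ → Option ℕ} (hx : xs t = some r) (hm : t ≠ m)
    (h : rowSt m xs t = some r) :
    rowSt m xs (t + 1) = some (r + 1) ∧ rowOut m xs t = some (r + 1) := by
  simp [rowSt_succ, rowOut, nst, nout, hm, hx, h]

theorem row_miss {m t r : ℕ} {xs : ℕ → Option ℕ} (hx : xs t = some r) (hm : t ≠ m)
    (h : rowSt m xs t ≠ some r) :
    rowSt m xs (t + 1) = rowSt m xs t ∧ rowOut m xs t = some r := by
  have h' : ¬ some r = rowSt m xs t := fun e => h e.symm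
  simp [rowSt_succ, rowOut, nst, nout, hm, hx, h']

theorem R1.toS {u r : ℕ} {b : ℕ × Option ℕ} (h : R1 (u, some r) b) : S1 u (r + 1) b := by
  refine ⟨h.1, fun e rb hb => ?_⟩
  have := h.2 e r rb rfl hb
  omega

theorem S1.toR {u r : ℕ} {b : ℕ × Option ℕ} (h : S1 u r b) : R1 (u, some r) b := by
  refine ⟨h.1, fun e ra rb ha hb => ?_⟩
  simp at ha; subst ha
  exact (h.2 e rb hb).le

theorem chainR_ext {val : ℕ → ℕ} {t : ℕ} (a : ℕ × Option ℕ) {ms : List ℕ} :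
    ∀ {xs : ℕ → Option ℕ} {v r : ℕ},
    t ∉ ms → xs t = some r → (∀ b ∈ chainR val ms xs t, S1 v r b) →
    (chainR val ms xs t).Pairwise R1 → (∀ b ∈ chainR val ms xs t, R1 a b) →
    (∀ C, a.2 = some C → a.1 ≤ v ∨ C ≠ r) →
    ∀ b ∈ chainR val ms xs (t + 1), R1 a b := by
  induction ms with
  | nil => intro xs v r _ _ _ _ _ _ b hb; simp [chainR] at hb
  | cons m ms ih =>
    intro xs v r ht hx hS hP hR ha b hb
    simp only [List.mem_cons, not_or] at ht
    simp only [chainR, List.mem_cons, List.pairwise_cons, forall_eq_or_imp] at hS hP hR hb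
    by_cases h : rowSt m xs t = some r
    · obtain ⟨h1, h2⟩ := row_hit hx ht.1 h
      rw [h] at hS hP hR
      rw [h1] at hb
      rcases hb with rfl | hb
      · refine ⟨hR.1.1, fun e ra rb hra hrb => ?_⟩
        simp at e hrb; subst hrb
        have k1 := hR.1.2 e ra r hra rfl
        have k2 := hS.1.1
        have k3 := hS.1.2
        simp at k2 k3
        rcases ha ra hra with h5 | h5 <;> omega
      · refine ih ht.2 h2 (fun b hb => (hP.1 b hb).toS) hP.2 hR.2 ?_ b hb
        intro C _; left; exact hR.1.1
    · obtain ⟨h1, h2⟩ := row_miss hx ht.1 h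
      rw [h1] at hb
      rcases hb with rfl | hb
      · exact hR.1
      · exact ih ht.2 h2 hS.2 hP.2 hR.2 ha b hb

theorem chainR_pend {val : ℕ → ℕ} {t : ℕ} {ms : List ℕ} :
    ∀ {xs : ℕ → Option ℕ} {v r : ℕ},
    t ∉ ms → xs t = some r → (∀ b ∈ chainR val ms xs t, S1 v r b) →
    (chainR val ms xs t).Pairwise R1 →
    ∀ b ∈ chainR val ms xs (t + 1), R1 (v, some r) b := by
  intro xs v r ht hx hS hP
  exact chainR_ext (v, some r) ht hx hS hP (fun b hb => (hS b hb).toR) (fun _ _ => Or.inl le_rfl)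

theorem chainR_pairwise {val : ℕ → ℕ} {t : ℕ} {ms : List ℕ} :
    ∀ {xs : ℕ → Option ℕ} {v r : ℕ},
    t ∉ ms → xs t = some r → (∀ b ∈ chainR val ms xs t, S1 v r b) →
    (chainR val ms xs t).Pairwise R1 → (chainR val ms xs (t + 1)).Pairwise R1 := by
  induction ms with
  | nil => intro xs v r _ _ _ _; simp [chainR]
  | cons m ms ih =>
    intro xs v r ht hx hS hP
    simp only [List.mem_cons, not_or] at ht
    simp only [chainR, List.mem_cons, List.pairwise_cons, forall_eq_or_imp] at hS hP ⊢
    by_cases h : rowSt m xs t = some r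
    · obtain ⟨h1, h2⟩ := row_hit hx ht.1 h
      rw [h] at hS hP
      rw [h1]
      exact ⟨chainR_pend ht.2 h2 (fun b hb => (hP.1 b hb).toS) hP.2,
        ih ht.2 h2 (fun b hb => (hP.1 b hb).toS) hP.2⟩
    · obtain ⟨h1, h2⟩ := row_miss hx ht.1 h
      rw [h1]
      refine ⟨chainR_ext _ ht.2 h2 hS.2 hP.2 hP.1 (fun C hC => Or.inr ?_), ih ht.2 h2 hS.2 hP.2⟩
      rintro rfl; exact h hC

def rowL (L : List (ℕ × Option ℕ)) (i : ℕ) : List ℕ :=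
  L.filterMap (fun b => if b.2 = some i then some b.1 else none)

theorem rowL_cons (v : ℕ) (s : Option ℕ) (L : List (ℕ × Option ℕ)) (i : ℕ) :
    rowL ((v, s) :: L) i = if s = some i then v :: rowL L i else rowL L i := by
  simp [rowL, List.filterMap_cons]; split_ifs <;> simp

theorem rowL_append (L M : List (ℕ × Option ℕ)) (i : ℕ) :
    rowL (L ++ M) i = rowL L i ++ rowL M i := by simp [rowL]

theorem rowL_lt {val : ℕ → ℕ} {t i : ℕ} {ms : List ℕ} :
    ∀ {xs : ℕ → Option ℕ} {r : ℕ}, t ∉ ms → xs t = some r → i < r →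
    rowL (chainR val ms xs (t + 1)) i = rowL (chainR val ms xs t) i := by
  induction ms with
  | nil => intros; rfl
  | cons m ms ih =>
    intro xs r ht hx hi
    simp only [List.mem_cons, not_or] at ht
    simp only [chainR, rowL_cons]
    by_cases h : rowSt m xs t = some r
    · obtain ⟨h1, h2⟩ := row_hit hx ht.1 h
      rw [h1, h, ih ht.2 h2 (by omega)]
      simp only [Option.some.injEq]
      rw [if_neg (by omega), if_neg (by omega)]
    · obtain ⟨h1, h2⟩ := row_miss hx ht.1 h
      rw [h1, ih ht.2 h2 hi]

theorem rskInsert_eq (x : ℕ) (T : List (List ℕ)) :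
    rskInsert x T = match (T.getD 0 []).findIdx? (fun z => decide (x < z)) with
      | none => (T.getD 0 [] ++ [x]) :: T.tail
      | some j => (T.getD 0 []).set j x :: rskInsert ((T.getD 0 []).getD j 0) T.tail := by
  cases T with
  | nil => simp [rskInsert]
  | cons a T =>
    simp only [rskInsert, List.getD_cons_zero, List.tail_cons]
    try (cases List.findIdx? (fun z => decide (x < z)) a <;> rfl)

theorem findIdx_none {l : List ℕ} {v : ℕ} (h : ∀ k ∈ l, k ≤ v) :
    l.findIdx? (fun z => decide (v < z)) = none := by
  rw [List.findIdx?_eq_none_iff]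
  intro k hk
  simpa using h k hk

theorem findIdx_some {l l' : List ℕ} {v u : ℕ} (h : ∀ k ∈ l, k ≤ v) (hu : v < u) :
    (l ++ u :: l').findIdx? (fun z => decide (v < z)) = some l.length := by
  rw [List.findIdx?_append, findIdx_none h]
  simp [List.findIdx?_cons, hu]

theorem rsk_main {val : ℕ → ℕ} {t : ℕ} {ms : List ℕ} :
    ∀ {xs : ℕ → Option ℕ} {v r : ℕ} {pre : ℕ → List ℕ} {T : List (List ℕ)},
    t ∉ ms → xs t = some r → (∀ b ∈ chainR val ms xs t, S1 v r b) →
    (chainR val ms xs t).Pairwise R1 →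
    (∀ k ∈ pre r, k ≤ v) → (∀ i, ∀ k ∈ pre i, ∀ b ∈ chainR val ms xs t, k ≤ b.1) →
    (∀ i, T.getD i [] = pre (r + i) ++ rowL (chainR val ms xs t) (r + i)) →
    ∀ i, (rskInsert v T).getD i [] = Function.update pre r (pre r ++ [v]) (r + i) ++
      rowL (chainR val ms xs (t + 1)) (r + i) := by
  induction ms with
  | nil =>
    intro xs v r pre T _ hx _ _ hp _ hT i
    have h0 := hT 0
    simp [chainR, rowL] at h0
    rw [rskInsert_eq, List.getD_eq_getElem?_getD, List.getD_eq_getElem?_getD, h0, findIdx_none hp]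
    rcases i with _ | i
    · simp [chainR, rowL]
    · have := hT (i + 1)
      simp [chainR, rowL] at this ⊢
      rw [this]
  | cons m ms ih =>
    intro xs v r pre T ht hx hS hP hp hpre hT i
    simp only [List.mem_cons, not_or] at ht
    simp only [chainR, List.mem_cons, List.pairwise_cons, forall_eq_or_imp] at hS hP hpre hT ⊢
    by_cases h : rowSt m xs t = some r
    · obtain ⟨h1, h2⟩ := row_hit hx ht.1 h
      rw [h] at hS hP
      simp only [h1, h, rowL_cons, Option.some.injEq] at hT ⊢
      have hlt : v < val m := by
        have k2 := hS.1.1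
        have k3 := hS.1.2
        simp at k2 k3
        omega
      have h0 := hT 0
      simp only [Nat.add_zero, if_true] at h0
      rw [rskInsert_eq, h0, findIdx_some hp hlt]
      simp only
      have e : (pre r ++ val m :: rowL (chainR val ms (rowOut m xs) t) r).getD (pre r).length 0
        = val m := by simp
      rw [e]
      rcases i with _ | i
      · simp only [List.getD_cons_zero, Nat.add_zero]
        rw [if_neg (by omega), rowL_lt ht.2 h2 (by omega)]
        simp
      · simp only [List.getD_cons_succ]
        rw [ih (r := r + 1) (pre := Function.update pre r (pre r ++ [v])) ht.2 h2
          (fun b hb => (hP.1 b hb).toS) hP.2]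
        · have e3 : r + (i + 1) = r + 1 + i := by ring
          rw [e3]
          by_cases e4 : i = 0
          · subst e4
            simp [Function.update]
          · rw [if_neg (by omega), Function.update_of_ne (by omega)]
        · intro k hk
          rw [Function.update_of_ne (by omega)] at hk
          exact (hpre _ k hk).1
        · intro i k hk b hb
          by_cases e4 : i = r
          · subst e4
            rw [Function.update_self] at hk
            rcases List.mem_append.1 hk with hk | hk
            · exact (hpre _ k hk).2 b hb
            · simp at hk; subst hk; exact (hS.2 b hb).1
          · rw [Function.update_of_ne e4] at hk
            exact (hpre _ k hk).2 b hb
        · intro i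
          have := hT (i + 1)
          rw [if_neg (by omega)] at this
          rw [Function.update_of_ne (by omega)]
          have e3 : r + (i + 1) = r + 1 + i := by ring
          rw [e3] at this
          rw [← this]
          cases T <;> simp
    · obtain ⟨h1, h2⟩ := row_miss hx ht.1 h
      rw [h1]
      rcases hs : rowSt m xs t with _ | a
      · simp only [hs, rowL_cons] at hT ⊢
        simp at hT ⊢
        simpa using ih (pre := pre) (T := T) ht.2 h2 hS.2 hP.2 hp (fun i k hk => (hpre i k hk).2)
          (by simpa using hT) i
      · have ar : a ≠ r := by rintro rfl; exact h hs
        rw [ih (pre := Function.update pre a (pre a ++ [val m])) ht.2 h2 hS.2 hP.2]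
        · rw [rowL_cons]
          simp only [Option.some.injEq]
          by_cases e4 : a = r + i
          · subst e4
            rw [if_pos rfl, Function.update_of_ne (by omega), Function.update_self,
              Function.update_of_ne (by omega)]
            simp
          · rw [if_neg e4]
            congr 1
            rw [Function.update_of_ne ar.symm]
            by_cases e5 : i = 0
            · subst e5; simp
            · rw [Function.update_of_ne (by omega), Function.update_of_ne (fun e => e4 e.symm),
                Function.update_of_ne (by omega)]
        · intro k hk
          rw [Function.update_of_ne ar.symm] at hk
          exact hp k hk
        · intro i k hk b hb
          by_cases e4 : i = a
          · subst e4
            rw [Function.update_self] at hk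
            rcases List.mem_append.1 hk with hk | hk
            · exact (hpre _ k hk).2 b hb
            · simp at hk; subst hk; exact (hP.1 b hb).1
          · rw [Function.update_of_ne e4] at hk
            exact (hpre _ k hk).2 b hb
        · intro i
          rw [hT i, rowL_cons, hs]
          simp only [Option.some.injEq]
          by_cases e4 : a = r + i
          · subst e4; simp
          · rw [if_neg e4, Function.update_of_ne (fun e => e4 e.symm)]

theorem chainR_none {val : ℕ → ℕ} {t : ℕ} {us : List ℕ} : ∀ {xs : ℕ → Option ℕ}, t ∉ us →
    xs t = none → chainR val us xs (t + 1) = chainR val us xs t := by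
  induction us with
  | nil => intros; rfl
  | cons m us ih =>
    intro xs ht hx
    simp only [List.mem_cons, not_or] at ht
    simp only [chainR]
    rw [ih ht.2 (rowOut_none.2 ⟨ht.1, hx⟩), rowSt_succ, hx]
    rcases rowSt m xs t <;> simp [nst, ht.1]

theorem rowL_length {val : ℕ → ℕ} {t i : ℕ} {ms : List ℕ} : ∀ {xs : ℕ → Option ℕ}, ms.Nodup →
    (∀ m ∈ ms, xs m = none) →
    cnt (rowFold ms xs) t i = cnt xs t i + (rowL (chainR val ms xs t) i).length := by
  induction ms with
  | nil => intros; rfl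
  | cons m ms ih =>
    intro xs hn hx
    rw [List.nodup_cons] at hn
    have h1 := ih (xs := rowOut m xs) hn.2 (fun k hk => rowOut_none.2
      ⟨by rintro rfl; exact hn.1 hk, hx k (by simp [hk])⟩)
    rw [rowFold_cons, h1, cnt_rowOut (hx m (by simp)), chainR, rowL_cons]
    split_ifs <;> simp <;> omega

theorem cnt_none (t i : ℕ) : cnt (fun _ => none) t i = 0 := by
  induction t with
  | zero => simp [cnt]
  | succ t ih => simp [cnt_succ, ih]

def stdOrd (val : ℕ → ℕ) (ms : List ℕ) : Prop :=
  ms.Pairwise (fun a b => val a < val b ∨ (val a = val b ∧ a < b))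

theorem stdOrd.nodup {val : ℕ → ℕ} {ms : List ℕ} (h : stdOrd val ms) : ms.Nodup := by
  refine List.Pairwise.imp ?_ h
  rintro a b hab rfl
  omega

theorem newCell_eq {T T' : List (List ℕ)} {r : ℕ}
    (h : ∀ i, (T'.getD i []).length = (T.getD i []).length + if i = r then 1 else 0) :
    newCell T T' = (r, (T.getD r []).length) := by
  have hr : r < T'.length := by
    by_contra hc
    have := h r
    rw [List.getD_eq_default _ _ (by omega)] at this
    simp at this
  unfold newCell
  have e : (List.range T'.length).findIdx
    (fun r => decide ((T.getD r []).length ≠ (T'.getD r []).length)) = r := by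
    rw [List.findIdx_eq (by simpa using hr)]
    constructor
    · rw [List.getElem_range, h r]; simp
    · intro j hj
      rw [List.getElem_range, h j, if_neg (by omega)]; simp
  simp only [e]

def RInv (val : ℕ → ℕ) (ms : List ℕ) (t : ℕ) (T : List (List ℕ)) : Prop :=
  (∀ i, T.getD i [] = rowL (chainR val ms (fun _ => none) t) i) ∧
  (chainR val ms (fun _ => none) t).Pairwise R1

theorem rowL_mem {L : List (ℕ × Option ℕ)} {i k : ℕ} (h : k ∈ rowL L i) :
    (k, some i) ∈ L := by
  simp only [rowL, List.mem_filterMap] at h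
  obtain ⟨⟨a, s⟩, h1, h2⟩ := h
  simp at h2
  obtain ⟨rfl, rfl⟩ := h2
  exact h1

theorem RInv.zero {val : ℕ → ℕ} {ms : List ℕ} (h : stdOrd val ms) : RInv val ms 0 [] := by
  have key : ∀ (ms : List ℕ) xs, ∀ b ∈ chainR val ms xs 0, b.2 = none := by
    intro ms xs b hb
    obtain ⟨m, _, _, h⟩ := chainR_mem hb
    exact h (Nat.zero_le _)
  constructor
  · intro i
    have : rowL (chainR val ms (fun _ => none) 0) i = [] := by
      rw [List.eq_nil_iff_forall_not_mem]
      intro k hk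
      have := key _ _ _ (rowL_mem hk)
      simp at this
    rw [this]; simp
  · unfold stdOrd at h
    generalize (fun _ => none : ℕ → Option ℕ) = xs
    induction ms generalizing xs with
    | nil => simp [chainR]
    | cons m ms ih =>
      rw [List.pairwise_cons] at h
      rw [chainR, List.pairwise_cons]
      refine ⟨fun b hb => ?_, ih h.2 _⟩
      obtain ⟨m', h1, h2, _⟩ := chainR_mem hb
      refine ⟨?_, ?_⟩
      · rw [h2]; have := h.1 m' h1; simp only; omega
      · intro _ ra rb _ hrb
        rw [key _ _ _ hb] at hrb; simp at hrb

theorem RInv.step {val : ℕ → ℕ} {ms : List ℕ} {t : ℕ} {T : List (List ℕ)} (h : stdOrd val ms)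
    (ht : t ∈ ms) (hI : RInv val ms t T) : RInv val ms (t + 1) (rskInsert (val t) T) := by
  obtain ⟨us, vs, rfl⟩ := List.append_of_mem ht
  have hn := h.nodup
  unfold stdOrd at h
  rw [List.pairwise_append, List.pairwise_cons] at h
  obtain ⟨h1, ⟨h2, h3⟩, h4⟩ := h
  have tu : t ∉ us := fun hu => by have := h4 t hu t (by simp); omega
  have tv : t ∉ vs := fun hu => by have := h2 t hu; omega
  obtain ⟨hT, hP⟩ := hI
  set xs : ℕ → Option ℕ := fun _ => none with hxs
  have x1 : rowFold us xs t = none := rowFold_none.2 ⟨tu, rfl⟩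
  have s1 : rowSt t (rowFold us xs) t = none := rowSt_none_of_le _ _ _ le_rfl
  have s2 : rowSt t (rowFold us xs) (t + 1) = some 0 := by simp [rowSt_succ, nst]
  have x2 : rowOut t (rowFold us xs) t = some 0 := by simp [rowOut, nout]
  simp only [RInv]
  rw [← hxs]
  simp only [chainR_append, chainR] at hT hP ⊢
  rw [chainR_none tu rfl, s2]
  rw [s1] at hP
  simp only [s1] at hT
  set ys := rowOut t (rowFold us xs)
  have hS : ∀ b ∈ chainR val vs ys t, S1 (val t) 0 b := by
    intro b hb
    obtain ⟨m, k1, k2, k3⟩ := chainR_mem hb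
    have k4 := h2 m k1
    refine ⟨by rw [k2]; omega, ?_⟩
    intro e rb hrb
    rw [k3 (by omega)] at hrb; simp at hrb
  have hu : ∀ b ∈ chainR val us xs t, b.1 ≤ val t := by
    intro b hb
    obtain ⟨m, k1, k2, k3⟩ := chainR_mem hb
    have := h4 m k1 t (by simp)
    rw [k2]; omega
  rw [List.pairwise_append, List.pairwise_cons] at hP
  obtain ⟨p1, ⟨p2, p3⟩, p4⟩ := hP
  constructor
  · intro i
    have := rsk_main (pre := rowL (chainR val us xs t)) (T := T) tv x2 hS p3
      (fun k hk => hu _ (rowL_mem hk))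
      (fun i k hk b hb => (p4 _ (rowL_mem hk) b (by simp [hb])).1)
      (fun i => by rw [hT i]; simp [rowL_append, rowL_cons]) i
    rw [this, rowL_append, rowL_cons]
    simp only [Nat.zero_add]
    rcases i with _ | i
    · simp
    · rw [Function.update_of_ne (by omega), if_neg (by simp)]
  · rw [List.pairwise_append, List.pairwise_cons]
    refine ⟨p1, ⟨chainR_pend tv x2 hS p3, chainR_pairwise tv x2 hS p3⟩, ?_⟩
    intro a ha b hb
    rcases List.mem_cons.1 hb with rfl | hb
    · refine ⟨hu a ha, fun _ ra rb _ hrb => ?_⟩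
      simp at hrb; omega
    · exact chainR_ext a tv x2 hS p3 (fun b hb => p4 a ha b (by simp [hb]))
        (fun _ _ => Or.inl (hu a ha)) b hb

def qFoldR (out : ℕ → Option ℕ) (t : ℕ) : List (List ℕ) :=
  (List.range t).foldl (fun Q i => match out i with
    | some r => setBox Q r (cnt out i r) (tsize Q + 1)
    | none => Q) []

theorem rskPQ_snoc (w : List ℕ) (x : ℕ) : rskPQ (w ++ [x]) =
    (rskInsert x (rskPQ w).1, setBox (rskPQ w).2 (newCell (rskPQ w).1 (rskInsert x (rskPQ w).1)).1
      (newCell (rskPQ w).1 (rskInsert x (rskPQ w).1)).2 (tsize (rskPQ w).2 + 1)) := by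
  simp [rskPQ]

theorem rsk_link {w : List ℕ} {ms : List ℕ} (h : stdOrd (fun i => w.getD i 0) ms)
    (hm : ∀ t, t < w.length → t ∈ ms) : ∀ t, t ≤ w.length →
    RInv (fun i => w.getD i 0) ms t (rskPQ (w.take t)).1 ∧
    (rskPQ (w.take t)).2 = qFoldR (rowFold ms (fun _ => none)) t := by
  intro t
  induction t with
  | zero => intro _; exact ⟨by simpa [rskPQ] using RInv.zero h, by simp [rskPQ, qFoldR]⟩
  | succ t ih =>
    intro ht
    obtain ⟨h1, h2⟩ := ih (by omega)
    have e : w.take (t + 1) = w.take t ++ [w.getD t 0] := by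
      rw [List.take_add_one]; simp [List.getElem?_eq_getElem (show t < w.length by omega)]
    have hs := h1.step h (hm t (by omega))
    rw [e, rskPQ_snoc]
    refine ⟨hs, ?_⟩
    have hsome : ∃ r, rowFold ms (fun _ => none) t = some r := by
      rcases hr : rowFold ms (fun _ => none) t with _ | r
      · exact absurd (hm t (by omega)) (rowFold_none.1 hr).1
      · exact ⟨r, rfl⟩
    obtain ⟨r, hr⟩ := hsome
    have len : ∀ t i, cnt (rowFold ms (fun _ => none)) t i =
        (rowL (chainR (fun i => w.getD i 0) ms (fun _ => none) t) i).length := by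
      intro t i
      rw [rowL_length (val := fun i => w.getD i 0) h.nodup (fun _ _ => rfl), cnt_none]
      simp
    have hc : newCell (rskPQ (w.take t)).1 (rskInsert (w.getD t 0) (rskPQ (w.take t)).1) =
        (r, cnt (rowFold ms (fun _ => none)) t r) := by
      rw [newCell_eq (r := r), h1.1, len]
      intro i
      rw [hs.1, h1.1, ← len, ← len, cnt_succ, hr]
      simp only [Option.some.injEq, eq_comm]
    simp only [hc]
    rw [h2, qFoldR, qFoldR, List.range_succ, List.foldl_append]
    simp [hr]

theorem rskQ_eq {w : List ℕ} {ms : List ℕ} (h : stdOrd (fun i => w.getD i 0) ms)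
    (hm : ∀ t, t < w.length → t ∈ ms) :
    rskQ w = qFoldR (rowFold ms (fun _ => none)) w.length := by
  have := (rsk_link h hm w.length le_rfl).2
  rwa [List.take_length] at this

/-! ### Part F: the mixed machine and shifted mixed insertion -/

def addF (f : ℕ → ℕ) (a : ℕ) : ℕ → ℕ := fun r => f r + if a = r then 1 else 0

abbrev St := (ℕ × ℕ) × Bool

def CV : (ℕ → ℕ) → (ℕ → ℕ) → List (ℕ × St) → Prop
  | _, _, [] => True
  | f, g, b :: L => SAdd f g b.2.1 ∧ CV (addF f b.2.1.1) (addF g b.2.1.2) L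

def stepL : (ℕ → ℕ) → (ℕ → ℕ) → ℕ × ℕ → List (ℕ × St) → List (ℕ × St)
  | _, _, _, [] => []
  | f, g, B, b :: L =>
    if b.2.1 = B then
      (b.1, mNext f g b.2) :: stepL (addF f b.2.1.1) (addF g b.2.1.2) (mNext f g b.2).1 L
    else b :: stepL (addF f b.2.1.1) (addF g b.2.1.2) B L

def stepB : (ℕ → ℕ) → (ℕ → ℕ) → ℕ × ℕ → List (ℕ × St) → ℕ × ℕ
  | _, _, B, [] => B
  | f, g, B, b :: L =>
    if b.2.1 = B then stepB (addF f b.2.1.1) (addF g b.2.1.2) (mNext f g b.2).1 L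
    else stepB (addF f b.2.1.1) (addF g b.2.1.2) B L

theorem stepL_length {L : List (ℕ × St)} : ∀ {f g : ℕ → ℕ} {B : ℕ × ℕ},
    (stepL f g B L).length = L.length := by
  induction L with
  | nil => intros; rfl
  | cons b L ih => intro f g B; simp only [stepL]; split_ifs <;> simp [ih]

def R2 (a b : ℕ × St) : Prop :=
  a.1 ≤ b.1 ∧ (a.1 = b.1 → (a.2.2 = false → b.2.2 = false ∧ b.2.1.1 ≤ a.2.1.1) ∧
    (a.2.2 = true → b.2.2 = true → b.2.1.2 ≤ a.2.1.2))

def S2 (a b : ℕ × St) : Prop :=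
  a.1 ≤ b.1 ∧ (a.1 = b.1 → (a.2.2 = false → b.2.2 = false ∧ b.2.1.1 < a.2.1.1) ∧
    (a.2.2 = true → b.2.2 = true → b.2.1.2 < a.2.1.2))

theorem R2.rfl (a : ℕ × St) : R2 a a :=
  ⟨le_rfl, fun _ => ⟨fun h => ⟨h, le_rfl⟩, fun _ _ => le_rfl⟩⟩

theorem S2.toR {a b : ℕ × St} (h : S2 a b) : R2 a b := by
  refine ⟨h.1, fun e => ⟨fun k => ?_, fun k k' => ?_⟩⟩
  · exact ⟨((h.2 e).1 k).1, ((h.2 e).1 k).2.le⟩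
  · exact ((h.2 e).2 k k').le

theorem R2.toS {u : ℕ} {s : St} {b : ℕ × St} (f g : ℕ → ℕ) (h : R2 (u, s) b) :
    S2 (u, mNext f g s) b := by
  obtain ⟨A, q⟩ := s
  obtain ⟨h1, h2⟩ := h
  refine ⟨h1, fun e => ?_⟩
  have h3 := h2 e
  simp only at h3
  unfold mNext
  split_ifs with hc
  · simp only at hc
    refine ⟨fun _ => ?_, fun k => by simp at k⟩
    have := h3.1 hc.1
    exact ⟨this.1, by simp; omega⟩
  · refine ⟨fun k => by simp at k, fun _ k => ?_⟩
    simp only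
    cases q
    · have := (h3.1 _root_.rfl).1; rw [k] at this; simp at this
    · have := h3.2 _root_.rfl k; omega

theorem addF_add {f g : ℕ → ℕ} {A B : ℕ × ℕ} (hA : SAdd f g A) (hB : SAdd f g B) (h : A ≠ B) :
    A.1 ≠ B.1 ∧ A.2 ≠ B.2 ∧ SAdd (addF f A.1) (addF g A.2) B := by
  obtain ⟨a1, a2, a3⟩ := hA
  obtain ⟨b1, b2, b3⟩ := hB
  have h1 : A.1 ≠ B.1 := fun e => h (Prod.ext e (by rw [← a1, ← b1, e]))
  have h2 : A.2 ≠ B.2 := fun e => h (Prod.ext (by rw [← a2, ← b2, e]) e)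
  exact ⟨h1, h2, by simp [SAdd, addF, h1, h2, b1, b2, b3]⟩

theorem SD.addF {f g : ℕ → ℕ} {A : ℕ × ℕ} (hd : SD f g) (hA : SAdd f g A) :
    SD (addF f A.1) (addF g A.2) := hd.step hA (fun _ => rfl) (fun _ => rfl)

theorem mNext_off {f g : ℕ → ℕ} {s : St} (hd : SD f g) (hA : SAdd f g s.1)
    (h : (mNext f g s).2 = true) : (mNext f g s).1.1 < (mNext f g s).1.2 := by
  obtain ⟨a1, a2, a3⟩ := hA
  unfold mNext at h ⊢
  split_ifs with hc
  · rw [if_pos hc] at h; simp at h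
  · have := hd.1 s.1.1 (s.1.2 + 1) (by omega)
    simp only
    omega

theorem R2_hit {a : ℕ × St} {f g : ℕ → ℕ} {u v : ℕ} {A : ℕ × ℕ} {p q : Bool} (hd : SD f g)
    (hA : SAdd f g A) (hp : p = true → A.1 < A.2) (hS : S2 (v, (A, p)) (u, (A, q)))
    (hR : R2 a (u, (A, q)))
    (ha : R2 a (v, (A, p)) ∨ (a.2.1.1 ≤ a.2.1.2 ∧ a.2.1.2 < f a.2.1.1 ∧ a.2.1.1 ≠ A.1 ∧
      a.2.1.2 ≠ A.2 ∧ (A.1 = A.2 → A.2 < a.2.1.2))) : R2 a (u, mNext f g (A, q)) := by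
  obtain ⟨z, ⟨C, s⟩⟩ := a
  refine ⟨hR.1, fun e => ?_⟩
  simp only at e
  subst e
  have r1 := hR.2 rfl
  obtain ⟨s1, s2⟩ := hS
  simp only at s1 s2 r1
  have l1 := hd.1 A.1 C.2
  have l2 := hd.1 C.1 C.2
  obtain ⟨c1, c2, c3⟩ := hA
  rcases ha with ⟨h1, h2⟩ | ⟨q1, q2, q3, q4, q5⟩
  · simp only at h1 h2
    have e : v = z := by omega
    have s3 := s2 e
    have h3 := h2 e.symm
    have pt : p = true := by
      cases p
      · have := (s3.1 rfl).2; omega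
      · rfl
    have qf : q = false := by
      cases q
      · rfl
      · have := s3.2 pt rfl; omega
    have st : s = true := by
      cases s
      · have := (h3.1 rfl).1; rw [pt] at this; simp at this
      · rfl
    have := hp pt
    subst qf st
    have hne : A.1 ≠ A.2 := by omega
    simp [mNext, hne]
  · simp only at q1 q2 q3 q4 q5
    cases s
    · obtain ⟨k1, k2⟩ := r1.1 rfl
      have hne : A.1 ≠ A.2 := by omega
      subst k1
      simp [mNext, hne]
      omega
    · refine ⟨fun k => by simp at k, fun _ => ?_⟩
      cases q
      · by_cases hne : A.1 = A.2
        · simp [mNext, hne]; omega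
        · simp [mNext, hne]
      · have := r1.2 rfl rfl
        simp [mNext]; omega

theorem stepL_ext (a : ℕ × St) {L : List (ℕ × St)} :
    ∀ {f g : ℕ → ℕ} {v : ℕ} {B : ℕ × ℕ} {p : Bool}, SD f g → CV f g L → SAdd f g B →
    (p = true → B.1 < B.2) → (∀ b ∈ L, S2 (v, (B, p)) b) → L.Pairwise R2 → (∀ b ∈ L, R2 a b) →
    (R2 a (v, (B, p)) ∨ (a.2.1.1 ≤ a.2.1.2 ∧ a.2.1.2 < f a.2.1.1 ∧ a.2.1.1 ≠ B.1 ∧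
      a.2.1.2 ≠ B.2 ∧ (B.1 = B.2 → B.2 < a.2.1.2))) →
    ∀ b ∈ stepL f g B L, R2 a b := by
  induction L with
  | nil => intro f g v B p _ _ _ _ _ _ _ _ b hb; simp [stepL] at hb
  | cons d L ih =>
    intro f g v B p hd hC hB hp hS hP hR ha b hb
    simp only [CV, List.mem_cons, List.pairwise_cons, forall_eq_or_imp] at hS hP hR hC
    simp only [stepL] at hb
    obtain ⟨u, ⟨A, q⟩⟩ := d
    simp only at hC hb
    by_cases h : A = B
    · subst h
      rw [if_pos rfl, List.mem_cons] at hb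
      have hn := mNext_add hd hC.1 q
      have key : R2 a (u, mNext f g (A, q)) := R2_hit hd hC.1 hp hS.1 hR.1 ha
      rcases hb with rfl | hb
      · exact key
      · exact ih (v := u) (p := (mNext f g (A, q)).2) (hd.addF hC.1) hC.2 hn.1
          (fun k => mNext_off hd hC.1 k) (fun b hb => (hP.1 b hb).toS f g) hP.2 hR.2 (Or.inl key) b hb
    · rw [if_neg h, List.mem_cons] at hb
      rcases hb with rfl | hb
      · exact hR.1
      · refine ih (hd.addF hC.1) hC.2 (addF_add hC.1 hB h).2.2 hp hS.2 hP.2 hR.2 ?_ b hb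
        refine ha.imp id ?_
        rintro ⟨q1, q2, q3⟩
        refine ⟨q1, ?_, q3⟩
        simp only [_root_.addF]; omega

theorem stepL_pend {L : List (ℕ × St)}
    {f g : ℕ → ℕ} {v : ℕ} {B : ℕ × ℕ} {p : Bool} (hd : SD f g) (hC : CV f g L) (hB : SAdd f g B)
    (hp : p = true → B.1 < B.2) (hS : ∀ b ∈ L, S2 (v, (B, p)) b) (hP : L.Pairwise R2) :
    ∀ b ∈ stepL f g B L, R2 (v, (B, p)) b :=
  stepL_ext _ hd hC hB hp hS hP (fun b hb => (hS b hb).toR) (Or.inl (R2.rfl _))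

theorem stepL_pairwise {L : List (ℕ × St)} :
    ∀ {f g : ℕ → ℕ} {v : ℕ} {B : ℕ × ℕ} {p : Bool}, SD f g → CV f g L → SAdd f g B →
    (p = true → B.1 < B.2) → (∀ b ∈ L, S2 (v, (B, p)) b) → L.Pairwise R2 →
    (stepL f g B L).Pairwise R2 := by
  induction L with
  | nil => intros; simp [stepL]
  | cons d L ih =>
    intro f g v B p hd hC hB hp hS hP
    simp only [CV, List.mem_cons, List.pairwise_cons, forall_eq_or_imp] at hS hP hC
    simp only [stepL]
    obtain ⟨u, ⟨A, q⟩⟩ := d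
    simp only at hC ⊢
    by_cases h : A = B
    · subst h
      rw [if_pos rfl, List.pairwise_cons]
      have hn := (mNext_add hd hC.1 q).1
      have ho : (mNext f g (A, q)).2 = true → _ := fun k => mNext_off hd hC.1 k
      exact ⟨stepL_pend (hd.addF hC.1) hC.2 hn ho (fun b hb => (hP.1 b hb).toS f g) hP.2,
        ih (v := u) (hd.addF hC.1) hC.2 hn ho (fun b hb => (hP.1 b hb).toS f g) hP.2⟩
    · rw [if_neg h, List.pairwise_cons]
      obtain ⟨k1, k2, k3⟩ := addF_add hC.1 hB h
      refine ⟨stepL_ext _ (hd.addF hC.1) hC.2 k3 hp hS.2 hP.2 hP.1 (Or.inr ?_),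
        ih (hd.addF hC.1) hC.2 k3 hp hS.2 hP.2⟩
      obtain ⟨a1, a2, a3⟩ := hC.1
      obtain ⟨b1, b2, b3⟩ := hB
      refine ⟨a3, by simp [addF]; omega, k1, k2, fun e => ?_⟩
      simp only
      have := hd.1 A.1 B.2
      omega

theorem padSet_getElem? (l : List ℕ) (j v : ℕ) (h : j ≤ l.length) (i : ℕ) :
    (padSet l j v)[i]? = if i = j then some v else l[i]? := by
  unfold padSet
  by_cases hj : j < l.length
  · rw [if_pos hj, List.getElem?_set]
    by_cases e : j = i
    · subst e; simp [hj]
    · rw [if_neg e, if_neg (fun k => e k.symm)]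
  · have e : j = l.length := by omega
    subst e
    simp only [lt_irrefl, if_false, Nat.sub_self, List.replicate_zero, List.append_nil]
    by_cases e : i = l.length
    · subst e; simp
    · rw [if_neg e]
      by_cases h2 : i < l.length
      · rw [List.getElem?_append_left h2]
      · rw [List.getElem?_eq_none (by simp; omega), List.getElem?_eq_none (by omega)]

theorem padSet_length (l : List ℕ) (j v : ℕ) (h : j ≤ l.length) :
    (padSet l j v).length = l.length + if j < l.length then 0 else 1 := by
  unfold padSet
  split_ifs <;> simp <;> omega

theorem tsize_set {T : List (List ℕ)} (l : List ℕ) : ∀ {r : ℕ}, r < T.length →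
    tsize (T.set r l) + (T.getD r []).length = tsize T + l.length := by
  induction T with
  | nil => intro r h; simp at h
  | cons a T ih =>
    intro r h
    rcases r with _ | r
    · simp [tsize]; omega
    · have := ih (r := r) (by simpa using h)
      simp [tsize] at this ⊢; omega

theorem tsize_pad (T : List (List ℕ)) (n : ℕ) :
    tsize (T ++ List.replicate n []) = tsize T := by simp [tsize]

theorem getD_pad (T : List (List ℕ)) (n i : ℕ) :
    (T ++ List.replicate n []).getD i [] = T.getD i [] := by
  simp only [List.getD_eq_getElem?_getD]
  by_cases h : i < T.length
  · rw [List.getElem?_append_left h]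
  · rw [List.getElem?_append_right (by omega), List.getElem?_eq_none (l := T) (by omega),
      List.getElem?_replicate]
    split_ifs <;> simp

theorem setBox_getD (T : List (List ℕ)) (r j v i : ℕ) :
    (setBox T r j v).getD i [] = if i = r then padSet (T.getD r []) j v else T.getD i [] := by
  have key : ∀ T' : List (List ℕ), r < T'.length → (∀ i, T'.getD i [] = T.getD i []) →
      (T'.set r (padSet (T'.getD r []) j v)).getD i [] =
      if i = r then padSet (T.getD r []) j v else T.getD i [] := by
    intro T' h1 h2
    rw [h2 r]
    by_cases e : i = r
    · subst e; simp [h1]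
    · rw [if_neg e, ← h2 i]
      simp only [List.getD_eq_getElem?_getD]
      rw [List.getElem?_set_ne (fun k => e k.symm)]
  unfold setBox
  by_cases h : r < T.length
  · simp only [h, if_true]
    exact key T h (fun _ => rfl)
  · simp only [h, if_false]
    exact key _ (by simp; omega) (fun i => getD_pad _ _ _)

theorem setBox_tsize (T : List (List ℕ)) (r j v : ℕ) (hj : j ≤ (T.getD r []).length) :
    tsize (setBox T r j v) = tsize T + if j < (T.getD r []).length then 0 else 1 := by
  have key : ∀ T' : List (List ℕ), r < T'.length → (T'.getD r [] = T.getD r []) →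
      tsize T' = tsize T →
      tsize (T'.set r (padSet (T'.getD r []) j v)) =
      tsize T + if j < (T.getD r []).length then 0 else 1 := by
    intro T' h1 h2 h3
    have h4 := tsize_set (padSet (T'.getD r []) j v) h1
    rw [h2, padSet_length _ _ _ hj] at h4
    rw [h2]
    omega
  unfold setBox
  by_cases h : r < T.length
  · simp only [h, if_true]
    exact key T h rfl rfl
  · simp only [h, if_false]
    exact key _ (by simp; omega) (getD_pad _ _ _) (tsize_pad _ _)

theorem set_eq_setBox (T : List (List ℕ)) (r j v : ℕ) (hj : j < (T.getD r []).length) :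
    T.set r ((T.getD r []).set j v) = setBox T r j v := by
  have h : r < T.length := by
    by_contra hc
    rw [List.getD_eq_default _ _ (by omega)] at hj
    simp at hj
  unfold setBox padSet
  simp only [h, hj, if_true]

def TRep (T : List (List ℕ)) (E : ℕ × ℕ → Option ℕ) : Prop :=
  ∀ r c, r ≤ c → (T.getD r [])[c - r]? = E (r, c)

theorem TRep.setBox {T : List (List ℕ)} {E : ℕ × ℕ → Option ℕ} (h : TRep T E) {r c : ℕ} (x : ℕ)
    (hrc : r ≤ c) (hl : c - r ≤ (T.getD r []).length) :
    TRep (setBox T r (c - r) x) (Function.update E (r, c) (some x)) := by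
  intro r' c' h'
  rw [setBox_getD]
  by_cases e : r' = r
  · subst e
    rw [if_pos rfl, padSet_getElem? _ _ _ hl]
    by_cases e : c' = c
    · subst e; simp
    · rw [if_neg (by omega), Function.update_of_ne (by simp [e]), h _ _ h']
  · rw [if_neg e, Function.update_of_ne (by simp [e]), h _ _ h']

def code (v : ℕ) (p : Bool) : ℕ := 2 * v - if p then 1 else 0

def EL (E : ℕ × ℕ → Option ℕ) (L : List (ℕ × St)) : ℕ × ℕ → Option ℕ :=
  L.foldl (fun E b => Function.update E b.2.1 (some (code b.1 b.2.2))) E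

theorem EL_cons (E : ℕ × ℕ → Option ℕ) (b : ℕ × St) (L : List (ℕ × St)) :
    EL E (b :: L) = EL (Function.update E b.2.1 (some (code b.1 b.2.2))) L := rfl

theorem EL_append (E : ℕ × ℕ → Option ℕ) (K L : List (ℕ × St)) :
    EL E (K ++ L) = EL (EL E K) L := by simp [EL]

theorem EL_mem {L : List (ℕ × St)} : ∀ {E : ℕ × ℕ → Option ℕ} {C : ℕ × ℕ} {k : ℕ},
    EL E L C = some k → E C = some k ∨ ∃ b ∈ L, b.2.1 = C ∧ k = code b.1 b.2.2 := by
  induction L with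
  | nil => intro E C k h; exact Or.inl h
  | cons b L ih =>
    intro E C k h
    rw [EL_cons] at h
    rcases ih h with h | ⟨d, h1, h2⟩
    · by_cases e : C = b.2.1
      · subst e
        rw [Function.update_self] at h
        exact Or.inr ⟨b, by simp, rfl, by simpa using h.symm⟩
      · rw [Function.update_of_ne e] at h
        exact Or.inl h
    · exact Or.inr ⟨d, by simp [h1], h2⟩

theorem EL_update {L : List (ℕ × St)} : ∀ {f g : ℕ → ℕ} {E : ℕ × ℕ → Option ℕ} {C : ℕ × ℕ}
    (y : Option ℕ), CV f g L → C.2 < f C.1 →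
    EL (Function.update E C y) L = Function.update (EL E L) C y := by
  induction L with
  | nil => intros; rfl
  | cons b L ih =>
    intro f g E C y h hC
    obtain ⟨h1, h2⟩ := h
    have hne : C ≠ b.2.1 := by
      rintro rfl
      have := h1.1; omega
    rw [EL_cons, EL_cons, Function.update_comm hne, ih y h2 (by simp [addF]; omega)]

theorem EL_old {L : List (ℕ × St)} {f g : ℕ → ℕ} {E : ℕ × ℕ → Option ℕ} {C : ℕ × ℕ}
    (h : CV f g L) (hC : C.2 < f C.1) : EL E L C = E C := by
  have := EL_update (E := E) (E C) h hC
  rw [Function.update_eq_self] at this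
  rw [this, Function.update_self]

def Supp (f : ℕ → ℕ) (E : ℕ × ℕ → Option ℕ) : Prop :=
  ∀ r c, r ≤ c → ((E (r, c)).isSome ↔ c < f r)

theorem Supp.add {f g : ℕ → ℕ} {E : ℕ × ℕ → Option ℕ} (h : Supp f E) {A : ℕ × ℕ}
    (hA : SAdd f g A) (k : ℕ) : Supp (addF f A.1) (Function.update E A (some k)) := by
  intro r c hrc
  obtain ⟨a1, a2, a3⟩ := hA
  by_cases e : (r, c) = A
  · subst e; simp [addF]; simp at a1; omega
  · rw [Function.update_of_ne e, h r c hrc]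
    simp only [addF]
    split_ifs with h1
    · subst h1
      have : c ≠ A.2 := by rintro rfl; exact e rfl
      omega
    · simp

theorem row_len {T : List (List ℕ)} {E : ℕ × ℕ → Option ℕ} {f : ℕ → ℕ} (h : TRep T E)
    (hs : Supp f E) (hf : ∀ r, r ≤ f r) (r : ℕ) : (T.getD r []).length = f r - r := by
  have key : ∀ i, i < (T.getD r []).length ↔ i < f r - r := by
    intro i
    have h1 := h r (r + i) (by omega)
    have h2 := hs r (r + i) (by omega)
    rw [← h1, Nat.add_sub_cancel_left] at h2
    have := hf r
    rw [Option.isSome_iff_ne_none, ne_eq, List.getElem?_eq_none_iff] at h2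
    omega
  have k1 := key (T.getD r []).length
  have k2 := key (f r - r)
  omega

theorem code_lt {u v : ℕ} {p q : Bool} {A : ℕ × ℕ} (hv : 1 ≤ v)
    (hS : S2 (v, (A, p)) (u, (A, q))) : code v p < code u q := by
  obtain ⟨h1, h2⟩ := hS
  simp only at h1 h2
  unfold code
  by_cases e : v = u
  · have := h2 e
    cases p <;> cases q <;> simp at * <;> omega
  · cases p <;> cases q <;> simp <;> omega

theorem mixedIns_row_hit {fuel r j v : ℕ} {T : List (List ℕ)} (z : ℕ)
    (h1 : ∀ i < j, ∀ k, (T.getD r [])[i]? = some k → k ≤ v)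
    (h2 : (T.getD r [])[j]? = some z) (h3 : v < z) :
    mixedIns (fuel + 1) T true r v =
      if (if j = 0 ∧ z % 2 = 0 then z - 1 else z) % 2 = 0 then
        mixedIns fuel (setBox T r j v) true (r + 1) (if j = 0 ∧ z % 2 = 0 then z - 1 else z)
      else mixedIns fuel (setBox T r j v) false (r + j + 1)
        (if j = 0 ∧ z % 2 = 0 then z - 1 else z) := by
  obtain ⟨hj, hz⟩ := List.getElem?_eq_some_iff.1 h2
  have e : (T.getD r []).findIdx? (fun z => decide (v < z)) = some j := by
    rw [List.findIdx?_eq_some_iff_getElem]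
    refine ⟨hj, by rw [hz]; simpa using h3, ?_⟩
    intro i hi
    have := h1 i hi _ (List.getElem?_eq_getElem (by omega))
    simpa using this
  have e2 : (T.getD r []).getD j 0 = z := by
    rw [List.getD_eq_getElem?_getD, h2]; rfl
  rw [mixedIns]
  simp only [e, e2, set_eq_setBox _ _ _ _ hj]

theorem mixedIns_row_end {fuel r v : ℕ} {T : List (List ℕ)}
    (h1 : ∀ k ∈ T.getD r [], k ≤ v) :
    mixedIns (fuel + 1) T true r v =
      (setBox T r (T.getD r []).length v, (r, r + (T.getD r []).length)) := by
  rw [mixedIns]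
  simp only [findIdx_none h1]

theorem mixedIns_col_hit {fuel r c v : ℕ} {T : List (List ℕ)} (z : ℕ) (hrc : r ≤ c)
    (h1 : ∀ i < r, ∀ k, (T.getD i [])[c - i]? = some k → k ≤ v)
    (h2 : (T.getD r [])[c - r]? = some z) (h3 : v < z) :
    mixedIns (fuel + 1) T false c v =
      if (if r = c ∧ z % 2 = 0 then z - 1 else z) % 2 = 0 then
        mixedIns fuel (setBox T r (c - r) v) true (r + 1) (if r = c ∧ z % 2 = 0 then z - 1 else z)
      else mixedIns fuel (setBox T r (c - r) v) false (c + 1)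
        (if r = c ∧ z % 2 = 0 then z - 1 else z) := by
  obtain ⟨hj, hz⟩ := List.getElem?_eq_some_iff.1 h2
  have e2 : sEntry T r c = z := by
    unfold sEntry
    rw [List.getD_eq_getElem?_getD, h2]; rfl
  have e : (List.range (c + 1)).find? (fun r =>
        decide (c - r < (T.getD r []).length) && decide (v < sEntry T r c)) = some r := by
    rw [List.find?_range_eq_some]
    refine ⟨by simp [e2, h3, hj]; simpa using hj, by simp; omega, ?_⟩
    intro i hi
    by_cases hl : c - i < (T.getD i []).length
    · have h4 := List.getElem?_eq_getElem hl
      have h5 := h1 i hi _ h4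
      have : sEntry T i c ≤ v := by
        unfold sEntry
        rw [List.getD_eq_getElem?_getD, h4]; exact h5
      simp [this]
    · simp only [hl]; simp
  rw [mixedIns]
  simp only [e, e2]

theorem mixedIns_col_end {fuel r c v : ℕ} {T : List (List ℕ)} (hrc : r ≤ c)
    (h1 : ∀ i ≤ c, ∀ k, (T.getD i [])[c - i]? = some k → k ≤ v)
    (h2 : ∀ i < r, c - i < (T.getD i []).length) (h3 : (T.getD r []).length ≤ c - r) :
    mixedIns (fuel + 1) T false c v = (setBox T r (c - r) v, (r, c)) := by
  have e : (List.range (c + 1)).find? (fun r =>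
        decide (c - r < (T.getD r []).length) && decide (v < sEntry T r c)) = none := by
    rw [List.find?_eq_none]
    intro i hi
    have hi' : i ≤ c := by simp at hi; omega
    by_cases hl : c - i < (T.getD i []).length
    · have h4 := List.getElem?_eq_getElem hl
      have h5 := h1 i hi' _ h4
      have : sEntry T i c ≤ v := by
        unfold sEntry
        rw [List.getD_eq_getElem?_getD, h4]; exact h5
      simp [this]
    · simp only [hl]; simp
  have e3 : (List.range (c + 1)).findIdx (fun r => decide ((T.getD r []).length ≤ c - r)) = r := by
    rw [List.findIdx_eq (by simp; omega)]
    constructor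
    · rw [List.getElem_range]; simpa using h3
    · intro j hj
      have := h2 j hj
      rw [List.getElem_range]; simp at this ⊢; omega
  rw [mixedIns]
  simp only [e, e3]

theorem mixedIns_hit {fuel u v : ℕ} {B : ℕ × ℕ} {p q : Bool} {T : List (List ℕ)} (f g : ℕ → ℕ)
    (hB : B.1 ≤ B.2) (hp : p = true → B.1 < B.2) (hu : 1 ≤ u) (hlt : code v p < code u q)
    (h1 : p = false → ∀ c, B.1 ≤ c → c < B.2 → ∀ k, (T.getD B.1 [])[c - B.1]? = some k →
      k ≤ code v p)
    (h2 : p = true → ∀ r, r < B.1 → ∀ k, (T.getD r [])[B.2 - r]? = some k → k ≤ code v p)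
    (h3 : (T.getD B.1 [])[B.2 - B.1]? = some (code u q)) :
    mixedIns (fuel + 1) T (!p) (if p then B.2 else B.1) (code v p) =
      mixedIns fuel (setBox T B.1 (B.2 - B.1) (code v p)) (!(mNext f g (B, q)).2)
        (if (mNext f g (B, q)).2 then (mNext f g (B, q)).1.2 else (mNext f g (B, q)).1.1)
        (code u (mNext f g (B, q)).2) := by
  have c0 : code u false = 2 * u := rfl
  have c1 : code u true = 2 * u - 1 := rfl
  have m0 : 2 * u % 2 = 0 := by omega
  have m1 : ¬ (2 * u - 1) % 2 = 0 := by omega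
  cases p
  · have := mixedIns_row_hit (fuel := fuel) (r := B.1) (j := B.2 - B.1) (T := T) (v := code v false)
      _ (fun i hi k hk => h1 rfl (B.1 + i) (by omega) (by omega) k (by simpa using hk)) h3 hlt
    simp only [Bool.not_false, Bool.false_eq_true, if_false]
    rw [this]
    have e : B.1 + (B.2 - B.1) + 1 = B.2 + 1 := by omega
    rw [e]
    cases q
    · by_cases hd : B.1 = B.2
      · have hd' : B.2 - B.1 = 0 := by omega
        simp only [c0, hd', m0, and_self, if_true]
        rw [if_neg m1]
        simp [mNext, hd, c1]
      · have hd' : ¬ B.2 - B.1 = 0 := by omega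
        simp only [c0, hd', m0, false_and, if_false, if_true]
        simp [mNext, hd, c0]
    · simp only [c1, m1, and_false, if_false]
      simp [mNext, c1]
  · have hne := hp rfl
    have := mixedIns_col_hit (fuel := fuel) (r := B.1) (c := B.2) (T := T) (v := code v true)
      _ (by omega) (fun i hi k hk => h2 rfl i hi k hk) h3 hlt
    simp only [Bool.not_true, if_true]
    rw [this]
    have hd : ¬ B.1 = B.2 := by omega
    cases q
    · simp only [c0, hd, m0, false_and, if_false, if_true]
      simp [mNext, hd, c0]
    · simp only [c1, m1, hd, and_false, if_false]
      simp [mNext, c1]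

theorem mixed_main {L : List (ℕ × St)} :
    ∀ {f g : ℕ → ℕ} {v : ℕ} {B : ℕ × ℕ} {p : Bool} {E : ℕ × ℕ → Option ℕ} {T : List (List ℕ)}
      {fuel : ℕ}, SD f g → CV f g L → SAdd f g B →
    (p = true → B.1 < B.2) → (∀ b ∈ L, S2 (v, (B, p)) b) → L.Pairwise R2 →
    1 ≤ v → (∀ b ∈ L, 1 ≤ b.1) → Supp f E →
    (p = false → ∀ c k, B.1 ≤ c → E (B.1, c) = some k → k ≤ code v p) →
    (p = true → ∀ r k, r ≤ B.2 → E (r, B.2) = some k → k ≤ code v p) →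
    (∀ b ∈ L, ∀ C k, C.1 ≤ C.2 → E C = some k →
      k ≤ 2 * b.1 ∧ (k = 2 * b.1 → b.2.2 = false ∧ b.2.1.1 ≤ C.1)) →
    TRep T (EL E L) → L.length < fuel →
    ∃ T', mixedIns fuel T (!p) (if p then B.2 else B.1) (code v p) = (T', stepB f g B L) ∧
      TRep T' (EL (Function.update E B (some (code v p))) (stepL f g B L)) ∧
      tsize T' = tsize T + 1 := by
  induction L with
  | nil =>
    intro f g v B p E T fuel hd _ hB hp _ _ hv _ hs H1 H2 _ hT hfuel
    obtain ⟨fuel, rfl⟩ : ∃ n, fuel = n + 1 := ⟨fuel - 1, by simp at hfuel; omega⟩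
    have hT' : TRep T E := hT
    have hl := row_len hT' hs hd.2.2
    obtain ⟨b1, b2, b3⟩ := hB
    have hlB : (T.getD B.1 []).length = B.2 - B.1 := by rw [hl, b1]
    refine ⟨setBox T B.1 (B.2 - B.1) (code v p), ?_, ?_, ?_⟩
    · cases p
      · simp only [Bool.not_false, Bool.false_eq_true, if_false, stepB]
        rw [mixedIns_row_end, hlB]
        · congr 1
          ext
          · rfl
          · simp only; omega
        · intro k hk
          obtain ⟨i, hi⟩ := List.getElem?_of_mem hk
          have := hT' B.1 (B.1 + i) (by omega)
          rw [Nat.add_sub_cancel_left, hi] at this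
          exact H1 rfl _ _ (by omega) this.symm
      · simp only [Bool.not_true, if_true, stepB]
        rw [mixedIns_col_end (r := B.1) b3]
        · intro i hi k hk
          rw [hT' i B.2 hi] at hk
          exact H2 rfl _ _ hi hk
        · intro i hi
          rw [hl]
          have := (hd.1 i B.2 (by omega)).2 (by omega)
          omega
        · omega
    · exact hT'.setBox _ b3 (by omega)
    · rw [setBox_tsize _ _ _ _ (by omega), if_neg (by omega)]
  | cons d L ih =>
    intro f g v B p E T fuel hd hC hB hp hS hP hv hL hs H1 H2 HE hT hfuel
    obtain ⟨fuel, rfl⟩ : ∃ n, fuel = n + 1 := ⟨fuel - 1, by simp at hfuel; omega⟩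
    simp only [CV, List.mem_cons, List.pairwise_cons, forall_eq_or_imp] at hS hP hC hL HE
    obtain ⟨u, ⟨A, q⟩⟩ := d
    simp only at hC hL HE
    rw [EL_cons] at hT
    simp only [stepL, stepB]
    simp only [List.length_cons] at hfuel
    by_cases h : A = B
    · subst h
      simp only [if_true]
      obtain ⟨b1, b2, b3⟩ := hB
      have hA := hC.1
      have hlt := code_lt hv hS.1
      have hAin : A.2 < addF f A.1 A.1 := by simp [addF]; omega
      have e3 : (T.getD A.1 [])[A.2 - A.1]? = some (code u q) := by
        rw [hT _ _ b3, EL_old hC.2 hAin]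
        simp
      have old : ∀ C : ℕ × ℕ, C.1 ≤ C.2 → C.2 < f C.1 → (T.getD C.1 [])[C.2 - C.1]? = E C := by
        intro C h1 h2
        have hne : C ≠ A := by rintro rfl; omega
        rw [hT _ _ h1, EL_old hC.2 (by simp [addF]; omega), Function.update_of_ne hne]
      have hn := mNext_add hd hA q
      have hoff := mNext_off (s := (A, q)) hd hA
      rw [mixedIns_hit f g b3 hp hL.1 hlt ?_ ?_ e3]
      · have hl : A.2 - A.1 < (T.getD A.1 []).length := (List.getElem?_eq_some_iff.1 e3).1
        have hrep : TRep (setBox T A.1 (A.2 - A.1) (code v p))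
            (EL (Function.update E A (some (code v p))) L) := by
          have := hT.setBox (code v p) b3 hl.le
          rw [← EL_update _ hC.2 hAin, Function.update_idem] at this
          exact this
        have hsz := setBox_tsize T A.1 (A.2 - A.1) (code v p) hl.le
        rw [if_pos hl] at hsz
        have hfc : ∀ c, A.1 ≤ c → c < f A.1 → c < A.2 := fun c _ h => by omega
        refine Exists.elim (ih (v := u) (p := (mNext f g (A, q)).2)
          (E := Function.update E A (some (code v p)))
          (T := setBox T A.1 (A.2 - A.1) (code v p)) (fuel := fuel)
          (hd.addF hA) hC.2 hn.1 hoff (fun b hb => (hP.1 b hb).toS f g) hP.2 hL.1 hL.2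
          (hs.add hA _) ?_ ?_ ?_ hrep (by omega)) ?_
        · intro hf c k hc hk
          rw [Function.update_of_ne] at hk
          · rw [hf]
            exact (HE.1 _ _ hc hk).1
          · intro e; exact hn.2.1 hf (congrArg Prod.fst e).symm
        · intro hf r k hc hk
          rw [Function.update_of_ne] at hk
          · have h5 := HE.1 _ _ hc hk
            have h6 := (hs r _ hc).1 (by rw [hk]; rfl)
            rw [hf]
            simp only [code, if_true]
            by_cases hk2 : k = 2 * u
            · exfalso
              obtain ⟨h7, h8⟩ := h5.2 hk2
              subst h7
              by_cases hdg : A.1 = A.2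
              · simp only [mNext, hdg] at hc h6 hk
                simp at hc h6 h8
                have i1 := hd.1 r (A.2 + 1) hc
                have i2 := hd.1 A.1 (A.2 + 1) (by omega)
                omega
              · simp [mNext, hdg] at hf
            · omega
          · intro e; exact hn.2.2 hf (congrArg Prod.snd e).symm
        · intro b hb C k hC1 hk
          by_cases e : C = A
          · subst e
            rw [Function.update_self] at hk
            simp only [Option.some.injEq] at hk
            subst hk
            have s1 := (hS.2 b hb).1
            have s2 := (hS.2 b hb).2
            simp only at s1 s2
            cases p
            · simp only [code]
              refine ⟨by simp; omega, fun e => ?_⟩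
              have := (s2 (by simp at e; omega)).1 rfl
              exact ⟨this.1, this.2.le⟩
            · simp only [code]
              refine ⟨by simp; omega, fun e => ?_⟩
              simp at e; omega
          · rw [Function.update_of_ne e] at hk
            exact HE.2 b hb C k hC1 hk
        · rintro T' ⟨k1, k2, k3⟩
          exact ⟨T', k1, k2, by omega⟩
      · intro hpf c hc1 hc2 k hk
        rw [old (A.1, c) hc1 (by simp only; omega)] at hk
        exact H1 hpf c k hc1 hk
      · intro hpt r hr k hk
        rw [old (r, A.2) (by simp only; omega)
          ((hd.1 r A.2 (by omega)).2 (by omega))] at hk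
        exact H2 hpt r k (by omega) hk
    · simp only [h, if_false]
      obtain ⟨k1, k2, k3⟩ := addF_add hC.1 hB h
      rw [EL_cons]
      simp only
      rw [Function.update_comm (fun e => h e.symm)]
      refine ih (hd.addF hC.1) hC.2 k3 hp hS.2 hP.2 hv hL.2 (hs.add hC.1 _) ?_ ?_ ?_ hT (by omega)
      · intro hf c k hc hk
        rw [Function.update_of_ne (by intro e; exact k1 (by rw [← e]))] at hk
        exact H1 hf c k hc hk
      · intro hf r k hc hk
        rw [Function.update_of_ne (by intro e; exact k2 (by rw [← e]))] at hk
        exact H2 hf r k hc hk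
      · intro b hb C k hC1 hk
        by_cases e : C = A
        · subst e
          rw [Function.update_self] at hk
          simp only [Option.some.injEq] at hk
          subst hk
          have s1 := (hP.1 b hb).1
          have s2 := (hP.1 b hb).2
          simp only at s1 s2
          cases q
          · simp only [code]
            refine ⟨by simp; omega, fun e => ?_⟩
            exact (s2 (by simp at e; omega)).1 rfl
          · simp only [code]
            refine ⟨by simp; omega, fun e => ?_⟩
            simp at e; omega
        · rw [Function.update_of_ne e] at hk
          exact HE.2 b hb C k hC1 hk

def chainM (val : ℕ → ℕ) : List ℕ → (ℕ → Option (ℕ × ℕ)) → ℕ → List (ℕ × St)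
  | [], _, _ => []
  | m :: ms, X, t => match mSt m X t with
    | none => chainM val ms (mOut m X) t
    | some s => (val m, s) :: chainM val ms (mOut m X) t

theorem chainM_append (val : ℕ → ℕ) (us vs : List ℕ) : ∀ (X : ℕ → Option (ℕ × ℕ)) (t : ℕ),
    chainM val (us ++ vs) X t = chainM val us X t ++ chainM val vs (mFold us X) t := by
  induction us with
  | nil => intros; rfl
  | cons u us ih =>
    intro X t
    simp only [List.cons_append, chainM, ih, mFold_cons]
    cases mSt u X t <;> simp

theorem mFold_append (us vs : List ℕ) (X : ℕ → Option (ℕ × ℕ)) :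
    mFold (us ++ vs) X = mFold vs (mFold us X) := by simp [mFold]

theorem chainM_mem {val : ℕ → ℕ} {ms : List ℕ} : ∀ {X : ℕ → Option (ℕ × ℕ)} {t : ℕ} {b : ℕ × St},
    b ∈ chainM val ms X t → ∃ m ∈ ms, b.1 = val m ∧ m < t := by
  induction ms with
  | nil => intro X t b h; simp [chainM] at h
  | cons u us ih =>
    intro X t b h
    simp only [chainM] at h
    rcases hs : mSt u X t with _ | s
    · rw [hs] at h
      obtain ⟨m, h1, h2⟩ := ih h
      exact ⟨m, by simp [h1], h2⟩
    · rw [hs] at h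
      rcases List.mem_cons.1 h with rfl | h
      · refine ⟨u, by simp, rfl, ?_⟩
        by_contra hc
        rw [mSt_none_of_le _ _ _ (by omega)] at hs
        simp at hs
      · obtain ⟨m, h1, h2⟩ := ih h
        exact ⟨m, by simp [h1], h2⟩

theorem mFold_none' {ms : List ℕ} : ∀ {X : ℕ → Option (ℕ × ℕ)} {t : ℕ},
    mFold ms X t = none ↔ t ∉ ms ∧ X t = none := by
  induction ms with
  | nil => intro X t; simp [mFold]
  | cons m ms ih =>
    intro X t
    rw [mFold_cons, ih, mOut_none]
    simp only [List.mem_cons, not_or]; tauto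

theorem mFold_SV {ms : List ℕ} : ∀ {X : ℕ → Option (ℕ × ℕ)}, SV X → ms.Nodup →
    (∀ m ∈ ms, X m = none) → SV (mFold ms X) := by
  induction ms with
  | nil => intro X h _ _; exact h
  | cons m ms ih =>
    intro X h hn hx
    rw [List.nodup_cons] at hn
    rw [mFold_cons]
    exact ih (h.mOut (hx m (by simp))) hn.2
      (fun k hk => mOut_none.2 ⟨by rintro rfl; exact hn.1 hk, hx k (by simp [hk])⟩)

theorem fn_none {m t : ℕ} {X : ℕ → Option (ℕ × ℕ)} (hm : X m = none) (h : mSt m X t = none) :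
    sfn (mOut m X) t = sfn X t ∧ sgn (mOut m X) t = sgn X t := by
  constructor <;> funext r
  · simp [sfn_mOut hm, h]
  · simp [sgn_mOut hm, h]

theorem fn_some {m t : ℕ} {X : ℕ → Option (ℕ × ℕ)} {s : St} (hm : X m = none)
    (h : mSt m X t = some s) :
    sfn (mOut m X) t = addF (sfn X t) s.1.1 ∧ sgn (mOut m X) t = addF (sgn X t) s.1.2 := by
  constructor <;> funext r
  · simp [sfn_mOut hm, h, addF]
  · simp [sgn_mOut hm, h, addF]

theorem chainM_CV {val : ℕ → ℕ} {t : ℕ} {ms : List ℕ} : ∀ {X : ℕ → Option (ℕ × ℕ)}, SV X →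
    ms.Nodup → (∀ m ∈ ms, X m = none) → CV (sfn X t) (sgn X t) (chainM val ms X t) := by
  induction ms with
  | nil => intro X h _ _; simp [chainM, CV]
  | cons m ms ih =>
    intro X h hn hx
    rw [List.nodup_cons] at hn
    have hm := hx m (by simp)
    have h1 := ih (X := mOut m X) (h.mOut hm) hn.2
      (fun k hk => mOut_none.2 ⟨by rintro rfl; exact hn.1 hk, hx k (by simp [hk])⟩)
    rw [chainM]
    rcases hs : mSt m X t with _ | s
    · rw [(fn_none hm hs).1, (fn_none hm hs).2] at h1
      exact h1
    · rw [(fn_some hm hs).1, (fn_some hm hs).2] at h1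
      exact ⟨mSt_add h hm t s hs, h1⟩

theorem chainM_supp {val : ℕ → ℕ} {t : ℕ} {ms : List ℕ} : ∀ {X : ℕ → Option (ℕ × ℕ)}
    {E : ℕ × ℕ → Option ℕ}, SV X →
    ms.Nodup → (∀ m ∈ ms, X m = none) → Supp (sfn X t) E →
    Supp (sfn (mFold ms X) t) (EL E (chainM val ms X t)) := by
  induction ms with
  | nil => intro X E h _ _ hs; exact hs
  | cons m ms ih =>
    intro X E h hn hx hE
    rw [List.nodup_cons] at hn
    have hm := hx m (by simp)
    have h1 := fun E hE => ih (X := mOut m X) (E := E) (h.mOut hm) hn.2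
      (fun k hk => mOut_none.2 ⟨by rintro rfl; exact hn.1 hk, hx k (by simp [hk])⟩) hE
    rw [chainM, mFold_cons]
    rcases hs : mSt m X t with _ | s
    · rw [(fn_none hm hs).1] at h1
      exact h1 E hE
    · rw [(fn_some hm hs).1] at h1
      rw [EL_cons]
      exact h1 _ (hE.add (mSt_add h hm t s hs) _)

theorem chainM_none {val : ℕ → ℕ} {t : ℕ} {us : List ℕ} : ∀ {X : ℕ → Option (ℕ × ℕ)}, t ∉ us →
    X t = none → chainM val us X (t + 1) = chainM val us X t := by
  induction us with
  | nil => intros; rfl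
  | cons m us ih =>
    intro X ht hx
    simp only [List.mem_cons, not_or] at ht
    have e : mSt m X (t + 1) = mSt m X t := by
      rw [mSt_succ, hx]
      rcases mSt m X t <;> simp [mst, ht.1]
    simp only [chainM, e]
    rw [ih ht.2 (mOut_none.2 ⟨ht.1, hx⟩)]

theorem chainM_step {val : ℕ → ℕ} {t : ℕ} {ms : List ℕ} : ∀ {X : ℕ → Option (ℕ × ℕ)} {B : ℕ × ℕ},
    ms.Nodup → (∀ m ∈ ms, X m = none) → t ∉ ms → X t = some B →
    chainM val ms X (t + 1) = stepL (sfn X t) (sgn X t) B (chainM val ms X t) ∧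
    mFold ms X t = some (stepB (sfn X t) (sgn X t) B (chainM val ms X t)) := by
  induction ms with
  | nil => intro X B _ _ _ h; exact ⟨rfl, h⟩
  | cons m ms ih =>
    intro X B hn hx ht hB
    rw [List.nodup_cons] at hn
    simp only [List.mem_cons, not_or] at ht
    have hm := hx m (by simp)
    have h1 := fun B hB => ih (X := mOut m X) (B := B) hn.2
      (fun k hk => mOut_none.2 ⟨by rintro rfl; exact hn.1 hk, hx k (by simp [hk])⟩) ht.2 hB
    simp only [chainM]
    rw [mFold_cons, mSt_succ]
    rcases hs : mSt m X t with _ | s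
    · rw [(fn_none hm hs).1, (fn_none hm hs).2] at h1
      have e : mOut m X t = some B := by simp [mOut, mout, ht.1, hs, hB]
      simpa [mst, ht.1, hB] using h1 B e
    · rw [(fn_some hm hs).1, (fn_some hm hs).2] at h1
      by_cases h : s.1 = B
      · have e : mOut m X t = some (mNext (sfn X t) (sgn X t) s).1 := by
          simp [mOut, mout, ht.1, hs, hB, h]
        have h2 := h1 _ e
        simp only [stepL, stepB, h, if_true]
        rw [h] at h2
        simp [mst, ht.1, hB, h, h2]
      · have h' : ¬ B = s.1 := fun k => h k.symm
        have e : mOut m X t = some B := by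
          simp [mOut, mout, ht.1, hs, hB, h']
        have h2 := h1 _ e
        simp [mst, ht.1, hB, h', stepL, stepB, h, h2]

def MInv (val : ℕ → ℕ) (ms : List ℕ) (t : ℕ) (T : List (List ℕ)) : Prop :=
  TRep T (EL (fun _ => none) (chainM val ms (fun _ => none) t)) ∧
  (chainM val ms (fun _ => none) t).Pairwise R2 ∧
  tsize T = (chainM val ms (fun _ => none) t).length

theorem MInv.zero {val : ℕ → ℕ} {ms : List ℕ} : MInv val ms 0 [] := by
  have e : chainM val ms (fun _ => none) 0 = [] := by
    rw [List.eq_nil_iff_forall_not_mem]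
    intro b hb
    obtain ⟨m, _, _, h⟩ := chainM_mem hb
    omega
  simp only [MInv, e]
  refine ⟨?_, by simp, by simp [tsize]⟩
  intro r c _
  simp [EL]

theorem SV_none : SV (fun _ => none) := by intro t A h; simp at h

theorem MInv.step {val : ℕ → ℕ} {ms : List ℕ} {t : ℕ} {T : List (List ℕ)} (h : stdOrd val ms)
    (hpos : ∀ m ∈ ms, 1 ≤ val m) (ht : t ∈ ms) (hI : MInv val ms t T) :
    MInv val ms (t + 1) (mixedInsLetter T (val t)).1 ∧
    mFold ms (fun _ => none) t = some (mixedInsLetter T (val t)).2 := by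
  obtain ⟨us, vs, rfl⟩ := List.append_of_mem ht
  have hn := h.nodup
  unfold stdOrd at h
  rw [List.pairwise_append, List.pairwise_cons] at h
  obtain ⟨h1, ⟨h2, h3⟩, h4⟩ := h
  have tu : t ∉ us := fun hu => by have := h4 t hu t (by simp); omega
  have tv : t ∉ vs := fun hu => by have := h2 t hu; omega
  rw [List.nodup_append, List.nodup_cons] at hn
  obtain ⟨n1, ⟨n2, n3⟩, n4⟩ := hn
  obtain ⟨hT, hP, hZ⟩ := hI
  set X0 : ℕ → Option (ℕ × ℕ) := fun _ => none with hX0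
  set X := mFold us X0 with hX
  have hv : SV X := mFold_SV SV_none n1 (fun _ _ => rfl)
  have x1 : X t = none := mFold_none'.2 ⟨tu, rfl⟩
  have s1 : mSt t X t = none := mSt_none_of_le _ _ _ le_rfl
  have s2 : mSt t X (t + 1) = some ((0, sfn X t 0), false) := by simp [mSt_succ, mst]
  have x2 : mOut t X t = some (0, sfn X t 0) := by simp [mOut, mout]
  have xv : ∀ m ∈ vs, mOut t X m = none := by
    intro m hm
    refine mOut_none.2 ⟨by rintro rfl; exact tv hm, mFold_none'.2 ⟨fun hu => ?_, rfl⟩⟩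
    exact n4 m hu m (by simp [hm]) rfl
  have hvY : SV (mOut t X) := hv.mOut x1
  have hd := hvY.sd t
  have hC := chainM_CV (val := val) (t := t) hvY n3 xv
  obtain ⟨st1, st2⟩ := chainM_step (val := val) (t := t) n3 xv tv x2
  have e1 := (fn_none x1 s1).1
  have e2 := (fn_none x1 s1).2
  rw [e1, e2] at hd hC st1 st2
  have hB : SAdd (sfn X t) (sgn X t) (0, sfn X t 0) := hd.zero
  simp only [MInv]
  rw [← hX0]
  simp only [chainM_append, chainM, ← hX, s1] at hT hP hZ
  simp only [chainM_append, chainM, ← hX, s2]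
  rw [chainM_none tu rfl, st1]
  rw [mFold_append, mFold_cons, ← hX, st2]
  set M := chainM val us X0 t with hM
  set L := chainM val vs (mOut t X) t with hL
  have hS : ∀ b ∈ L, S2 (val t, ((0, sfn X t 0), false)) b := by
    intro b hb
    obtain ⟨m, k1, k2, k3⟩ := chainM_mem hb
    have k4 := h2 m k1
    refine ⟨by rw [k2]; simp only; omega, ?_⟩
    intro e
    rw [k2] at e; simp only at e; omega
  have hu : ∀ b ∈ M, b.1 ≤ val t := by
    intro b hb
    obtain ⟨m, k1, k2, k3⟩ := chainM_mem hb
    have := h4 m k1 t (by simp)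
    rw [k2]; omega
  have hn' : ∀ a ∈ M, R2 a (val t, ((0, sfn X t 0), false)) := by
    intro a ha
    refine ⟨hu a ha, fun _ => ⟨fun _ => ⟨rfl, by simp⟩, fun _ k => by simp at k⟩⟩
  rw [List.pairwise_append] at hP
  obtain ⟨p1, p2, p3⟩ := hP
  have hsupp : Supp (sfn X t) (EL (fun _ => none) M) := by
    refine chainM_supp SV_none n1 (fun _ _ => rfl) ?_
    intro r c hrc
    have : sfn X0 t r = r := by simp [sfn, hX0, cnt_none]
    simp only [this]
    simp [hrc]
  have hpf : false = true → (0, sfn X t 0).1 < (0, sfn X t 0).2 := fun k => by simp at k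
  obtain ⟨T', k1, k2, k3⟩ := mixed_main (L := L) (v := val t) (B := (0, sfn X t 0)) (p := false)
    (E := EL (fun _ => none) M) (T := T) (fuel := tsize T + 2) hd hC hB hpf hS p2
    (hpos t ht) (fun b hb => by
      obtain ⟨m, k1, k2, k3⟩ := chainM_mem hb
      rw [k2]; exact hpos m (by simp [k1])) hsupp
    (fun _ c k hc hk => by
      rcases EL_mem hk with hk | ⟨b, b1, b2, rfl⟩
      · simp at hk
      · have := hu b b1
        simp only [code]; simp; omega)
    (fun k => by simp at k)
    (fun b hb C k hCC hk => by
      rcases EL_mem hk with hk | ⟨a, b1, rfl, rfl⟩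
      · simp at hk
      · obtain ⟨i1, i2⟩ := p3 a b1 b hb
        simp only [code]
        have := hu a b1
        rcases hq : a.2.2 with _ | _
        · simp; exact ⟨i1, fun e => (i2 e).1 hq⟩
        · simp
          obtain ⟨m, j1, j2, j3⟩ := chainM_mem b1
          have := hpos m (by simp [j1])
          omega)
    (by rw [← EL_append]; exact hT) (by rw [hZ]; simp; omega)
  have hres : mixedInsLetter T (val t) = (T', stepB (sfn X t) (sgn X t) (0, sfn X t 0) L) := by
    rw [← k1]; rfl
  rw [hres]
  refine ⟨⟨?_, ?_, ?_⟩, rfl⟩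
  · simp only
    rw [EL_append, EL_cons]
    exact k2
  · rw [List.pairwise_append, List.pairwise_cons]
    refine ⟨p1, ⟨stepL_pend hd hC hB hpf hS p2, stepL_pairwise hd hC hB hpf hS p2⟩, ?_⟩
    intro a ha b hb
    rcases List.mem_cons.1 hb with rfl | hb
    · exact hn' a ha
    · exact stepL_ext a hd hC hB hpf hS p2 (fun b hb => p3 a ha b hb) (Or.inl (hn' a ha)) b hb
  · simp only
    rw [k3, hZ]
    simp [stepL_length]; omega

def qFoldM (out : ℕ → Option (ℕ × ℕ)) (t : ℕ) : List (List ℕ) :=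
  (List.range t).foldl (fun Q i => match out i with
    | some B => setBox Q B.1 (B.2 - B.1) (tsize Q + 1)
    | none => Q) []

theorem mixedPQ_snoc (w : List ℕ) (x : ℕ) : mixedPQ (w ++ [x]) =
    ((mixedInsLetter (mixedPQ w).1 x).1,
      setBox (mixedPQ w).2 (mixedInsLetter (mixedPQ w).1 x).2.1
      ((mixedInsLetter (mixedPQ w).1 x).2.2 - (mixedInsLetter (mixedPQ w).1 x).2.1)
      (tsize (mixedPQ w).2 + 1)) := by
  simp [mixedPQ]

theorem mixed_link {w : List ℕ} {ms : List ℕ} (h : stdOrd (fun i => w.getD i 0) ms)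
    (hpos : ∀ m ∈ ms, 1 ≤ w.getD m 0)
    (hm : ∀ t, t < w.length → t ∈ ms) : ∀ t, t ≤ w.length →
    MInv (fun i => w.getD i 0) ms t (mixedPQ (w.take t)).1 ∧
    (mixedPQ (w.take t)).2 = qFoldM (mFold ms (fun _ => none)) t := by
  intro t
  induction t with
  | zero => intro _; exact ⟨by simpa [mixedPQ] using MInv.zero, by simp [mixedPQ, qFoldM]⟩
  | succ t ih =>
    intro ht
    obtain ⟨h1, h2⟩ := ih (by omega)
    have e : w.take (t + 1) = w.take t ++ [w.getD t 0] := by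
      rw [List.take_add_one]; simp [List.getElem?_eq_getElem (show t < w.length by omega)]
    obtain ⟨hs, hr⟩ := h1.step h hpos (hm t (by omega))
    rw [e, mixedPQ_snoc]
    refine ⟨hs, ?_⟩
    simp only at hr ⊢
    rw [h2, qFoldM, qFoldM, List.range_succ, List.foldl_append]
    simp only [List.foldl_cons, List.foldl_nil, hr]

theorem mixedQ_eq {w : List ℕ} {ms : List ℕ} (h : stdOrd (fun i => w.getD i 0) ms)
    (hpos : ∀ m ∈ ms, 1 ≤ w.getD m 0)
    (hm : ∀ t, t < w.length → t ∈ ms) :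
    mixedQ w = qFoldM (mFold ms (fun _ => none)) w.length := by
  have := (mixed_link h hpos hm w.length le_rfl).2
  rwa [List.take_length] at this

theorem mem_stdTimes {K i : ℕ} {w : List ℕ} :
    i ∈ stdTimes K w ↔ ∃ k, k < K ∧ w[i]? = some k := by
  simp [stdTimes, mem_posOf]

theorem stdTimes_ord (K : ℕ) (w : List ℕ) : stdOrd (fun i => w.getD i 0) (stdTimes K w) := by
  have hv : ∀ k i, i ∈ posOf k w → w.getD i 0 = k := by
    intro k i hi
    rw [List.getD_eq_getElem?_getD, mem_posOf.1 hi]; rfl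
  unfold stdOrd
  induction K with
  | zero => simp [stdTimes]
  | succ K ih =>
    have e : stdTimes (K + 1) w = stdTimes K w ++ posOf K w := by
      simp [stdTimes, List.range_succ]
    rw [e, List.pairwise_append]
    refine ⟨ih, ?_, ?_⟩
    · refine (posOf_sorted K w).imp_of_mem ?_
      intro a b ha hb hab
      right
      exact ⟨by beta_reduce; rw [hv _ _ ha, hv _ _ hb], hab⟩
    · intro a ha b hb
      obtain ⟨k, hk, ha⟩ := mem_stdTimes.1 ha
      left
      beta_reduce
      rw [hv _ _ hb, hv _ _ (mem_posOf.2 ha)]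
      exact hk

theorem Q_eq {w : List ℕ} {K : ℕ} (h1 : ∀ x ∈ w, 1 ≤ x) (h2 : ∀ x ∈ w, x < K) :
    rskQ w = qFoldR (rowFold (stdTimes K w) (fun _ => none)) w.length ∧
    mixedQ w = qFoldM (mFold (stdTimes K w) (fun _ => none)) w.length := by
  have hm : ∀ t, t < w.length → t ∈ stdTimes K w := by
    intro t ht
    exact mem_stdTimes.2 ⟨w[t], h2 _ (List.getElem_mem ht), List.getElem?_eq_getElem ht⟩
  refine ⟨rskQ_eq (stdTimes_ord K w) hm, mixedQ_eq (stdTimes_ord K w) ?_ hm⟩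
  intro m hmm
  obtain ⟨k, _, hk⟩ := mem_stdTimes.1 hmm
  rw [List.getD_eq_getElem?_getD, hk]
  exact h1 k (List.mem_of_getElem? hk)

/-- (Lascoux–Leclerc–Thibon, Theorem 5.5.1, and its shifted analogue.)  Recording tableaux
are invariant under the crystal operators `e_j`: for every word `w` over the positive
integers and every `j ≥ 1`, `Q(e_j(w)) = Q(w)` and `Q'(e_j(w)) = Q'(w)`. -/
theorem recording_tableaux_invariant_under_crystal_operators
    (w : List ℕ) (hw : ∀ x ∈ w, 1 ≤ x) (j : ℕ) (hj : 1 ≤ j) :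
    rskQ (cryE j w) = rskQ w ∧ mixedQ (cryE j w) = mixedQ w := by
  have hsum : ∀ x ∈ w, x < j + 2 + w.sum := by
    intro x hx
    have := List.single_le_sum (l := w) (by simp) x hx
    omega
  have hmem : ∀ x ∈ cryE j w, x ∈ w ∨ x = j + 1 := by
    intro x hx
    rcases cryE_cases j w with e | ⟨i, _, e⟩
    · rw [e] at hx; exact Or.inl hx
    · rw [e] at hx; exact List.mem_or_eq_of_mem_set hx
  have hlen : (cryE j w).length = w.length := by
    rcases cryE_cases j w with e | ⟨i, _, e⟩ <;> simp [e]
  obtain ⟨a1, a2⟩ := Q_eq hw hsum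
  obtain ⟨b1, b2⟩ := Q_eq (w := cryE j w) (K := j + 2 + w.sum)
    (fun x hx => by rcases hmem x hx with h | h; exacts [hw x h, by omega])
    (fun x hx => by rcases hmem x hx with h | h; exacts [hsum x h, by omega])
  have hP := cry_stdTimes j (j + 2 + w.sum) w (by omega)
  have hn := (stdTimes_ord (j + 2 + w.sum) (cryE j w)).nodup
  rw [a1, a2, b1, b2, hlen, rowFold_plac hP _ hn (fun _ _ => rfl), mFold_plac hP hn]
  exact ⟨rfl, rfl⟩
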